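/- arXiv:2605.20705 — 2 statements merged into one kernel-verified Lean document; each statement's English description precedes it below -/
import Mathlib

section
/- For all integers k ≥ 1 and s ≥ k+2 and every real δ > 0 there exists α > 0 such that the following holds for every integer N ≥ 1: let H be a (k+1)-uniform hypergraph on an N-element vertex set V, i.e., a family of (k+1)-element subsets of V. If there exists a family F of s-element subsets of V with |F| ≥ δ·N^(k+1) such that (i) every member S of F spans a clique in H (every (k+1)-element subset of S is an edge of H), and (ii) any two distinct members of F share at most k vertices (so their cliques are edge-disjoint), then the total number of s-element subsets of V spanning cliques in H is at least α·N^s. -/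
open scoped Classical

namespace HSat
set_option linter.unusedSectionVars false
open MeasureTheory Filter Topology ENNReal

/-! ### Part 1: internal sets and the Loeb measure -/

/-- The (unquotiented) ultraproduct of the spaces `ι → V n`. -/
def Om (ι : Type) (V : ℕ → Type) : Type := ∀ n, ι → V n

noncomputable def UF : Ultrafilter ℕ := hyperfilter ℕ

section
variable {ι : Type} {V : ℕ → Type}

def intl (A : ∀ n, Set (ι → V n)) : Set (Om ι V) :=
  {x | ∀ᶠ n in (UF : Filter ℕ), x n ∈ A n}

def Dep (e : Finset ι) (A : ∀ n, Set (ι → V n)) : Prop :=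
  ∀ n x y, (∀ i ∈ e, x i = y i) → x ∈ A n → y ∈ A n

def IA (V : ℕ → Type) (e : Finset ι) : Set (Set (Om ι V)) :=
  {S | ∃ A, Dep e A ∧ S = intl A}

theorem mem_intl {A : ∀ n, Set (ι → V n)} {x : Om ι V} :
    x ∈ intl A ↔ ∀ᶠ n in (UF : Filter ℕ), x n ∈ A n := Iff.rfl

theorem intl_compl (A : ∀ n, Set (ι → V n)) : (intl A)ᶜ = intl (fun n => (A n)ᶜ) := by
  ext x
  simp only [Set.mem_compl_iff, mem_intl, Ultrafilter.eventually_not]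

theorem intl_union (A B : ∀ n, Set (ι → V n)) :
    intl A ∪ intl B = intl (fun n => A n ∪ B n) := by
  ext x
  simp only [Set.mem_union, mem_intl, Ultrafilter.eventually_or]

theorem intl_inter (A B : ∀ n, Set (ι → V n)) :
    intl A ∩ intl B = intl (fun n => A n ∩ B n) := by
  ext x
  simp only [Set.mem_inter_iff, mem_intl, eventually_and]

theorem intl_diff (A B : ∀ n, Set (ι → V n)) :
    intl A \ intl B = intl (fun n => A n \ B n) := by
  rw [Set.sdiff_eq, intl_compl, intl_inter]; rfl

theorem intl_empty : intl (fun n => (∅ : Set (ι → V n))) = ∅ := by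
  ext x
  simp [mem_intl, UF.neBot.ne]

theorem intl_univ : intl (fun n => (Set.univ : Set (ι → V n))) = Set.univ := by
  ext x
  simp [mem_intl]

theorem Dep.compl {e : Finset ι} {A : ∀ n, Set (ι → V n)} (h : Dep e A) :
    Dep e (fun n => (A n)ᶜ) :=
  fun n x y hxy hx hy => hx (h n y x (fun i hi => (hxy i hi).symm) hy)

theorem IA_alg (e : Finset ι) : IsSetAlgebra (IA V e) where
  empty_mem := ⟨fun _ => ∅, fun _ _ _ _ h => h, intl_empty.symm⟩
  compl_mem := by
    rintro _ ⟨A, hA, rfl⟩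
    exact ⟨_, hA.compl, intl_compl A⟩
  union_mem := by
    rintro _ _ ⟨A, hA, rfl⟩ ⟨B, hB, rfl⟩
    exact ⟨_, fun n x y hxy h => h.imp (hA n x y hxy) (hB n x y hxy), intl_union A B⟩

theorem IA_mono {e f : Finset ι} (h : e ⊆ f) : IA V e ⊆ IA V f := by
  rintro _ ⟨A, hA, rfl⟩
  exact ⟨A, fun n x y hxy => hA n x y (fun i hi => hxy i (h hi)), rfl⟩

theorem intl_mem_univ [Fintype ι] (A : ∀ n, Set (ι → V n)) : intl A ∈ IA V Finset.univ :=
  ⟨A, fun n x y hxy h => by rwa [← funext (fun i => hxy i (Finset.mem_univ i))], rfl⟩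

theorem intl_subset [∀ n, Nonempty (V n)] {A B : ∀ n, Set (ι → V n)} (h : intl A ⊆ intl B) :
    ∀ᶠ n in (UF : Filter ℕ), A n ⊆ B n := by
  by_contra hc
  rw [← Ultrafilter.eventually_not] at hc
  have : ∀ n, ∃ x : ι → V n, ¬ A n ⊆ B n → x ∈ A n ∧ x ∉ B n := by
    intro n
    by_cases hn : A n ⊆ B n
    · exact ⟨fun _ => Classical.arbitrary _, fun h => absurd hn h⟩
    · obtain ⟨x, hx, hx'⟩ := Set.not_subset.1 hn
      exact ⟨x, fun _ => ⟨hx, hx'⟩⟩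
  choose x hx using this
  have h1 : (x : Om ι V) ∈ intl A := hc.mono fun n hn => (hx n hn).1
  have h2 : (x : Om ι V) ∈ intl B := h h1
  have := (hc.and h2).exists
  obtain ⟨n, hn, hn'⟩ := this
  exact (hx n hn).2 hn'

theorem saturation [∀ n, Nonempty (V n)] (B : ∀ n, Set (ι → V n)) (A : ℕ → ∀ n, Set (ι → V n))
    (h : intl B ⊆ ⋃ i, intl (A i)) : ∃ k, intl B ⊆ ⋃ i ∈ Finset.range k, intl (A i) := by
  by_contra! hc
  let C : ℕ → ∀ n, Set (ι → V n) := fun k n => {x | x ∈ B n ∧ ∀ i < k, x ∉ A i n}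
  have hC : ∀ k, ∀ᶠ n in (UF : Filter ℕ), (C k n).Nonempty := by
    intro k
    obtain ⟨x, hx, hx'⟩ := Set.not_subset.1 (hc k)
    have h1 : ∀ i ∈ Finset.range k, ∀ᶠ n in (UF : Filter ℕ), x n ∉ A i n := by
      intro i hi
      rw [Ultrafilter.eventually_not]
      intro h
      exact hx' (Set.mem_biUnion (x := i) hi h)
    have h2 := (Filter.eventually_all_finset (Finset.range k)).2 h1
    filter_upwards [hx, h2] with n hn hn2
    exact ⟨x n, hn, fun i hi => hn2 i (Finset.mem_range.2 hi)⟩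
  have : ∀ n, ∃ x : ι → V n, ∀ j ≤ n, (C j n).Nonempty → x ∈ C j n := by
    intro n
    by_cases hn : ∃ j ≤ n, (C j n).Nonempty
    · have hs : ((Finset.range (n+1)).filter (fun j => (C j n).Nonempty)).Nonempty := by
        obtain ⟨j, hj, hj'⟩ := hn
        exact ⟨j, by simp [hj']; omega⟩
      obtain ⟨k, hk, hmax⟩ := Finset.exists_max_image _ id hs
      obtain ⟨x, hx⟩ := (Finset.mem_filter.1 hk).2
      refine ⟨x, fun j hj hj' => ?_⟩
      have : j ≤ k := hmax j (by simp [hj']; omega)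
      exact ⟨hx.1, fun i hi => hx.2 i (by omega)⟩
    · push Not at hn
      exact ⟨fun _ => Classical.arbitrary _, fun j hj h => absurd h (by simp [hn j hj])⟩
  choose x hx using this
  have hxC : ∀ j, ∀ᶠ n in (UF : Filter ℕ), x n ∈ C j n := by
    intro j
    have hj : ∀ᶠ n in (UF : Filter ℕ), j ≤ n :=
      (Nat.hyperfilter_le_atTop) (eventually_ge_atTop j)
    filter_upwards [hC j, hj] with n h1 h2
    exact hx n j h2 h1
  have h1 : (x : Om ι V) ∈ intl B := (hxC 0).mono fun n h => h.1
  obtain ⟨i, hi⟩ := Set.mem_iUnion.1 (h h1)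
  obtain ⟨n, hn, hn'⟩ := ((hxC (i+1)).and hi).exists
  exact hn.2 i (by omega) hn'

/-! averages -/

noncomputable def avg {α : Type} [Fintype α] (f : α → ℝ) : ℝ := (∑ x, f x) / Fintype.card α

noncomputable def dens {α : Type} [Fintype α] (A : Set α) : ℝ := avg (A.indicator 1)

theorem avg_mono {α : Type} [Fintype α] {f g : α → ℝ} (h : ∀ x, f x ≤ g x) : avg f ≤ avg g := by
  unfold avg
  gcongr
  exact h _

theorem avg_add {α : Type} [Fintype α] (f g : α → ℝ) : avg (f + g) = avg f + avg g := by
  simp [avg, Finset.sum_add_distrib, add_div]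

theorem avg_smul {α : Type} [Fintype α] (c : ℝ) (g : α → ℝ) :
    avg (fun x => c * g x) = c * avg g := by
  simp [avg, ← Finset.mul_sum, mul_div_assoc]

theorem dens_nonneg {α : Type} [Fintype α] (A : Set α) : 0 ≤ dens A := by
  unfold dens avg
  have : ∀ x, 0 ≤ A.indicator (1 : α → ℝ) x := fun x => Set.indicator_nonneg (by simp) x
  exact div_nonneg (Finset.sum_nonneg fun x _ => this x) (by positivity)

theorem dens_univ {α : Type} [Fintype α] [Nonempty α] : dens (Set.univ : Set α) = 1 := by
  simp [dens, avg]

theorem dens_empty {α : Type} [Fintype α] : dens (∅ : Set α) = 0 := by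
  simp [dens, avg]

theorem dens_union {α : Type} [Fintype α] {A B : Set α} (h : Disjoint A B) :
    dens (A ∪ B) = dens A + dens B := by
  unfold dens
  rw [← avg_add, Set.indicator_union_of_disjoint h]; rfl

theorem dens_eq {α : Type} [Fintype α] (A : Set α) :
    dens A = ((Finset.univ.filter (· ∈ A)).card : ℝ) / Fintype.card α := by
  unfold dens avg
  congr 1
  simp [Set.indicator_apply]

end

section
variable {ι : Type} [Fintype ι] {V : ℕ → Type} [∀ n, Fintype (V n)] [∀ n, Nonempty (V n)]

/-- ultralimit of densities -/
noncomputable def ulim (A : ∀ n, Set (ι → V n)) : ℝ≥0∞ :=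
  (UF.map (fun n => ENNReal.ofReal (dens (A n)))).lim

theorem ulim_tendsto (A : ∀ n, Set (ι → V n)) :
    Tendsto (fun n => ENNReal.ofReal (dens (A n))) UF (𝓝 (ulim A)) :=
  (UF.map (fun n => ENNReal.ofReal (dens (A n)))).le_nhds_lim

theorem ulim_congr {A B : ∀ n, Set (ι → V n)} (h : intl A = intl B) : ulim A = ulim B := by
  have h1 := intl_subset h.le
  have h2 := intl_subset h.ge
  refine tendsto_nhds_unique ((ulim_tendsto A).congr' ?_) (ulim_tendsto B)
  filter_upwards [h1, h2] with n h1 h2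
  rw [h1.antisymm h2]

noncomputable def cont (S : Set (Om ι V)) : ℝ≥0∞ :=
  if h : ∃ A, S = intl A then ulim h.choose else 0

theorem cont_intl (A : ∀ n, Set (ι → V n)) : cont (intl A) = ulim A := by
  have h : ∃ B, intl A = intl B := ⟨A, rfl⟩
  rw [cont, dif_pos h]
  exact ulim_congr h.choose_spec.symm

instance omMS : MeasurableSpace (Om ι V) := MeasurableSpace.generateFrom (IA V Finset.univ)

noncomputable def content : AddContent ℝ≥0∞ (IA V (Finset.univ : Finset ι)) :=
  (IA_alg (V := V) Finset.univ).isSetRing.addContent_of_union cont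
    (by
      rw [← intl_empty, cont_intl]
      refine tendsto_nhds_unique (ulim_tendsto _) ?_
      simp [dens_empty])
    (by
      rintro _ _ ⟨A, hA, rfl⟩ ⟨B, hB, rfl⟩ hd
      rw [intl_union, cont_intl, cont_intl, cont_intl]
      refine tendsto_nhds_unique (ulim_tendsto _)
        (((ulim_tendsto A).add (ulim_tendsto B)).congr' ?_)
      have : intl (fun n => A n ∩ B n) ⊆ intl (fun n => ∅) := by
        rw [← intl_inter, hd.inter_eq, intl_empty]
      filter_upwards [intl_subset this] with n hn
      rw [dens_union (Set.disjoint_iff.2 hn),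
        ENNReal.ofReal_add (dens_nonneg _) (dens_nonneg _)])

theorem content_apply (S : Set (Om ι V)) : content S = cont S := rfl

theorem content_sub : (content (ι := ι) (V := V)).IsSigmaSubadditive := by
  intro f hf hU
  choose A hA hfA using hf
  obtain ⟨B, hB, hfB⟩ := hU
  obtain ⟨k, hk⟩ := saturation B A (by rw [← hfB]; exact Set.iUnion_mono fun i => (hfA i).le)
  have : (⋃ i, f i) = ⋃ i ∈ Finset.range k, f i := by
    apply Set.Subset.antisymm
    · rw [hfB]; simpa only [hfA] using hk
    · exact Set.iUnion₂_subset fun i _ => Set.subset_iUnion f i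
  rw [this]
  refine (addContent_biUnion_le (IA_alg (V := V) Finset.univ).isSetRing
    (fun i _ => ⟨A i, hA i, hfA i⟩)).trans ?_
  exact ENNReal.sum_le_tsum _

noncomputable def loeb : Measure (Om ι V) :=
  (content (ι := ι) (V := V)).measure (IA_alg (V := V) Finset.univ).isSetRing.isSetSemiring
    le_rfl content_sub

theorem loeb_intl (A : ∀ n, Set (ι → V n)) : loeb (intl A) = ulim A := by
  rw [loeb, AddContent.measure_eq _ _ rfl _ (intl_mem_univ A), content_apply, cont_intl]

instance : IsProbabilityMeasure (loeb (ι := ι) (V := V)) where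
  measure_univ := by
    rw [← intl_univ, loeb_intl]
    refine tendsto_nhds_unique (ulim_tendsto _) ?_
    simp [dens_univ]

theorem tendsto_dens (A : ∀ n, Set (ι → V n)) :
    Tendsto (fun n => dens (A n)) UF (𝓝 (loeb.real (intl A))) := by
  have h := (ENNReal.tendsto_toReal (measure_ne_top loeb (intl A))).comp
    (loeb_intl A ▸ ulim_tendsto A)
  refine h.congr fun n => ?_
  simp [ENNReal.toReal_ofReal (dens_nonneg _)]

end
end HSat

namespace HSat
set_option linter.unusedSectionVars false
open MeasureTheory Filter Topology ENNReal

/-! ### Part 2: the independence lemma -/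

section
variable {ι : Type} {V : Type}

noncomputable def glue (e : Finset ι) (x y : ι → V) : ι → V := fun i => if i ∈ e then x i else y i

theorem glue_glue (e : Finset ι) (x y : ι → V) : glue e (glue e x y) (glue e y x) = x := by
  funext i
  by_cases h : i ∈ e <;> simp [glue, h]

theorem exists_slice [Fintype ι] [Fintype V] [Nonempty V] (e : Finset ι) (g : (ι → V) → ℝ)
    (hg : ∀ x y, (∀ i ∈ e, x i = y i) → g x = g y) (H : Set (ι → V)) :
    ∃ y, avg (H.indicator g) ≤ avg ({x | glue e x y ∈ H}.indicator g) := by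
  have key : ∑ y : ι → V, ∑ x, H.indicator g x
      = ∑ y : ι → V, ∑ x, {x | glue e x y ∈ H}.indicator g x := by
    rw [← Fintype.sum_prod_type', ← Fintype.sum_prod_type']
    let φ : (ι → V) × (ι → V) → (ι → V) × (ι → V) := fun p => (glue e p.1 p.2, glue e p.2 p.1)
    have hφ : Function.Involutive φ := by
      rintro ⟨x, y⟩
      simp [φ, glue_glue]
    rw [← Equiv.sum_comp (hφ.toPerm φ)]
    have hswap : ∀ p : (ι → V) × (ι → V), hφ.toPerm φ p = φ p := fun p => rfl
    refine Finset.sum_congr rfl fun p _ => ?_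
    simp only [hswap, φ]
    have : g (glue e p.1 p.2) = g p.1 := hg _ _ fun i hi => by simp [glue, hi]
    have h2 : g (glue e p.2 p.1) = g p.2 := hg _ _ fun i hi => by simp [glue, hi]
    simp only [Set.indicator_apply, Set.mem_ofPred_eq, this, h2]
  obtain ⟨y, -, hy⟩ := Finset.exists_le_of_sum_le Finset.univ_nonempty key.le
  exact ⟨y, by unfold avg; gcongr⟩

end

section
variable {ι : Type} [Fintype ι] {V : ℕ → Type} [∀ n, Fintype (V n)] [∀ n, Nonempty (V n)]

@[reducible] def BB (V : ℕ → Type) (e : Finset ι) : MeasurableSpace (Om ι V) :=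
  MeasurableSpace.generateFrom (IA V e)

theorem BB_mono {e f : Finset ι} (h : e ⊆ f) : BB V e ≤ BB V f :=
  MeasurableSpace.generateFrom_mono (IA_mono h)

theorem BB_le (e : Finset ι) : BB V e ≤ omMS :=
  BB_mono (Finset.subset_univ e)

@[reducible] def Low (V : ℕ → Type) (e : Finset ι) (i : ℕ) : MeasurableSpace (Om ι V) :=
  ⨆ h ∈ {h : Finset ι | h ⊆ e ∧ h.card < i}, BB V h

@[reducible] def Off (V : ℕ → Type) (e : Finset ι) (i : ℕ) : MeasurableSpace (Om ι V) :=
  ⨆ h ∈ {h : Finset ι | (h ∩ e).card < i}, BB V h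

theorem BB_le_Low {h e : Finset ι} {i : ℕ} (h1 : h ⊆ e) (h2 : h.card < i) :
    BB V h ≤ Low V e i :=
  le_iSup₂_of_le (f := fun h _ => BB V h) h ⟨h1, h2⟩ le_rfl

theorem BB_le_Off {h e : Finset ι} {i : ℕ} (h2 : (h ∩ e).card < i) :
    BB V h ≤ Off V e i :=
  le_iSup₂_of_le (f := fun h _ => BB V h) h h2 le_rfl

theorem Low_le_BB (e : Finset ι) (i : ℕ) : Low V e i ≤ BB V e :=
  iSup₂_le fun _ hh => BB_mono hh.1

theorem Low_le (e : Finset ι) (i : ℕ) :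
    Low V e i ≤ omMS :=
  (Low_le_BB e i).trans (BB_le e)

theorem Off_le (e : Finset ι) (i : ℕ) :
    Off V e i ≤ omMS :=
  iSup₂_le fun h _ => BB_le h

theorem Low_mono {e f : Finset ι} (h : e ⊆ f) (i : ℕ) : Low V e i ≤ Low V f i :=
  iSup₂_le fun _ hg => BB_le_Low (hg.1.trans h) hg.2

theorem Low_le_Off' (f e : Finset ι) (i : ℕ) : Low V f i ≤ Off V e i :=
  iSup₂_le fun _ hg => BB_le_Off
    (lt_of_le_of_lt (Finset.card_le_card Finset.inter_subset_left) hg.2)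

/-- approximation by sets of a generating algebra -/
theorem approx {𝒜 : Set (Set (Om ι V))} (h𝒜 : IsSetAlgebra 𝒜)
    {m : MeasurableSpace (Om ι V)} (hm : m = MeasurableSpace.generateFrom 𝒜)
    (hle : m ≤ omMS) {S : Set (Om ι V)}
    (hS : MeasurableSet[m] S) {ε : ℝ} (hε : 0 < ε) :
    ∃ t ∈ 𝒜, loeb (symmDiff S t) < ENNReal.ofReal ε := by
  have : IsFiniteMeasure (loeb.trim hle) := isFiniteMeasure_trim hle
  have hd := @Measure.MeasureDense.of_generateFrom_isSetAlgebra_finite _ m (loeb.trim hle) 𝒜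
    this h𝒜 hm
  obtain ⟨t, ht, h⟩ := hd.approx S hS (measure_ne_top _ _) ε hε
  refine ⟨t, ht, ?_⟩
  rwa [trim_measurableSet_eq] at h
  exact MeasurableSet.symmDiff hS (hd.measurable t ht)

theorem meas_intl (A : ∀ n, Set (ι → V n)) : MeasurableSet (intl A) :=
  MeasurableSpace.measurableSet_generateFrom (intl_mem_univ A)

def PP (e : Finset ι) (g : Om ι V → ℝ) : Prop :=
  ∃ G : ∀ n, (ι → V n) → ℝ, (∀ n x y, (∀ i ∈ e, x i = y i) → G n x = G n y) ∧
    StronglyMeasurable[BB V e] g ∧ Integrable g loeb ∧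
    ∀ H : ∀ n, Set (ι → V n), Tendsto (fun n => avg ((H n).indicator (G n))) UF
      (𝓝 (∫ x in intl H, g x ∂loeb))

theorem PP.add {e : Finset ι} {f g : Om ι V → ℝ} (hf : PP e f) (hg : PP e g) :
    PP e (f + g) := by
  obtain ⟨F, F1, F2, F3, F4⟩ := hf
  obtain ⟨G, G1, G2, G3, G4⟩ := hg
  refine ⟨fun n => F n + G n, fun n x y h => by simp [F1 n x y h, G1 n x y h], F2.add G2,
    F3.add G3, fun H => ?_⟩
  have : ∫ x in intl H, (f + g) x ∂loeb = ∫ x in intl H, f x ∂loeb + ∫ x in intl H, g x ∂loeb :=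
    integral_add F3.integrableOn G3.integrableOn
  rw [this]
  refine ((F4 H).add (G4 H)).congr fun n => ?_
  rw [← avg_add]; exact congrArg avg (Set.indicator_add' (H n) (F n) (G n)).symm

theorem PP_indicator {e : Finset ι} {S : Set (Om ι V)} (hS : S ∈ IA V e) (c : ℝ) :
    PP e (S.indicator fun _ => c) := by
  have hSm : MeasurableSet[BB V e] S := MeasurableSpace.measurableSet_generateFrom hS
  obtain ⟨A, hA, rfl⟩ := hS
  refine ⟨fun n => (A n).indicator fun _ => c, ?_, stronglyMeasurable_const.indicator hSm,
    (integrable_const c).indicator (BB_le e _ hSm), ?_⟩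
  · intro n x y h
    have : x ∈ A n ↔ y ∈ A n := ⟨hA n x y h, hA n y x fun i hi => (h i hi).symm⟩
    simp [Set.indicator_apply, this]
  · intro H
    rw [setIntegral_indicator (meas_intl A), setIntegral_const, intl_inter, smul_eq_mul, mul_comm]
    refine ((tendsto_dens _).const_mul c).congr fun n => ?_
    rw [dens, ← avg_smul]
    congr 1
    funext x
    simp only [Set.indicator_apply, Set.mem_inter_iff, Pi.one_apply]
    split_ifs <;> simp_all

theorem PP.slice {e : Finset ι} {g : Om ι V → ℝ} (hg : PP e g) (H : ∀ n, Set (ι → V n)) :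
    ∃ y : Om ι V, ∫ x in intl H, g x ∂loeb ≤
      ∫ x in intl (fun n => {x | glue e x (y n) ∈ H n}), g x ∂loeb := by
  obtain ⟨G, G1, G2, G3, G4⟩ := hg
  choose y hy using fun n => exists_slice e (G n) (G1 n) (H n)
  exact ⟨y, le_of_tendsto_of_tendsto' (G4 H) (G4 _) hy⟩

theorem PP_dense {e : Finset ι} {f : Om ι V → ℝ} (hf : StronglyMeasurable[BB V e] f)
    (hfi : Integrable f loeb) {ε : ℝ} (hε : 0 < ε) :
    ∃ g, PP e g ∧ ∫ x, |f x - g x| ∂loeb ≤ ε := by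
  have hle := BB_le (V := V) e
  have hfL : @MemLp _ _ (BB V e) _ _ f 1 (loeb.trim hle) := by
    refine ⟨hf.aestronglyMeasurable, ?_⟩
    rw [eLpNorm_trim hle hf]
    exact (memLp_one_iff_integrable.2 hfi).2
  obtain ⟨g, hg, hPg⟩ := @MemLp.induction_dense _ _ (BB V e) _ 1 (loeb.trim hle) (by simp) (PP e)
    (by
      intro c s hs _ ε hε
      by_cases hεt : ε = ∞
      · exact ⟨_, by simp [hεt], PP_indicator (IA_alg e).empty_mem 0⟩
      have hε' : 0 < ε.toReal := ENNReal.toReal_pos hε hεt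
      obtain ⟨t, ht, hst⟩ := approx (IA_alg e) rfl hle hs
        (ε := ε.toReal / (|c| + 1)) (by positivity)
      have htm : MeasurableSet[BB V e] t := MeasurableSpace.measurableSet_generateFrom ht
      refine ⟨t.indicator fun _ => c, ?_, PP_indicator ht c⟩
      rw [eLpNorm_trim hle ((stronglyMeasurable_const.indicator htm).sub
        (stronglyMeasurable_const.indicator hs)), eLpNorm_one_eq_lintegral_enorm]
      calc ∫⁻ x, ‖(t.indicator (fun _ => c) - s.indicator fun _ => c) x‖ₑ ∂loeb
          ≤ ∫⁻ x, (symmDiff s t).indicator (fun _ => ENNReal.ofReal |c|) x ∂loeb := by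
            refine lintegral_mono fun x => ?_
            simp only [Pi.sub_apply, Set.indicator_apply, Set.mem_symmDiff]
            by_cases h1 : x ∈ s <;> by_cases h2 : x ∈ t <;>
              simp [h1, h2, Real.enorm_eq_ofReal_abs]
        _ = ENNReal.ofReal |c| * loeb (symmDiff s t) :=
            lintegral_indicator_const (hle _ (hs.symmDiff htm)) _
        _ ≤ ENNReal.ofReal |c| * ENNReal.ofReal (ε.toReal / (|c| + 1)) := by gcongr
        _ = ENNReal.ofReal (|c| * (ε.toReal / (|c| + 1))) := by
            rw [ENNReal.ofReal_mul (abs_nonneg c)]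
        _ ≤ ENNReal.ofReal ε.toReal := by
            apply ENNReal.ofReal_le_ofReal
            have := abs_nonneg c
            rw [← mul_div_assoc, div_le_iff₀ (by positivity)]
            nlinarith
        _ = ε := ENNReal.ofReal_toReal hεt)
    (fun f g hf hg => hf.add hg) (fun f hf => hf.choose_spec.2.1.aestronglyMeasurable)
    f hfL (ENNReal.ofReal ε) (by simpa using hε)
  refine ⟨g, hPg, ?_⟩
  obtain ⟨G, G1, G2, G3, G4⟩ := hPg
  rw [eLpNorm_trim hle (hf.sub G2), eLpNorm_one_eq_lintegral_enorm] at hg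
  have := integral_norm_eq_lintegral_enorm (hfi.sub G3).aestronglyMeasurable
  have h2 : ∫ x, |f x - g x| ∂loeb = (∫⁻ x, ‖(f - g) x‖ₑ ∂loeb).toReal := this
  rw [h2]
  exact ENNReal.toReal_le_of_le_ofReal hε.le hg

theorem set_diff_le {f g : Om ι V → ℝ} (hf : Integrable f loeb) (hg : Integrable g loeb)
    (S : Set (Om ι V)) :
    ∫ x in S, f x ∂loeb ≤ ∫ x in S, g x ∂loeb + ∫ x, |f x - g x| ∂loeb := by
  have h1 : ∫ x in S, f x ∂loeb - ∫ x in S, g x ∂loeb = ∫ x in S, (f x - g x) ∂loeb :=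
    (integral_sub hf.integrableOn hg.integrableOn).symm
  have h2 : ∫ x in S, (f x - g x) ∂loeb ≤ ∫ x in S, |f x - g x| ∂loeb :=
    integral_mono (hf.sub hg).integrableOn (hf.sub hg).abs.integrableOn fun x => le_abs_self _
  have h3 : ∫ x in S, |f x - g x| ∂loeb ≤ ∫ x, |f x - g x| ∂loeb :=
    setIntegral_le_integral (hf.sub hg).abs (Eventually.of_forall fun x => abs_nonneg _)
  linarith

theorem slice_le {e : Finset ι} {f : Om ι V → ℝ} (hf : StronglyMeasurable[BB V e] f)
    (hfi : Integrable f loeb) (H : ∀ n, Set (ι → V n)) {ε : ℝ} (hε : 0 < ε) :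
    ∃ y : Om ι V, ∫ x in intl H, f x ∂loeb ≤
      ∫ x in intl (fun n => {x | glue e x (y n) ∈ H n}), f x ∂loeb + ε := by
  obtain ⟨g, hg, hfg⟩ := PP_dense hf hfi (half_pos hε)
  obtain ⟨y, hy⟩ := hg.slice H
  refine ⟨y, ?_⟩
  have hgi := hg.choose_spec.2.2.1
  have h1 := set_diff_le hfi hgi (intl H)
  have h2 := set_diff_le hgi hfi (intl (fun n => {x | glue e x (y n) ∈ H n}))
  have h3 : ∫ x, |g x - f x| ∂loeb = ∫ x, |f x - g x| ∂loeb := by simp_rw [abs_sub_comm]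
  linarith

/-- π-system generating `Off` -/
def OffPi (V : ℕ → Type) (e : Finset ι) (i : ℕ) : Set (Set (Om ι V)) :=
  {S | ∃ A : Finset ι → ∀ n, Set (ι → V n), (∀ h, Dep h (A h)) ∧
    S = intl (fun n => {x | ∀ h : Finset ι, (h ∩ e).card < i → x ∈ A h n})}

theorem OffPi_eq {e : Finset ι} {i : ℕ} (A : Finset ι → ∀ n, Set (ι → V n)) :
    intl (fun n => {x | ∀ h : Finset ι, (h ∩ e).card < i → x ∈ A h n})
     = ⋂ h : Finset ι, ⋂ _ : (h ∩ e).card < i, intl (A h) := by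
  ext x
  simp only [mem_intl, Set.mem_iInter, Set.mem_ofPred_eq, eventually_all]

theorem OffPi_isPi (e : Finset ι) (i : ℕ) : IsPiSystem (OffPi V e i) := by
  rintro _ ⟨A, hA, rfl⟩ _ ⟨B, hB, rfl⟩ _
  refine ⟨fun h n => A h n ∩ B h n,
    fun h n x y hxy hx => ⟨hA h n x y hxy hx.1, hB h n x y hxy hx.2⟩, ?_⟩
  rw [intl_inter]
  congr 1
  funext n
  ext x
  simp only [Set.mem_inter_iff, Set.mem_ofPred_eq]
  exact ⟨fun h k hk => ⟨h.1 k hk, h.2 k hk⟩, fun h => ⟨fun k hk => (h k hk).1,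
    fun k hk => (h k hk).2⟩⟩

theorem Off_eq (e : Finset ι) (i : ℕ) :
    Off V e i = MeasurableSpace.generateFrom (OffPi V e i) := by
  apply le_antisymm
  · refine iSup₂_le fun h hh => MeasurableSpace.generateFrom_mono ?_
    rintro _ ⟨A, hA, rfl⟩
    refine ⟨fun h' n => if h' = h then A n else Set.univ, ?_, ?_⟩
    · intro h' n x y hxy
      by_cases h1 : h' = h
      · subst h1; simpa using hA n x y hxy
      · simp [h1]
    · congr 1
      funext n
      ext x
      simp only [Set.mem_ofPred_eq]
      constructor
      · intro hx h' _
        by_cases h1 : h' = h <;> simp [h1, hx]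
      · intro hx
        simpa using hx h hh
  · refine MeasurableSpace.generateFrom_le ?_
    rintro _ ⟨A, hA, rfl⟩
    rw [OffPi_eq]
    refine MeasurableSet.iInter fun h => MeasurableSet.iInter fun hh => ?_
    exact BB_le_Off hh _ (MeasurableSpace.measurableSet_generateFrom ⟨A h, hA h, rfl⟩)

theorem slice_meas {e : Finset ι} {i : ℕ} (A : Finset ι → ∀ n, Set (ι → V n))
    (hA : ∀ h, Dep h (A h)) (y : Om ι V) :
    MeasurableSet[Low V e i] (intl (fun n => {x | glue e x (y n) ∈
      {x | ∀ h : Finset ι, (h ∩ e).card < i → x ∈ A h n}})) := by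
  have : intl (fun n => {x | glue e x (y n) ∈ {x | ∀ h : Finset ι, (h ∩ e).card < i → x ∈ A h n}})
      = ⋂ h : Finset ι, ⋂ _ : (h ∩ e).card < i, intl (fun n => {x | glue e x (y n) ∈ A h n}) := by
    ext x
    simp only [mem_intl, Set.mem_iInter, Set.mem_ofPred_eq, eventually_all]
  rw [this]
  refine MeasurableSet.iInter fun h => MeasurableSet.iInter fun hh => ?_
  refine BB_le_Low (h := h ∩ e) Finset.inter_subset_right hh _
    (MeasurableSpace.measurableSet_generateFrom ⟨_, ?_, rfl⟩)
  intro n x x' hxx hx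
  refine hA h n _ _ ?_ hx
  intro j hj
  by_cases hje : j ∈ e
  · simp [glue, hje, hxx j (Finset.mem_inter.2 ⟨hj, hje⟩)]
  · simp [glue, hje]

theorem zero_on_Off {e : Finset ι} {i : ℕ} {k : Om ι V → ℝ} (hk : StronglyMeasurable[BB V e] k)
    (hki : Integrable k loeb)
    (h0 : ∀ S, MeasurableSet[Low V e i] S → ∫ x in S, k x ∂loeb = 0)
    {S : Set (Om ι V)} (hS : MeasurableSet[Off V e i] S) : ∫ x in S, k x ∂loeb = 0 := by
  have base : ∀ k : Om ι V → ℝ, StronglyMeasurable[BB V e] k → Integrable k loeb →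
    (∀ S, MeasurableSet[Low V e i] S → ∫ x in S, k x ∂loeb = 0) → ∀ t ∈ OffPi V e i,
      ∫ x in t, k x ∂loeb ≤ 0 := by
    rintro k hk hki h0 _ ⟨A, hA, rfl⟩
    refine le_of_forall_pos_le_add fun ε hε => ?_
    obtain ⟨y, hy⟩ := slice_le hk hki _ hε
    rwa [h0 _ (slice_meas A hA y)] at hy
  have huniv : ∫ x, k x ∂loeb = 0 := by simpa using h0 Set.univ MeasurableSet.univ
  refine MeasurableSpace.induction_on_inter (C := fun S _ => ∫ x in S, k x ∂loeb = 0)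
    (Off_eq e i) (OffPi_isPi e i) (by simp) ?_ ?_ ?_ S hS
  · intro t ht
    refine le_antisymm (base k hk hki h0 t ht) ?_
    have := base (fun x => - k x) hk.neg hki.neg
      (fun S hS => by rw [integral_neg, h0 S hS, neg_zero]) t ht
    rw [integral_neg] at this
    linarith
  · intro t ht h
    have := integral_add_compl (Off_le e i _ ht) hki
    linarith
  · intro f hd hm h
    rw [integral_iUnion (fun j => Off_le e i _ (hm j)) hd hki.integrableOn]
    simp [h]

/-- The independence lemma. -/
theorem condExp_Off {e : Finset ι} {g : Om ι V → ℝ} (i : ℕ) (hg : StronglyMeasurable[BB V e] g)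
    (hgi : Integrable g loeb) :
    loeb[g | Low V e i] =ᵐ[loeb] loeb[g | Off V e i] := by
  refine ae_eq_condExp_of_forall_setIntegral_eq (Off_le e i) hgi
    (fun s _ _ => integrable_condExp.integrableOn) ?_ ?_
  · intro s hs _
    have h := zero_on_Off (e := e) (i := i) (k := fun x => g x - (loeb[g | Low V e i]) x)
      (hg.sub (stronglyMeasurable_condExp.mono (Low_le_BB e i)))
      (hgi.sub integrable_condExp) (fun S hS => by
        rw [integral_sub hgi.integrableOn integrable_condExp.integrableOn,
          setIntegral_condExp (Low_le e i) hgi hS, sub_self]) hs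
    rw [integral_sub hgi.integrableOn integrable_condExp.integrableOn] at h
    linarith
  · exact (stronglyMeasurable_condExp.mono (Low_le_Off' e e i)).aestronglyMeasurable

/-- integrated form -/
theorem integral_mul_condExp {e : Finset ι} {i : ℕ} {g W : Om ι V → ℝ}
    (hg : StronglyMeasurable[BB V e] g) (hgi : Integrable g loeb)
    (hW : StronglyMeasurable[Off V e i] W) (hWg : Integrable (W * g) loeb) :
    ∫ x, W x * g x ∂loeb = ∫ x, W x * (loeb[g | Low V e i]) x ∂loeb := by
  have h1 : ∫ x, (W * g) x ∂loeb = ∫ x, (loeb[W * g | Off V e i]) x ∂loeb :=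
    (integral_condExp (Off_le e i)).symm
  have h2 := condExp_mul_of_stronglyMeasurable_left hW hWg hgi
  have h3 := condExp_Off i hg hgi
  calc ∫ x, W x * g x ∂loeb = ∫ x, (loeb[W * g | Off V e i]) x ∂loeb := h1
    _ = ∫ x, W x * (loeb[g | Low V e i]) x ∂loeb := by
      refine integral_congr_ae ?_
      filter_upwards [h2, h3] with x h2 h3
      rw [h2, h3]; rfl

end
end HSat

namespace HSat
set_option linter.unusedSectionVars false
open MeasureTheory Filter Topology ENNReal

/-! ### Part 3: the removal lemma -/

section
variable {ι : Type} [Fintype ι] {V : ℕ → Type} [∀ n, Fintype (V n)] [∀ n, Nonempty (V n)]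

noncomputable def ce (S : Set (Om ι V)) (m : MeasurableSpace (Om ι V)) : Om ι V → ℝ :=
  loeb[S.indicator (fun _ => (1 : ℝ)) | m]

theorem int_ind {S : Set (Om ι V)} (hS : MeasurableSet S) :
    Integrable (S.indicator (fun _ => (1 : ℝ))) loeb := (integrable_const 1).indicator hS

theorem ce_nonneg (S : Set (Om ι V)) (m : MeasurableSpace (Om ι V)) :
    ∀ᵐ x ∂loeb, 0 ≤ ce S m x :=
  condExp_nonneg (Eventually.of_forall fun x => Set.indicator_nonneg (by simp) x)

theorem ce_le_one {S : Set (Om ι V)} (hS : MeasurableSet S) {m : MeasurableSpace (Om ι V)}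
    (hm : m ≤ omMS) : ∀ᵐ x ∂loeb, ce S m x ≤ 1 := by
  have := condExp_mono (m := m) (int_ind hS) (integrable_const (1 : ℝ)) (μ := loeb)
    (Eventually.of_forall fun x => Set.indicator_le_self' (by simp) x)
  rw [condExp_const hm] at this
  exact this

theorem ce_sm (S : Set (Om ι V)) (m : MeasurableSpace (Om ι V)) :
    StronglyMeasurable[m] (ce S m) := stronglyMeasurable_condExp

theorem ce_int (S : Set (Om ι V)) (m : MeasurableSpace (Om ι V)) :
    Integrable (ce S m) loeb := integrable_condExp

theorem ce_set {S : Set (Om ι V)} (hS : MeasurableSet S) {m : MeasurableSpace (Om ι V)}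
    (hm : m ≤ omMS) {R : Set (Om ι V)} (hR : MeasurableSet[m] R) :
    ∫ x in R, ce S m x ∂loeb = loeb.real (R ∩ S) := by
  unfold ce
  rw [setIntegral_condExp hm (int_ind hS) hR, setIntegral_indicator hS, setIntegral_const]
  simp

theorem int_mul_prod {W : Om ι V → ℝ} (hW : Integrable W loeb) (𝓖 : Finset (Finset ι))
    (q : Finset ι → Om ι V → ℝ) (hq : ∀ f ∈ 𝓖, AEStronglyMeasurable (q f) loeb)
    (hq1 : ∀ f ∈ 𝓖, ∀ᵐ x ∂loeb, ‖q f x‖ ≤ 1) :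
    Integrable (fun x => W x * ∏ f ∈ 𝓖, q f x) loeb := by
  induction 𝓖 using Finset.induction with
  | empty => simpa using hW
  | insert f 𝓖 hf ih =>
    have h1 := ih (fun f hf => hq f (Finset.mem_insert_of_mem hf))
      (fun f hf => hq1 f (Finset.mem_insert_of_mem hf))
    have h2 := h1.mul_bdd (c := 1) (hq f (Finset.mem_insert_self _ _))
      (hq1 f (Finset.mem_insert_self _ _))
    refine h2.congr (Eventually.of_forall fun x => ?_)
    simp only [Finset.prod_insert hf]
    ring

theorem ind_bdd (S : Set (Om ι V)) (x : Om ι V) : ‖S.indicator (fun _ => (1 : ℝ)) x‖ ≤ 1 := by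
  by_cases h : x ∈ S <;> simp [h]

theorem prod_condExp {i : ℕ} (𝓖 : Finset (Finset ι)) (h𝓖 : ∀ f ∈ 𝓖, f.card = i)
    (A : Finset ι → Set (Om ι V)) (hA : ∀ f ∈ 𝓖, MeasurableSet[BB V f] (A f)) :
    ∀ W : Om ι V → ℝ, StronglyMeasurable[Low V Finset.univ i] W → Integrable W loeb →
    ∫ x, W x * ∏ f ∈ 𝓖, (A f).indicator (fun _ => (1 : ℝ)) x ∂loeb
      = ∫ x, W x * ∏ f ∈ 𝓖, ce (A f) (Low V f i) x ∂loeb := by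
  induction 𝓖 using Finset.induction with
  | empty => intro W _ _; simp
  | insert f 𝓖 hf ih =>
    intro W hW hWi
    have hAf := hA f (Finset.mem_insert_self _ _)
    have hA' : ∀ f ∈ 𝓖, MeasurableSet[BB V f] (A f) :=
      fun f hf => hA f (Finset.mem_insert_of_mem hf)
    have h𝓖' : ∀ f ∈ 𝓖, f.card = i := fun f hf => h𝓖 f (Finset.mem_insert_of_mem hf)
    have hfi : f.card = i := h𝓖 f (Finset.mem_insert_self _ _)
    set W' : Om ι V → ℝ := fun x => W x * ∏ f ∈ 𝓖, (A f).indicator (fun _ => (1 : ℝ)) x with hW'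
    have hW'm : StronglyMeasurable[Off V f i] W' := by
      refine (hW.mono (Low_le_Off' _ f i)).mul (Finset.stronglyMeasurable_fun_prod 𝓖 ?_)
      intro f' hf'
      refine stronglyMeasurable_const.indicator (BB_le_Off (h := f') ?_ _ (hA' f' hf'))
      rw [← hfi]
      refine Finset.card_lt_card (Finset.ssubset_iff_subset_ne.2 ⟨Finset.inter_subset_right, ?_⟩)
      intro h
      have h3 : f ⊆ f' := by rw [← h]; exact Finset.inter_subset_left
      have : f = f' := Finset.eq_of_subset_of_card_le h3 (by rw [hfi, h𝓖' f' hf'])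
      exact hf (this ▸ hf')
    have hW'i : Integrable W' loeb := int_mul_prod hWi 𝓖 _
      (fun f' hf' => (int_ind (BB_le f' _ (hA' f' hf'))).aestronglyMeasurable)
      (fun f' _ => Eventually.of_forall (ind_bdd _))
    have h1 : ∫ x, W' x * (A f).indicator (fun _ => (1 : ℝ)) x ∂loeb
        = ∫ x, W' x * ce (A f) (Low V f i) x ∂loeb :=
      integral_mul_condExp (stronglyMeasurable_const.indicator hAf) (int_ind (BB_le f _ hAf)) hW'm
        (hW'i.mul_bdd (c := 1) (int_ind (BB_le f _ hAf)).aestronglyMeasurable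
          (Eventually.of_forall (ind_bdd _)))
    have h2 := ih h𝓖' hA' (fun x => W x * ce (A f) (Low V f i) x)
      (hW.mul ((ce_sm _ _).mono (Low_mono (Finset.subset_univ f) i)))
      (hWi.mul_bdd (c := 1) (ce_int _ _).aestronglyMeasurable (by
        filter_upwards [ce_nonneg (A f) (Low V f i), ce_le_one (BB_le f _ hAf) (Low_le f i)]
          with x h1 h2
        rwa [Real.norm_of_nonneg h1]))
    calc _ = ∫ x, W' x * (A f).indicator (fun _ => (1 : ℝ)) x ∂loeb := by
            congr 1; funext x; simp only [Finset.prod_insert hf, hW']; ring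
      _ = _ := h1
      _ = ∫ x, W x * ce (A f) (Low V f i) x *
            ∏ f ∈ 𝓖, (A f).indicator (fun _ => (1 : ℝ)) x ∂loeb := by
            congr 1; funext x; simp only [hW']; ring
      _ = _ := h2
      _ = _ := by
            congr 1; funext x; simp only [Finset.prod_insert hf]; ring

theorem prod_formula {i : ℕ} {e : Finset ι} (𝓖 : Finset (Finset ι)) (h𝓖 : ∀ f ∈ 𝓖, f.card = i)
    (h𝓖e : ∀ f ∈ 𝓖, ¬ f ⊆ e)
    (A : Finset ι → Set (Om ι V)) (hA : ∀ f ∈ 𝓖, MeasurableSet[BB V f] (A f))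
    {G T : Set (Om ι V)} (hG : MeasurableSet[BB V e] G)
    (hT : MeasurableSet[Low V Finset.univ i] T) :
    loeb.real {x | x ∈ T ∧ x ∈ G ∧ ∀ f ∈ 𝓖, x ∈ A f} =
      ∫ x in T, ce G (Low V e i) x * ∏ f ∈ 𝓖, ce (A f) (Low V f i) x ∂loeb := by
  have hTm := Low_le _ _ _ hT
  have hGm := BB_le _ _ hG
  have hAm : ∀ f ∈ 𝓖, MeasurableSet (A f) := fun f hf => BB_le _ _ (hA f hf)
  set W : Om ι V → ℝ := fun x => T.indicator (fun _ => (1 : ℝ)) x *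
    ∏ f ∈ 𝓖, (A f).indicator (fun _ => (1 : ℝ)) x with hW
  have hWm : StronglyMeasurable[Off V e i] W := by
    refine (stronglyMeasurable_const.indicator (Low_le_Off' _ e i _ hT)).mul
      (Finset.stronglyMeasurable_fun_prod 𝓖 ?_)
    intro f hf
    refine stronglyMeasurable_const.indicator (BB_le_Off (h := f) ?_ _ (hA f hf))
    rw [← h𝓖 f hf]
    refine Finset.card_lt_card (Finset.ssubset_iff_subset_ne.2 ⟨Finset.inter_subset_left, ?_⟩)
    intro h
    exact h𝓖e f hf (by rw [← h]; exact Finset.inter_subset_right)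
  have hWi : Integrable W loeb := int_mul_prod (int_ind hTm) 𝓖 _
      (fun f' hf' => (int_ind (hAm f' hf')).aestronglyMeasurable)
      (fun f' _ => Eventually.of_forall (ind_bdd _))
  have h1 : ∫ x, W x * G.indicator (fun _ => (1 : ℝ)) x ∂loeb
        = ∫ x, W x * ce G (Low V e i) x ∂loeb :=
      integral_mul_condExp (stronglyMeasurable_const.indicator hG) (int_ind hGm) hWm
        (hWi.mul_bdd (c := 1) (int_ind hGm).aestronglyMeasurable
          (Eventually.of_forall (ind_bdd _)))
  have h2 := prod_condExp 𝓖 h𝓖 A hA (T.indicator (ce G (Low V e i)))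
    (((ce_sm _ _).mono (Low_mono (Finset.subset_univ e) i)).indicator hT)
    ((ce_int _ _).indicator hTm)
  have hset : MeasurableSet {x | x ∈ T ∧ x ∈ G ∧ ∀ f ∈ 𝓖, x ∈ A f} := by
    have : {x | x ∈ T ∧ x ∈ G ∧ ∀ f ∈ 𝓖, x ∈ A f} = T ∩ (G ∩ ⋂ f ∈ 𝓖, A f) := by
      ext x; simp; try tauto
    rw [this]
    exact hTm.inter (hGm.inter (Finset.measurableSet_biInter _ hAm))
  calc _ = ∫ x, {x | x ∈ T ∧ x ∈ G ∧ ∀ f ∈ 𝓖, x ∈ A f}.indicator (fun _ => (1:ℝ)) x ∂loeb := by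
        rw [integral_indicator_const _ hset]; simp
    _ = ∫ x, W x * G.indicator (fun _ => (1 : ℝ)) x ∂loeb := by
        congr 1; funext x
        simp only [hW]
        by_cases hT : x ∈ T <;> by_cases hG : x ∈ G <;> by_cases hA : ∀ f ∈ 𝓖, x ∈ A f
        · rw [Finset.prod_congr rfl (fun f hf => Set.indicator_of_mem (hA f hf) _)]
          simp [hT, hG]
          exact hA
        · have hA' := hA
          push Not at hA
          obtain ⟨f, hf, hfx⟩ := hA
          rw [Finset.prod_eq_zero hf (Set.indicator_of_notMem hfx _)]
          rw [Set.indicator_of_notMem]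
          · simp
          · exact fun h => hA' h.2.2
        all_goals simp [hT, hG]
    _ = _ := h1
    _ = ∫ x, T.indicator (ce G (Low V e i)) x *
          ∏ f ∈ 𝓖, (A f).indicator (fun _ => (1 : ℝ)) x ∂loeb := by
        congr 1; funext x
        simp only [hW]
        by_cases hT : x ∈ T <;> simp [hT]; ring
    _ = _ := h2
    _ = _ := by
        rw [← integral_indicator hTm]
        congr 1; funext x
        by_cases hT : x ∈ T <;> simp [hT]

def Ae (A : Finset ι → Set (Om ι V)) (i : ℕ) (e : Finset ι) : Set (Om ι V) :=
  {x | ∀ f, f ⊆ e → f.card = i → x ∈ A f}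

def Ts (A : Finset ι → Set (Om ι V)) (K : ℝ) (i : ℕ) (e : Finset ι) (E : Set (Om ι V)) :
    Set (Om ι V) :=
  {x | 2 * K * ce (Ae A i e \ E) (Low V e i) x < ce (Ae A i e) (Low V e i) x} ∩
  {x | ∀ f, f ⊆ e → f.card = i → 0 < ce (A f) (Low V f i) x}

theorem Ae_congr {A A' : Finset ι → Set (Om ι V)} {i : ℕ} {e : Finset ι}
    (h : ∀ f, f ⊆ e → f.card = i → A f = A' f) : Ae A i e = Ae A' i e := by
  ext x
  exact forall_congr' fun f => forall_congr' fun h1 => forall_congr' fun h2 => by rw [h f h1 h2]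

theorem Ts_congr {A A' : Finset ι → Set (Om ι V)} {K : ℝ} {i : ℕ} {e : Finset ι}
    {E : Set (Om ι V)}
    (h : ∀ f, f ⊆ e → f.card = i → A f = A' f) : Ts A K i e E = Ts A' K i e E := by
  unfold Ts
  rw [Ae_congr h]
  congr 1
  ext x
  exact forall_congr' fun f => forall_congr' fun h1 => forall_congr' fun h2 => by rw [h f h1 h2]

theorem Ae_eq (A : Finset ι → Set (Om ι V)) (i : ℕ) (e : Finset ι) :
    Ae A i e = ⋂ f, ⋂ _ : f ⊆ e, ⋂ _ : f.card = i, A f := by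
  ext x; simp [Ae]

theorem Ae_meas {A : Finset ι → Set (Om ι V)} (hA : ∀ f, MeasurableSet[BB V f] (A f)) (i : ℕ)
    (e : Finset ι) : MeasurableSet[BB V e] (Ae A i e) := by
  rw [Ae_eq]
  exact MeasurableSet.iInter fun f => MeasurableSet.iInter fun hf => MeasurableSet.iInter
    fun _ => BB_mono hf _ (hA f)

theorem Ts_meas (A : Finset ι → Set (Om ι V)) (K : ℝ) (i : ℕ) (e : Finset ι)
    (E : Set (Om ι V)) : MeasurableSet[Low V e i] (Ts A K i e E) := by
  refine MeasurableSet.inter ?_ ?_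
  · exact ((ce_sm _ _).const_mul _).measurableSet_lt (ce_sm _ _)
  · have : {x : Om ι V | ∀ f, f ⊆ e → f.card = i → 0 < ce (A f) (Low V f i) x} =
      ⋂ f, ⋂ _ : f ⊆ e, ⋂ _ : f.card = i, {x | 0 < ce (A f) (Low V f i) x} := by
      ext x; simp
    rw [this]
    refine MeasurableSet.iInter fun f => MeasurableSet.iInter fun hf => MeasurableSet.iInter
      fun _ => ?_
    exact stronglyMeasurable_const.measurableSet_lt ((ce_sm _ _).mono (Low_mono hf i))

theorem Ts_err {A : Finset ι → Set (Om ι V)} (hA : ∀ f, MeasurableSet[BB V f] (A f)) {K : ℝ}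
    (hK : 0 ≤ K) (i : ℕ) (e : Finset ι) {E : Set (Om ι V)} (hE : MeasurableSet[BB V e] E)
    {L : Set (Om ι V)} (hL : MeasurableSet[Low V e i] L) :
    loeb.real ((E ∩ Ae A i e) \ Ts A K i e E) ≤
      loeb.real ((E ∩ Ae A i e) \ L) + 2 * K * loeb.real ((Ae A i e ∩ L) \ E) := by
  have hAe := Ae_meas hA i e
  set R : Set (Om ι V) := {x | ce (Ae A i e) (Low V e i) x ≤
    2 * K * ce (Ae A i e \ E) (Low V e i) x} with hR
  have hRm : MeasurableSet[Low V e i] R :=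
    (ce_sm _ _).measurableSet_le ((ce_sm _ _).const_mul _)
  have hLR : MeasurableSet[Low V e i] (L ∩ R) := hL.inter hRm
  have hz : ∀ f, loeb.real ({x | ce (A f) (Low V f i) x ≤ 0} ∩ A f) = 0 := by
    intro f
    have hm : MeasurableSet[Low V f i] {x | ce (A f) (Low V f i) x ≤ 0} :=
      (ce_sm _ _).measurableSet_le stronglyMeasurable_const
    refine le_antisymm ?_ measureReal_nonneg
    rw [← ce_set (BB_le f _ (hA f)) (Low_le f i) hm]
    exact setIntegral_nonpos (Low_le f i _ hm) fun x hx => hx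
  have hsub : (E ∩ Ae A i e) \ Ts A K i e E ⊆
      ((E ∩ Ae A i e) \ L ∪ (L ∩ R) ∩ Ae A i e) ∪
        ⋃ f ∈ (Finset.univ : Finset (Finset ι)), ({x | ce (A f) (Low V f i) x ≤ 0} ∩ A f) := by
    rintro x ⟨⟨hxE, hxA⟩, hxT⟩
    by_cases hxL : x ∈ L
    · by_cases hxR : x ∈ R
      · exact Or.inl (Or.inr ⟨⟨hxL, hxR⟩, hxA⟩)
      · right
        have h1 : ¬ ∀ f, f ⊆ e → f.card = i → 0 < ce (A f) (Low V f i) x := by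
          intro h
          have h2 : 2 * K * ce (Ae A i e \ E) (Low V e i) x < ce (Ae A i e) (Low V e i) x :=
            not_le.1 hxR
          exact hxT ⟨h2, h⟩
        push Not at h1
        obtain ⟨f, hf, hfi, hfx⟩ := h1
        exact Set.mem_biUnion (x := f) (Finset.mem_univ f) ⟨hfx, hxA f hf hfi⟩
    · exact Or.inl (Or.inl ⟨⟨hxE, hxA⟩, hxL⟩)
  have h2 : loeb.real ((L ∩ R) ∩ Ae A i e) ≤ 2 * K * loeb.real ((Ae A i e ∩ L) \ E) := by
    have hd : MeasurableSet[BB V e] (Ae A i e \ E) := @MeasurableSet.diff _ (BB V e) _ _ hAe hE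
    rw [← ce_set (BB_le e _ hAe) (Low_le e i) hLR]
    calc ∫ x in L ∩ R, ce (Ae A i e) (Low V e i) x ∂loeb
        ≤ ∫ x in L ∩ R, 2 * K * ce (Ae A i e \ E) (Low V e i) x ∂loeb :=
          setIntegral_mono_on (ce_int _ _).integrableOn ((ce_int _ _).const_mul _).integrableOn
            (Low_le e i _ hLR) fun x hx => hx.2
      _ = 2 * K * loeb.real ((L ∩ R) ∩ (Ae A i e \ E)) := by
          rw [integral_const_mul, ce_set (BB_le e _ hd) (Low_le e i) hLR]
      _ ≤ _ := by
          gcongr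
          · exact measure_ne_top _ _
          · rintro x ⟨⟨h1, h2⟩, h3, h4⟩
            exact ⟨⟨h3, h1⟩, h4⟩
  calc _ ≤ _ := measureReal_mono hsub (measure_ne_top _ _)
    _ ≤ _ := measureReal_union_le _ _
    _ ≤ (loeb.real ((E ∩ Ae A i e) \ L) + loeb.real ((L ∩ R) ∩ Ae A i e)) + ∑ f,
        loeb.real ({x | ce (A f) (Low V f i) x ≤ 0} ∩ A f) :=
        add_le_add (measureReal_union_le _ _) (measureReal_biUnion_finset_le _ _)
    _ ≤ _ := by
        simp only [hz, Finset.sum_const_zero, add_zero]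
        gcongr

theorem Ts_null {A : Finset ι → Set (Om ι V)} (hA : ∀ f, MeasurableSet[BB V f] (A f)) (i : ℕ)
    (𝓔 : Finset (Finset ι)) {E : Finset ι → Set (Om ι V)}
    (hE : ∀ e ∈ 𝓔, MeasurableSet[BB V e] (E e)) (h0 : loeb (⋂ e ∈ 𝓔, E e) = 0) :
    loeb (⋂ e ∈ 𝓔, Ts A 𝓔.card i e (E e)) = 0 := by
  set K : ℝ := (𝓔.card : ℝ) with hK
  set T : Set (Om ι V) := ⋂ e ∈ 𝓔, Ts A K i e (E e) with hT
  have hTm : MeasurableSet[Low V Finset.univ i] T :=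
    Finset.measurableSet_biInter _ fun e _ => Low_mono (Finset.subset_univ e) i _ (Ts_meas _ _ _ _ _)
  have hTm' := Low_le _ _ _ hTm
  set 𝓕 : Finset (Finset ι) :=
    Finset.univ.filter (fun f => f.card = i ∧ ∃ e ∈ 𝓔, f ⊆ e) with h𝓕
  set 𝓖 : Finset ι → Finset (Finset ι) := fun e => 𝓕.filter (fun f => ¬ f ⊆ e) with h𝓖
  rcases 𝓔.eq_empty_or_nonempty with he | ⟨e₀, he₀⟩
  · simp [he] at h0
  have hKpos : 0 < K := by
    rw [hK]; exact_mod_cast Finset.card_pos.2 ⟨e₀, he₀⟩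
  have hTp : ∀ x ∈ T, ∀ f ∈ 𝓕, 0 < ce (A f) (Low V f i) x := by
    intro x hx f hf
    obtain ⟨-, hfi, e, he, hfe⟩ := Finset.mem_filter.1 hf
    exact (Set.mem_iInter₂.1 hx e he).2 f hfe hfi
  have hG1 : ∀ e, ∀ f ∈ 𝓖 e, f.card = i := fun e f hf =>
    (Finset.mem_filter.1 (Finset.mem_filter.1 hf).1).2.1
  have hG2 : ∀ e, ∀ f ∈ 𝓖 e, ¬ f ⊆ e := fun e f hf => (Finset.mem_filter.1 hf).2
  have hG3 : ∀ e, ∀ f ∈ 𝓖 e, f ∈ 𝓕 := fun e f hf => (Finset.mem_filter.1 hf).1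
  set X : Set (Om ι V) := {x | x ∈ T ∧ ∀ f ∈ 𝓕, x ∈ A f} with hX
  have hAeX : ∀ e ∈ 𝓔, ∀ x, (x ∈ Ae A i e ∧ ∀ f ∈ 𝓖 e, x ∈ A f) ↔ ∀ f ∈ 𝓕, x ∈ A f := by
    intro e he x
    constructor
    · rintro ⟨h1, h2⟩ f hf
      by_cases hfe : f ⊆ e
      · exact h1 f hfe (Finset.mem_filter.1 hf).2.1
      · exact h2 f (Finset.mem_filter.2 ⟨hf, hfe⟩)
    · intro h
      exact ⟨fun f hf hfi => h f (Finset.mem_filter.2 ⟨Finset.mem_univ _, hfi, e, he, hf⟩),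
        fun f hf => h f (hG3 e f hf)⟩
  have hXe : ∀ e ∈ 𝓔, loeb.real X = ∫ x in T, ce (Ae A i e) (Low V e i) x *
      ∏ f ∈ 𝓖 e, ce (A f) (Low V f i) x ∂loeb := by
    intro e he
    rw [← prod_formula (𝓖 e) (hG1 e) (hG2 e) A (fun f _ => hA f) (Ae_meas hA i e) hTm]
    congr 1
    ext x
    simp only [hX, Set.mem_ofPred_eq]
    rw [hAeX e he x]
  have hYe : ∀ e ∈ 𝓔, loeb.real (X \ E e) = ∫ x in T, ce (Ae A i e \ E e) (Low V e i) x *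
      ∏ f ∈ 𝓖 e, ce (A f) (Low V f i) x ∂loeb := by
    intro e he
    rw [← prod_formula (𝓖 e) (hG1 e) (hG2 e) A (fun f _ => hA f)
      (@MeasurableSet.diff _ (BB V e) _ _ (Ae_meas hA i e) (hE e he)) hTm]
    congr 1
    ext x
    simp only [hX, Set.mem_ofPred_eq, Set.mem_sdiff]
    rw [← hAeX e he x]
    tauto
  have hIntegr : ∀ e, ∀ S : Set (Om ι V), Integrable (fun x => ce S (Low V e i) x *
      ∏ f ∈ 𝓖 e, ce (A f) (Low V f i) x) loeb := by
    intro e S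
    refine int_mul_prod (ce_int _ _) _ _ (fun f _ => (ce_int _ _).aestronglyMeasurable) ?_
    intro f _
    filter_upwards [ce_nonneg (A f) (Low V f i), ce_le_one (BB_le f _ (hA f)) (Low_le f i)]
      with x h1 h2
    rwa [Real.norm_of_nonneg h1]
  have hYX : ∀ e ∈ 𝓔, 2 * K * loeb.real (X \ E e) ≤ loeb.real X := by
    intro e he
    rw [hXe e he, hYe e he, ← integral_const_mul]
    refine setIntegral_mono_on ((hIntegr _ _).const_mul _).integrableOn (hIntegr _ _).integrableOn hTm'
      fun x hx => ?_
    rw [← mul_assoc]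
    refine mul_le_mul_of_nonneg_right (Set.mem_iInter₂.1 hx e he).1.le ?_
    exact Finset.prod_nonneg fun f hf => (hTp x hx f (hG3 e f hf)).le
  have hXsub : X ⊆ (⋂ e ∈ 𝓔, E e) ∪ ⋃ e ∈ 𝓔, X \ E e := by
    intro x hx
    by_cases h : x ∈ ⋂ e ∈ 𝓔, E e
    · exact Or.inl h
    · right
      simp only [Set.mem_iInter, not_forall] at h
      obtain ⟨e, he, hxe⟩ := h
      exact Set.mem_biUnion (x := e) he ⟨hx, hxe⟩
  have hX0 : loeb.real X = 0 := by
    have h1 : loeb.real X ≤ loeb.real (⋂ e ∈ 𝓔, E e) + ∑ e ∈ 𝓔, loeb.real (X \ E e) :=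
      (measureReal_mono hXsub (measure_ne_top _ _)).trans
        ((measureReal_union_le _ _).trans
          (add_le_add le_rfl (measureReal_biUnion_finset_le _ _)))
    have h2 : loeb.real (⋂ e ∈ 𝓔, E e) = 0 := by simp [Measure.real, h0]
    have h3 : ∑ e ∈ 𝓔, loeb.real (X \ E e) ≤ ∑ e ∈ 𝓔, loeb.real X / (2 * K) := by
      refine Finset.sum_le_sum fun e he => ?_
      rw [le_div_iff₀ (by positivity)]
      linarith [hYX e he]
    rw [Finset.sum_const, nsmul_eq_mul, ← hK] at h3
    have h4 : K * (loeb.real X / (2 * K)) = loeb.real X / 2 := by field_simp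
    have h5 : 0 ≤ loeb.real X := measureReal_nonneg
    linarith
  have hpos : ∀ᵐ x ∂loeb, x ∈ T → 0 < ce (Ae A i e₀) (Low V e₀ i) x *
      ∏ f ∈ 𝓖 e₀, ce (A f) (Low V f i) x := by
    filter_upwards [ce_nonneg (Ae A i e₀ \ E e₀) (Low V e₀ i)] with x hx hxT
    refine mul_pos (lt_of_le_of_lt (mul_nonneg (mul_nonneg zero_le_two hKpos.le) hx) (Set.mem_iInter₂.1 hxT e₀ he₀).1) ?_
    exact Finset.prod_pos fun f hf => hTp x hxT f (hG3 e₀ f hf)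
  rw [hXe e₀ he₀] at hX0
  have hpos' := (ae_restrict_iff' hTm').2 hpos
  rw [integral_eq_zero_iff_of_nonneg_ae (hpos'.mono fun x hx => hx.le)
    (hIntegr _ _).integrableOn] at hX0
  have : ∀ᵐ x ∂(loeb.restrict T), False := by
    filter_upwards [hX0, hpos'] with x h1 h2
    exact h2.ne' h1
  rw [ae_restrict_iff' hTm'] at this
  rw [measure_eq_zero_iff_ae_notMem]
  exact this

end
end HSat

namespace HSat
set_option linter.unusedSectionVars false
open MeasureTheory Filter Topology ENNReal

/-! ### Part 4: colourings and the removal lemma -/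

section
variable {ι : Type} [Fintype ι] {V : ℕ → Type} [∀ n, Fintype (V n)] [∀ n, Nonempty (V n)]

theorem IA_univ (e : Finset ι) : (Set.univ : Set (Om ι V)) ∈ IA V e := by
  simpa using (IA_alg (V := V) e).compl_mem (IA_alg e).empty_mem

theorem IA_inter {e : Finset ι} {A B : Set (Om ι V)} (hA : A ∈ IA V e) (hB : B ∈ IA V e) :
    A ∩ B ∈ IA V e := (IA_alg e).inter_mem hA hB

/-- colour classes -/
def Ac {κ : Type} (c : Finset ι → Om ι V → κ) (a : Finset ι → κ) (f : Finset ι) :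
    Set (Om ι V) := {x | c f x = a f}

def Agree {κ : Type} (e : Finset ι) (i : ℕ) (a b : Finset ι → κ) : Prop :=
  ∀ f, f ⊆ e → f.card = i → a f = b f

def Desc' (κ : Type) (e : Finset ι) (i : ℕ) (D : Set (Om ι V)) (c : Finset ι → Om ι V → κ)
    (L : (Finset ι → κ) → Set (Om ι V)) : Prop :=
  (∀ f k, {x | c f x = k} ∈ IA V f) ∧ (∀ a, MeasurableSet[Low V e i] (L a)) ∧
    (∀ a b, Agree e i a b → L a = L b) ∧ D = {x | x ∈ L (fun f => c f x)}

def Desc (e : Finset ι) (i : ℕ) (D : Set (Om ι V)) : Prop :=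
  ∃ (κ : Type) (_ : Fintype κ) (c : Finset ι → Om ι V → κ)
    (L : (Finset ι → κ) → Set (Om ι V)), Desc' κ e i D c L

theorem Desc_alg (e : Finset ι) (i : ℕ) : IsSetAlgebra {D : Set (Om ι V) | Desc e i D} where
  empty_mem := ⟨Unit, inferInstance, fun _ _ => (), fun _ => ∅, fun f k => by
    simpa using IA_univ f, fun _ => @MeasurableSet.empty _ (Low V e i), fun _ _ _ => rfl, rfl⟩
  compl_mem := by
    rintro D ⟨κ, _, c, L, h1, h2, h3, rfl⟩
    exact ⟨κ, inferInstance, c, fun a => (L a)ᶜ, h1, fun a => (h2 a).compl,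
      fun a b h => by beta_reduce; rw [h3 a b h], rfl⟩
  union_mem := by
    rintro D D' ⟨κ, _, c, L, h1, h2, h3, rfl⟩ ⟨κ', _, c', L', h1', h2', h3', rfl⟩
    refine ⟨κ × κ', inferInstance, fun f x => (c f x, c' f x),
      fun a => L (fun f => (a f).1) ∪ L' (fun f => (a f).2), ?_, fun a => (h2 _).union (h2' _),
      ?_, rfl⟩
    · rintro f ⟨k, k'⟩
      have : {x | (c f x, c' f x) = (k, k')} = {x | c f x = k} ∩ {x | c' f x = k'} := by
        ext x; simp
      rw [this]
      exact IA_inter (h1 f k) (h1' f k')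
    · intro a b h
      beta_reduce
      rw [h3 _ (fun f => (b f).1) (fun f hf hi => congrArg Prod.fst (h f hf hi)),
        h3' _ (fun f => (b f).2) (fun f hf hi => congrArg Prod.snd (h f hf hi))]

theorem IA_meas {e : Finset ι} {A : Set (Om ι V)} (hA : A ∈ IA V e) : MeasurableSet[BB V e] A :=
  MeasurableSpace.measurableSet_generateFrom hA

theorem Low_succ_mono (e : Finset ι) (i : ℕ) : Low V e i ≤ Low V e (i + 1) :=
  iSup₂_le fun _ hg => BB_le_Low hg.1 (Nat.lt_succ_of_lt hg.2)

theorem Desc_meas {κ : Type} [Fintype κ] {e : Finset ι} {i : ℕ} {D : Set (Om ι V)}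
    {c : Finset ι → Om ι V → κ} {L : (Finset ι → κ) → Set (Om ι V)}
    (h : Desc' κ e i D c L) : MeasurableSet[Low V e (i + 1)] D := by
  obtain ⟨h1, h2, h3, rfl⟩ := h
  have : {x | x ∈ L (fun f => c f x)} = ⋃ a, (L a ∩ Ae (Ac c a) i e) := by
    ext x
    simp only [Set.mem_iUnion]
    constructor
    · intro hx
      exact ⟨_, hx, fun f _ _ => rfl⟩
    · rintro ⟨a, hx, hxa⟩
      show x ∈ L _
      rwa [h3 _ a fun f hf hi => hxa f hf hi]
  rw [this]
  refine MeasurableSet.iUnion fun a => MeasurableSet.inter (Low_succ_mono e i _ (h2 a)) ?_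
  rw [Ae_eq]
  exact MeasurableSet.iInter fun f => MeasurableSet.iInter fun hf => MeasurableSet.iInter
    fun hi => BB_le_Low hf (by omega) _ (IA_meas (h1 f (a f)))

theorem Low_succ (e : Finset ι) (i : ℕ) :
    Low V e (i + 1) = MeasurableSpace.generateFrom {D : Set (Om ι V) | Desc e i D} := by
  apply le_antisymm
  · refine iSup₂_le fun h hh => MeasurableSpace.generateFrom_mono fun G hG => ?_
    obtain ⟨hhe, hhi⟩ := hh
    by_cases hi : h.card < i
    · exact ⟨Unit, inferInstance, fun _ _ => (), fun _ => G, fun f k => by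
        simpa using IA_univ f, fun _ => BB_le_Low hhe hi _ (IA_meas hG), fun _ _ _ => rfl, rfl⟩
    · have hi' : h.card = i := by omega
      refine ⟨Bool, inferInstance, fun f x => decide (f = h ∧ x ∈ G),
        fun a => if a h then Set.univ else ∅, ?_, ?_, ?_, ?_⟩
      · intro f k
        by_cases hf : f = h
        · subst hf
          cases k
          · have : {x | decide (f = f ∧ x ∈ G) = false} = Gᶜ := by ext x; simp
            rw [this]; exact (IA_alg f).compl_mem hG
          · have : {x | decide (f = f ∧ x ∈ G) = true} = G := by ext x; simp
            rw [this]; exact hG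
        · cases k
          · have : {x | decide (f = h ∧ x ∈ G) = false} = Set.univ := by ext x; simp [hf]
            rw [this]; exact IA_univ f
          · have : {x | decide (f = h ∧ x ∈ G) = true} = ∅ := by ext x; simp [hf]
            rw [this]; exact (IA_alg f).empty_mem
      · intro a
        beta_reduce
        split_ifs
        · exact @MeasurableSet.univ _ (Low V e i)
        · exact @MeasurableSet.empty _ (Low V e i)
      · intro a b hab
        beta_reduce
        rw [hab h hhe hi']
      · ext x
        by_cases hx : x ∈ G <;> simp [hx]
  · refine MeasurableSpace.generateFrom_le ?_
    rintro D ⟨κ, _, c, L, h⟩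
    exact Desc_meas h

theorem err_step {κ : Type} [Fintype κ] {e : Finset ι} {i : ℕ} {D : Set (Om ι V)}
    {c : Finset ι → Om ι V → κ} {L : (Finset ι → κ) → Set (Om ι V)}
    (h : Desc' κ e i D c L) {E : Set (Om ι V)} (hE : MeasurableSet[BB V e] E) {K : ℝ}
    (hK : 0 ≤ K) :
    loeb.real (⋃ a, (E ∩ Ae (Ac c a) i e) \ Ts (Ac c a) K i e E) ≤
      loeb.real (E \ D) + 2 * K * loeb.real (D \ E) := by
  have hDm : MeasurableSet D := Low_le _ _ _ (Desc_meas h)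
  have hEm : MeasurableSet E := BB_le _ _ hE
  obtain ⟨h1, h2, h3, hD⟩ := h
  obtain ⟨x0⟩ : Nonempty (Om ι V) := ⟨fun n _ => Classical.arbitrary (V n)⟩
  let r : (Finset ι → κ) → (Finset ι → κ) :=
    fun a f => if f ⊆ e ∧ f.card = i then a f else c ∅ x0
  have hr : ∀ a, Agree e i a (r a) := fun a f hf hi => by simp [r, hf, hi]
  let B : Finset (Finset ι → κ) := Finset.univ.image r
  have hAc : ∀ a f, MeasurableSet[BB V f] (Ac c a f) := fun a f => IA_meas (h1 f (a f))
  have hAem : ∀ a, MeasurableSet (Ae (Ac c a) i e) := fun a => BB_le _ _ (Ae_meas (hAc a) i e)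
  have hcongr : ∀ a, ∀ f, f ⊆ e → f.card = i → Ac c a f = Ac c (r a) f := by
    intro a f hf hi
    unfold Ac
    rw [hr a f hf hi]
  have hsub : (⋃ a, (E ∩ Ae (Ac c a) i e) \ Ts (Ac c a) K i e E) ⊆
      ⋃ b ∈ B, (E ∩ Ae (Ac c b) i e) \ Ts (Ac c b) K i e E := by
    refine Set.iUnion_subset fun a => ?_
    rw [Ae_congr (hcongr a), Ts_congr (hcongr a)]
    intro x hx
    exact Set.mem_biUnion (x := r a) (Finset.mem_image_of_mem r (Finset.mem_univ a)) hx
  have hdisj : (B : Set (Finset ι → κ)).PairwiseDisjoint (fun b => Ae (Ac c b) i e) := by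
    intro b hb b' hb' hne
    rw [Function.onFun, Set.disjoint_left]
    intro x hx hx'
    apply hne
    obtain ⟨a, -, rfl⟩ := Finset.mem_image.1 hb
    obtain ⟨a', -, rfl⟩ := Finset.mem_image.1 hb'
    funext f
    by_cases hf : f ⊆ e ∧ f.card = i
    · have e1 : c f x = r a f := hx f hf.1 hf.2
      have e2 : c f x = r a' f := hx' f hf.1 hf.2
      rw [← e1, e2]
    · simp [r, hf]
  have hsum : ∀ S : Set (Om ι V), MeasurableSet S →
      ∑ b ∈ B, loeb.real (S ∩ Ae (Ac c b) i e) ≤ loeb.real S := by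
    intro S hS
    rw [← measureReal_biUnion_finset]
    · exact measureReal_mono (Set.iUnion₂_subset fun b _ => Set.inter_subset_left)
        (measure_ne_top _ _)
    · exact fun b hb b' hb' hne =>
        (hdisj hb hb' hne).mono Set.inter_subset_right Set.inter_subset_right
    · exact fun b _ => hS.inter (hAem b)
  have hDL : ∀ b, ∀ x ∈ Ae (Ac c b) i e, (x ∈ D ↔ x ∈ L b) := by
    intro b x hx
    rw [hD]
    show x ∈ L _ ↔ _
    rw [h3 _ b fun f hf hi => hx f hf hi]
  calc loeb.real (⋃ a, (E ∩ Ae (Ac c a) i e) \ Ts (Ac c a) K i e E)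
      ≤ loeb.real (⋃ b ∈ B, (E ∩ Ae (Ac c b) i e) \ Ts (Ac c b) K i e E) :=
        measureReal_mono hsub (measure_ne_top _ _)
    _ ≤ ∑ b ∈ B, loeb.real ((E ∩ Ae (Ac c b) i e) \ Ts (Ac c b) K i e E) :=
        measureReal_biUnion_finset_le _ _
    _ ≤ ∑ b ∈ B, (loeb.real ((E \ D) ∩ Ae (Ac c b) i e) +
          2 * K * loeb.real ((D \ E) ∩ Ae (Ac c b) i e)) := by
        refine Finset.sum_le_sum fun b _ => (Ts_err (hAc b) hK i e hE (h2 b)).trans ?_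
        gcongr
        · exact measure_ne_top _ _
        · rintro x ⟨⟨hx1, hx2⟩, hx3⟩
          exact ⟨⟨hx1, fun hd => hx3 ((hDL b x hx2).1 hd)⟩, hx2⟩
        · exact measure_ne_top _ _
        · rintro x ⟨⟨hx1, hx2⟩, hx3⟩
          exact ⟨⟨(hDL b x hx1).2 hx2, hx3⟩, hx1⟩
    _ ≤ _ := by
        rw [Finset.sum_add_distrib, ← Finset.mul_sum]
        gcongr
        · exact hsum _ (hEm.diff hDm)
        · exact hsum _ (hDm.diff hEm)

theorem Desc_merge {κ : Finset ι → Type} {i : ℕ} {e : Finset ι} {D : Set (Om ι V)}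
    (c : ∀ e, Finset ι → Om ι V → κ e) (hc : ∀ e f k, {x | c e f x = k} ∈ IA V f)
    (L : (Finset ι → κ e) → Set (Om ι V)) (h : Desc' (κ e) e i D (c e) L) :
    Desc' (∀ e, κ e) e i D (fun f x e => c e f x) (fun a => L (fun f => a f e)) := by
  obtain ⟨h1, h2, h3, h4⟩ := h
  refine ⟨fun f k => ?_, fun a => h2 _, fun a b hab => h3 _ _ fun f hf hi => ?_, h4⟩
  · have : {x | (fun e => c e f x) = k} = ⋂ e ∈ (Finset.univ : Finset (Finset ι)),
        {x | c e f x = k e} := by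
      ext x; simp [funext_iff]
    rw [this]
    exact (IA_alg f).biInter_mem _ fun e _ => hc e f (k e)
  · rw [hab f hf hi]

theorem Low_zero_eq {e : Finset ι} {E : Set (Om ι V)} (h : MeasurableSet[Low V e 0] E) :
    E = ∅ ∨ E = Set.univ := by
  have : Low V e 0 = ⊥ := by
    simp [Low]
  rw [this] at h
  exact MeasurableSpace.measurableSet_bot_iff.1 h

theorem removal (𝓔 : Finset (Finset ι)) : ∀ (i : ℕ) (E : Finset ι → Set (Om ι V)),
    (∀ e, MeasurableSet[Low V e i] (E e)) → loeb (⋂ e ∈ 𝓔, E e) = 0 → ∀ ε : ℝ, 0 < ε →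
    ∃ E' : Finset ι → Set (Om ι V), (∀ e, E' e ∈ IA V e ∧ loeb.real (E e \ E' e) ≤ ε) ∧
      ⋂ e ∈ 𝓔, E' e = ∅ := by
  intro i
  induction i with
  | zero =>
    intro E hE h0 ε hε
    refine ⟨E, fun e => ⟨?_, by simp [hε.le]⟩, ?_⟩
    · rcases Low_zero_eq (hE e) with h | h
      · rw [h]; exact (IA_alg e).empty_mem
      · rw [h]; exact IA_univ e
    · by_contra hne
      obtain ⟨x, hx⟩ := Set.nonempty_iff_ne_empty.2 hne
      have : ⋂ e ∈ 𝓔, E e = Set.univ := by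
        simp only [Set.iInter_eq_univ]
        intro e he
        rcases Low_zero_eq (hE e) with h | h
        · have := Set.mem_iInter₂.1 hx e he
          rw [h] at this
          exact this.elim
        · exact h
      rw [this] at h0
      simp at h0
  | succ i ih =>
    intro E hE h0 ε hε
    set K : ℝ := (𝓔.card : ℝ) with hK
    have hK0 : 0 ≤ K := by rw [hK]; exact Nat.cast_nonneg _
    set η : ℝ := ε / (2 * (2 * K + 1)) with hη
    have hη0 : 0 < η := by positivity
    have hEB : ∀ e, MeasurableSet[BB V e] (E e) := fun e => Low_le_BB e _ _ (hE e)
    have hap := fun e => approx (Desc_alg e i) (Low_succ e i) (Low_le e (i+1)) (hE e) hη0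
    choose D hD hDE using hap
    choose κ hκ c L hd using hD
    have hd' := fun e => Desc_merge c (fun e => (hd e).1) (L e) (hd e)
    set c' : Finset ι → Om ι V → (∀ e, κ e) := fun f x e => c e f x with hc'
    have hAc : ∀ a f, Ac c' a f ∈ IA V f := fun a f => (hd' ∅).1 f (a f)
    have hAcm : ∀ a f, MeasurableSet[BB V f] (Ac c' a f) := fun a f => IA_meas (hAc a f)
    set M : ℝ := (Fintype.card (Finset ι → ∀ e, κ e) : ℝ) with hM
    have hM0 : 0 ≤ M := by rw [hM]; exact Nat.cast_nonneg _
    have hIH := fun a : Finset ι → ∀ e, κ e => ih (fun e => Ts (Ac c' a) K i e (E e))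
      (fun e => Ts_meas _ _ _ _ _) (Ts_null (hAcm a) i 𝓔 (fun e _ => hEB e) h0)
      (ε / (2 * (M + 1))) (by positivity)
    choose T hT hTe using hIH
    refine ⟨fun e => ⋂ a ∈ (Finset.univ : Finset (Finset ι → ∀ e, κ e)),
      ((Ae (Ac c' a) i e)ᶜ ∪ T a e), fun e => ⟨?_, ?_⟩, ?_⟩
    · refine (IA_alg e).biInter_mem _ fun a _ => (IA_alg e).union_mem ((IA_alg e).compl_mem ?_)
        (hT a e).1
      have : Ae (Ac c' a) i e = ⋂ f ∈ (Finset.univ.filter (fun f : Finset ι => f ⊆ e ∧ f.card = i)),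
          Ac c' a f := by
        ext x; simp [Ae]
      rw [this]
      exact (IA_alg e).biInter_mem _ fun f hf => IA_mono (Finset.mem_filter.1 hf).2.1 (hAc a f)
    · have hsub : E e \ (⋂ a ∈ (Finset.univ : Finset (Finset ι → ∀ e, κ e)),
          ((Ae (Ac c' a) i e)ᶜ ∪ T a e)) ⊆
          (⋃ a, (E e ∩ Ae (Ac c' a) i e) \ Ts (Ac c' a) K i e (E e)) ∪
          ⋃ a ∈ (Finset.univ : Finset (Finset ι → ∀ e, κ e)),
            (Ts (Ac c' a) K i e (E e) \ T a e) := by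
        rintro x ⟨hxE, hx⟩
        simp only [Set.mem_iInter, not_forall] at hx
        obtain ⟨a, ha, hx⟩ := hx
        rw [Set.mem_union, not_or, Set.mem_compl_iff, not_not] at hx
        by_cases hxT : x ∈ Ts (Ac c' a) K i e (E e)
        · exact Or.inr (Set.mem_biUnion (x := a) ha ⟨hxT, hx.2⟩)
        · exact Or.inl (Set.mem_iUnion.2 ⟨a, ⟨hxE, hx.1⟩, hxT⟩)
      have hsd : loeb.real (symmDiff (E e) (D e)) ≤ η :=
        ENNReal.toReal_le_of_le_ofReal hη0.le (hDE e).le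
      have h1 : loeb.real (E e \ D e) ≤ η :=
        (measureReal_mono (fun x hx => Or.inl hx) (measure_ne_top _ _)).trans hsd
      have h2 : loeb.real (D e \ E e) ≤ η :=
        (measureReal_mono (fun x hx => Or.inr hx) (measure_ne_top _ _)).trans hsd
      calc _ ≤ _ := measureReal_mono hsub (measure_ne_top _ _)
        _ ≤ _ := measureReal_union_le _ _
        _ ≤ (loeb.real (E e \ D e) + 2 * K * loeb.real (D e \ E e)) +
            ∑ a : Finset ι → ∀ e, κ e, loeb.real (Ts (Ac c' a) K i e (E e) \ T a e) :=
            add_le_add (err_step (hd' e) (hEB e) hK0) (measureReal_biUnion_finset_le _ _)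
        _ ≤ (η + 2 * K * η) + ∑ a : Finset ι → ∀ e, κ e, ε / (2 * (M + 1)) := by
            have h3 := mul_le_mul_of_nonneg_left h2 (mul_nonneg zero_le_two hK0)
            have h4 := Finset.sum_le_sum (s := Finset.univ) fun (a : Finset ι → ∀ e, κ e) _ =>
              (hT a e).2
            linarith
        _ = ε / 2 + M * (ε / (2 * (M + 1))) := by
            rw [Finset.sum_const, nsmul_eq_mul, Finset.card_univ, ← hM]
            congr 1
            rw [hη]; field_simp; ring
        _ ≤ ε := by
            have : M * (ε / (2 * (M + 1))) ≤ ε / 2 := by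
              rw [← mul_div_assoc, div_le_div_iff₀ (by positivity) (by positivity)]
              nlinarith
            linarith
    · rw [Set.eq_empty_iff_forall_notMem]
      intro x hx
      have : x ∈ ⋂ e ∈ 𝓔, T (fun f => c' f x) e := by
        refine Set.mem_iInter₂.2 fun e he => ?_
        have h1 := Set.mem_iInter₂.1 (Set.mem_iInter₂.1 hx e he) (fun f => c' f x)
          (Finset.mem_univ _)
        rcases h1 with h1 | h1
        · exact absurd (fun f _ _ => rfl) h1
        · exact h1
      rw [hTe] at this
      exact this

end
end HSat

namespace HSat
set_option linter.unusedSectionVars false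
open MeasureTheory Filter Topology ENNReal

/-! ### Part 5: the counting lemmas -/

section
variable {β : Type} [DecidableEq β]

/-- the relation on coordinates `e` coming from the hypergraph `H` -/
def Ed (s k : ℕ) (V : Finset β) (H : Finset (Finset β)) (e : Finset (Fin s)) :
    Set (Fin s → V) :=
  {x | e.card = k + 1 → e.image (fun i => (x i : β)) ∈ H}

theorem clique_count {s k : ℕ} (hk : 1 ≤ k) (hs : k + 2 ≤ s) (V : Finset β)
    (H : Finset (Finset β)) (hH : ∀ e ∈ H, e ⊆ V ∧ e.card = k + 1) :
    (Finset.univ.filter (fun x : Fin s → V => x ∈ {x : Fin s → V |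
      ∀ e ∈ (Finset.univ : Finset (Fin s)).powersetCard (k + 1), x ∈ Ed s k V H e})).card ≤
      s ^ s * ((V.powersetCard s).filter (fun S => ∀ T ∈ S.powersetCard (k + 1), T ∈ H)).card := by
  refine Finset.card_le_mul_card_image_of_maps_to
    (f := fun x => Finset.univ.image (fun i => (x i : β))) ?_ _ ?_
  · intro x hx
    have hx' : ∀ e : Finset (Fin s), e.card = k + 1 → e.image (fun i => (x i : β)) ∈ H := by
      intro e he
      exact (Finset.mem_filter.1 hx).2 e (Finset.mem_powersetCard.2 ⟨Finset.subset_univ _, he⟩) he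
    have hinj : Function.Injective (fun i => (x i : β)) := by
      intro i j hij
      by_contra hne
      obtain ⟨e, he, hec⟩ := Finset.exists_superset_card_eq (s := ({i, j} : Finset (Fin s)))
        (n := k + 1) (by rw [Finset.card_pair hne]; omega) (by simp; omega)
      have h1 := (hH _ (hx' e hec)).2
      rw [← hec] at h1
      exact hne (Finset.card_image_iff.1 h1 (he (by simp)) (he (by simp)) hij)
    refine Finset.mem_filter.2 ⟨Finset.mem_powersetCard.2 ⟨?_, ?_⟩, ?_⟩
    · intro b hb
      obtain ⟨i, -, rfl⟩ := Finset.mem_image.1 hb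
      exact (x i).2
    · rw [Finset.card_image_of_injective _ hinj]; simp
    · intro T hT
      obtain ⟨hTS, hTc⟩ := Finset.mem_powersetCard.1 hT
      obtain ⟨e, -, rfl⟩ := Finset.subset_image_iff.1 hTS
      rw [Finset.card_image_of_injective _ hinj] at hTc
      exact hx' e hTc
  · intro S hS
    have hSc := (Finset.mem_powersetCard.1 (Finset.mem_filter.1 hS).1).2
    have : (Fintype.piFinset (fun _ : Fin s => S)).card = s ^ s := by
      simp [Fintype.card_piFinset, hSc]
    rw [← this]
    refine Finset.card_le_card_of_injOn (fun x i => (x i : β)) ?_ ?_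
    · intro x hx
      have := (Finset.mem_filter.1 hx).2
      refine Fintype.mem_piFinset.2 fun i => ?_
      rw [← this]
      exact Finset.mem_image_of_mem _ (Finset.mem_univ i)
    · intro x _ y _ hxy
      funext i
      exact Subtype.ext (congrFun hxy i)

theorem family_count {s k : ℕ} (hs : k + 2 ≤ s) (V : Finset β) (hV : 1 ≤ V.card)
    (H F : Finset (Finset β))
    (hF : ∀ S ∈ F, S ⊆ V ∧ S.card = s ∧ ∀ T ∈ S.powersetCard (k + 1), T ∈ H)
    (hFF : ∀ S₁ ∈ F, ∀ S₂ ∈ F, S₁ ≠ S₂ → (S₁ ∩ S₂).card ≤ k)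
    (B : Finset (Fin s) → Set (Fin s → V))
    (hB : ∀ e x y, (∀ i ∈ e, x i = y i) → x ∈ B e → y ∈ B e)
    (h0 : {x : Fin s → V | ∀ e ∈ (Finset.univ : Finset (Fin s)).powersetCard (k + 1), x ∈ B e} ⊆ ∅)
    (γ : ℝ)
    (hγ : ∀ e ∈ (Finset.univ : Finset (Fin s)).powersetCard (k + 1),
      dens (Ed s k V H e \ B e) ≤ γ) :
    (F.card : ℝ) ≤ s.choose (k + 1) * γ * (V.card : ℝ) ^ (k + 1) := by
  have hVne : Nonempty V := by
    obtain ⟨v, hv⟩ := Finset.card_pos.1 hV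
    exact ⟨⟨v, hv⟩⟩
  have hNpos : (0 : ℝ) < V.card := by exact_mod_cast hV
  have hex : ∀ S, ∃ (x : Fin s → V) (e : Finset (Fin s)), S ∈ F →
      Function.Injective x ∧ (∀ i, (x i : β) ∈ S) ∧ e.card = k + 1 ∧ x ∈ Ed s k V H e \ B e := by
    intro S
    by_cases hS : S ∈ F
    · obtain ⟨hSV, hSc, hSH⟩ := hF S hS
      let φ := S.equivFinOfCardEq hSc
      let x : Fin s → V := fun i => ⟨(φ.symm i : β), hSV (φ.symm i).2⟩
      have hxi : Function.Injective x := by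
        intro i j hij
        exact φ.symm.injective (Subtype.ext (congrArg (fun v : V => (v : β)) hij))
      have hxi' : Function.Injective (fun i => (x i : β)) := Subtype.val_injective.comp hxi
      have hxS : ∀ i, (x i : β) ∈ S := fun i => (φ.symm i).2
      have : ∃ e ∈ (Finset.univ : Finset (Fin s)).powersetCard (k + 1), x ∉ B e := by
        by_contra! hc
        exact h0 hc
      obtain ⟨e, he, hxe⟩ := this
      have hec := (Finset.mem_powersetCard.1 he).2
      refine ⟨x, e, fun _ => ⟨hxi, hxS, hec, fun _ => hSH _ ?_, hxe⟩⟩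
      refine Finset.mem_powersetCard.2 ⟨?_, ?_⟩
      · intro b hb
        obtain ⟨i, -, rfl⟩ := Finset.mem_image.1 hb
        exact hxS i
      · rw [Finset.card_image_of_injective _ hxi', hec]
    · exact ⟨fun _ => Classical.arbitrary _, ∅, fun h => absurd h hS⟩
  choose x e hxe using hex
  have hmaps : ∀ S ∈ F, e S ∈ (Finset.univ : Finset (Fin s)).powersetCard (k + 1) :=
    fun S hS => Finset.mem_powersetCard.2 ⟨Finset.subset_univ _, (hxe S hS).2.2.1⟩
  have hfib : ∀ f ∈ (Finset.univ : Finset (Fin s)).powersetCard (k + 1),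
      ((F.filter (fun S => e S = f)).card : ℝ) ≤ γ * (V.card : ℝ) ^ (k + 1) := by
    intro f hf
    have hfc := (Finset.mem_powersetCard.1 hf).2
    have hcard : (F.filter (fun S => e S = f)).card * V.card ^ (s - (k + 1)) ≤
        (Finset.univ.filter (fun y : Fin s → V => y ∈ Ed s k V H f \ B f)).card := by
      have h1 : Fintype.card ({i // i ∉ f} → V) = V.card ^ (s - (k + 1)) := by
        rw [Fintype.card_fun, Fintype.card_coe]
        congr 1
        rw [Fintype.card_subtype_compl]
        simp [hfc]
      rw [← h1, ← Finset.card_univ, ← Finset.card_product]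
      refine Finset.card_le_card_of_injOn
        (fun p i => if h : i ∈ f then x p.1 i else p.2 ⟨i, h⟩) ?_ ?_
      · rintro ⟨S, z⟩ hp
        have hS := Finset.mem_filter.1 (Finset.mem_product.1 hp).1
        obtain ⟨-, -, -, hx1, hx2⟩ := hxe S hS.1
        rw [hS.2] at hx1 hx2
        refine Finset.mem_coe.2 (Finset.mem_filter.2 ⟨Finset.mem_univ _, ?_, ?_⟩)
        · intro hc
          have h3 := hx1 hc
          have h4 : f.image (fun i => ((if h : i ∈ f then x S i else z ⟨i, h⟩ : V) : β)) =
              f.image (fun i => (x S i : β)) :=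
            Finset.image_congr fun i hi => by
              have hi' : i ∈ f := hi
              simp [hi']
          rw [← h4] at h3
          exact h3
        · intro hc
          refine hx2 (hB f _ _ ?_ hc)
          intro i hi
          simp [hi]
      · rintro ⟨S, z⟩ hp ⟨S', z'⟩ hp' heq
        have hS := Finset.mem_filter.1 (Finset.mem_product.1 hp).1
        have hS' := Finset.mem_filter.1 (Finset.mem_product.1 hp').1
        have hx : ∀ i ∈ f, x S i = x S' i := by
          intro i hi
          have := congrFun heq i
          simpa [hi] using this
        have hSS : S = S' := by
          by_contra hne
          have h1 := hFF S hS.1 S' hS'.1 hne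
          have h2 : f.image (fun i => (x S i : β)) ⊆ S ∩ S' := by
            intro b hb
            obtain ⟨i, hi, rfl⟩ := Finset.mem_image.1 hb
            refine Finset.mem_inter.2 ⟨(hxe S hS.1).2.1 i, ?_⟩
            rw [hx i hi]
            exact (hxe S' hS'.1).2.1 i
          have h3 := Finset.card_le_card h2
          have h4 : Function.Injective (fun i => (x S i : β)) :=
            Subtype.val_injective.comp (hxe S hS.1).1
          rw [Finset.card_image_of_injective _ h4, hfc] at h3
          omega
        have hz : z = z' := by
          funext ⟨i, hi⟩
          have := congrFun heq i
          simpa [hi] using this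
        rw [hSS, hz]
    have hd := hγ f hf
    rw [dens_eq, div_le_iff₀ (by exact_mod_cast Fintype.card_pos)] at hd
    have hc2 : (Fintype.card (Fin s → V) : ℝ) =
        (V.card : ℝ) ^ (k + 1) * (V.card : ℝ) ^ (s - (k + 1)) := by
      rw [← pow_add, Fintype.card_fun, Fintype.card_coe, Fintype.card_fin]
      push_cast
      congr 1
      omega
    rw [hc2] at hd
    have hcard' : ((F.filter (fun S => e S = f)).card : ℝ) * (V.card : ℝ) ^ (s - (k + 1)) ≤
        ((Finset.univ.filter (fun y : Fin s → V => y ∈ Ed s k V H f \ B f)).card : ℝ) := by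
      exact_mod_cast hcard
    have hp : (0 : ℝ) < (V.card : ℝ) ^ (s - (k + 1)) := by positivity
    have hd' : ((Finset.univ.filter (fun y : Fin s → V => y ∈ Ed s k V H f \ B f)).card : ℝ) ≤
        γ * ((V.card : ℝ) ^ (k + 1) * (V.card : ℝ) ^ (s - (k + 1))) := by
      refine le_trans (le_of_eq ?_) hd
      congr
    refine le_of_mul_le_mul_right (hcard'.trans (hd'.trans (le_of_eq ?_))) hp
    ring
  rw [Finset.card_eq_sum_card_fiberwise hmaps]
  push_cast
  refine (Finset.sum_le_sum hfib).trans (le_of_eq ?_)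
  rw [Finset.sum_const, nsmul_eq_mul, Finset.card_powersetCard]
  simp
  ring

end
end HSat

namespace HSat
open MeasureTheory Filter Topology

theorem dens_inst {α : Type} (i₁ i₂ : Fintype α) (A : Set α) :
    @dens α i₁ A = @dens α i₂ A := by
  rw [Subsingleton.elim i₁ i₂]

theorem final_aux (k s : ℕ) (hk : 1 ≤ k) (hs : k + 2 ≤ s)
    (δ : ℝ) (hδ : 0 < δ)
    (β : ℕ → Type) [inst : ∀ n, DecidableEq (β n)] (V : ∀ n, Finset (β n))
    (H F : ∀ n, Finset (Finset (β n)))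
    (hV : ∀ n, 1 ≤ (V n).card)
    (hH : ∀ n, ∀ e ∈ H n, e ⊆ V n ∧ e.card = k + 1)
    (hF : ∀ n, ∀ S ∈ F n, S ⊆ V n ∧ S.card = s ∧ ∀ T ∈ S.powersetCard (k+1), T ∈ H n)
    (hFF : ∀ n, ∀ S₁ ∈ F n, ∀ S₂ ∈ F n, S₁ ≠ S₂ → (S₁ ∩ S₂).card ≤ k)
    (hFc : ∀ n, δ * ((V n).card : ℝ) ^ (k + 1) ≤ ((F n).card : ℝ))
    (hcl : ∀ n, ((((V n).powersetCard s).filter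
              (fun S => ∀ T ∈ S.powersetCard (k+1), T ∈ H n)).card : ℝ) <
        (1 / ((n : ℝ) + 1)) * ((V n).card : ℝ) ^ s) : False := by
  have hne : ∀ n, Nonempty (V n) := by
    intro n
    obtain ⟨v, hv⟩ := Finset.card_pos.1 (hV n)
    exact ⟨⟨v, hv⟩⟩
  have hNpos : ∀ n, (0 : ℝ) < (V n).card := fun n => by exact_mod_cast hV n
  let 𝓔 : Finset (Finset (Fin s)) := (Finset.univ : Finset (Fin s)).powersetCard (k + 1)
  let A : Finset (Fin s) → ∀ n, Set (Fin s → V n) := fun e n => Ed s k (V n) (H n) e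
  let E : Finset (Fin s) → Set (Om (Fin s) (fun n => V n)) := fun e => intl (A e)
  have hDep : ∀ e, Dep e (A e) := by
    intro e n x y hxy hx hc
    have h1 := hx hc
    have h2 : e.image (fun i => (y i : β n)) = e.image (fun i => (x i : β n)) :=
      Finset.image_congr fun i hi => by
        have := hxy i hi
        simp [this]
    rwa [h2]
  have hE : ∀ e, MeasurableSet[Low (fun n => V n) e (k + 2)] (E e) := by
    intro e
    by_cases he : e.card = k + 1
    · exact BB_le_Low (Finset.Subset.refl e) (by omega) _ (IA_meas ⟨A e, hDep e, rfl⟩)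
    · have h1 : A e = fun n => Set.univ := by
        funext n
        ext x
        simp [A, Ed, he]
      have : E e = Set.univ := by
        show intl (A e) = _
        rw [h1, intl_univ]
      rw [this]
      exact @MeasurableSet.univ _ (Low (fun n => V n) e (k + 2))
  have hinter : ∀ B : Finset (Fin s) → ∀ n, Set (Fin s → V n),
      ⋂ e ∈ 𝓔, intl (V := fun n => V n) (B e) =
        intl (V := fun n => V n) (fun n => {x | ∀ e ∈ 𝓔, x ∈ B e n}) := by
    intro B
    ext x
    simp only [Set.mem_iInter, mem_intl, Set.mem_ofPred_eq]
    rw [eventually_all_finset]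
  have h0 : loeb (⋂ e ∈ 𝓔, E e) = 0 := by
    rw [hinter A, ← measureReal_eq_zero_iff]
    refine tendsto_nhds_unique (tendsto_dens _) ?_
    have hb : ∀ n, dens {x : Fin s → V n | ∀ e ∈ 𝓔, x ∈ A e n} ≤
        (s : ℝ) ^ s * (1 / ((n : ℝ) + 1)) := by
      intro n
      have h1 := clique_count hk hs (V n) (H n) (hH n)
      have h1' : ((Finset.univ.filter (fun x : Fin s → V n => x ∈ {x : Fin s → V n |
          ∀ e ∈ 𝓔, x ∈ A e n})).card : ℝ) ≤ (s : ℝ) ^ s * ((((V n).powersetCard s).filter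
              (fun S => ∀ T ∈ S.powersetCard (k+1), T ∈ H n)).card : ℝ) := by
        exact_mod_cast h1
      have h2 := mul_le_mul_of_nonneg_left (hcl n).le (by positivity : (0 : ℝ) ≤ (s : ℝ) ^ s)
      have hc : (Fintype.card (Fin s → V n) : ℝ) = ((V n).card : ℝ) ^ s := by
        rw [Fintype.card_fun, Fintype.card_coe, Fintype.card_fin]
        push_cast
        rfl
      rw [dens_eq, div_le_iff₀ (by exact_mod_cast Fintype.card_pos), hc]
      refine le_trans (le_of_eq ?_) (h1'.trans (h2.trans (le_of_eq ?_)))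
      · congr
      · ring
    have hlim : Tendsto (fun n : ℕ => (s : ℝ) ^ s * (1 / ((n : ℝ) + 1))) UF (𝓝 0) := by
      have := (tendsto_one_div_add_atTop_nhds_zero_nat (𝕜 := ℝ)).const_mul ((s : ℝ) ^ s)
      rw [mul_zero] at this
      exact this.mono_left Nat.hyperfilter_le_atTop
    exact squeeze_zero (fun n => @dens_nonneg _ (_) _)
      (fun n => (dens_inst _ _ _).le.trans (hb n)) hlim
  let C : ℝ := (s.choose (k + 1) : ℝ)
  have hC : 0 ≤ C := Nat.cast_nonneg _
  have hε : 0 < δ / (4 * (C + 1)) := by positivity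
  obtain ⟨E', hE', hE0⟩ := removal 𝓔 (k + 2) E hE h0 _ hε
  choose hIA hmeas using hE'
  choose B hB hEB using hIA
  have hev0 : ∀ᶠ n in (UF : Filter ℕ), {x : Fin s → V n | ∀ e ∈ 𝓔, x ∈ B e n} ⊆ ∅ := by
    refine intl_subset (V := fun n => V n) ?_
    rw [← hinter B, intl_empty]
    simp only [hEB] at hE0
    exact hE0.le
  have hev1 : ∀ᶠ n in (UF : Filter ℕ), ∀ e ∈ 𝓔,
      dens (A e n \ B e n) ≤ δ / (2 * (C + 1)) := by
    rw [eventually_all_finset]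
    intro e _
    have h1 := hmeas e
    rw [hEB e] at h1
    have h2 : loeb.real (intl (V := fun n => V n) (fun n => A e n \ B e n)) ≤
        δ / (4 * (C + 1)) := by
      rw [← intl_diff]
      exact h1
    have h3 : δ / (4 * (C + 1)) < δ / (2 * (C + 1)) := by
      apply div_lt_div_of_pos_left hδ (by positivity)
      linarith
    have h4 := (tendsto_dens (V := fun n => V n) (fun n => A e n \ B e n)).eventually
      (eventually_lt_nhds (lt_of_le_of_lt h2 h3))
    exact h4.mono fun n hn => (dens_inst _ _ _).le.trans hn.le
  obtain ⟨n, hn0, hn1⟩ := (hev0.and hev1).exists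
  have h1 := family_count hs (V n) (hV n) (H n) (F n) (hF n) (hFF n) (fun e => B e n)
    (fun e => hB e n) hn0 _ hn1
  have h2 := (hFc n).trans h1
  have h3 : (0 : ℝ) < ((V n).card : ℝ) ^ (k + 1) := pow_pos (hNpos n) _
  have h4 : δ ≤ C * (δ / (2 * (C + 1))) := le_of_mul_le_mul_right h2 h3
  rw [← mul_div_assoc, le_div_iff₀ (by positivity)] at h4
  nlinarith

end HSat

theorem hypergraph_supersaturation (k s : ℕ) (hk : 1 ≤ k) (hs : k + 2 ≤ s)
    (δ : ℝ) (hδ : 0 < δ) :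
    ∃ α : ℝ, 0 < α ∧
      ∀ N : ℕ, 1 ≤ N → ∀ (β : Type) [DecidableEq β] (V : Finset β)
        (H F : Finset (Finset β)),
        V.card = N →
        (∀ e ∈ H, e ⊆ V ∧ e.card = k + 1) →
        (∀ S ∈ F, S ⊆ V ∧ S.card = s ∧ ∀ T ∈ S.powersetCard (k+1), T ∈ H) →
        (∀ S₁ ∈ F, ∀ S₂ ∈ F, S₁ ≠ S₂ → (S₁ ∩ S₂).card ≤ k) →
        δ * (N : ℝ) ^ (k + 1) ≤ (F.card : ℝ) →
        α * (N : ℝ) ^ s ≤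
          (((V.powersetCard s).filter
              (fun S => ∀ T ∈ S.powersetCard (k+1), T ∈ H)).card : ℝ) := by
  by_contra! hcon
  choose N hN β inst V H F hVN hH hF hFF hFc hcl using
    fun n : ℕ => hcon (1 / ((n : ℝ) + 1)) (by positivity)
  obtain rfl : N = fun n => (V n).card := funext fun n => (hVN n).symm
  exact HSat.final_aux k s hk hs δ hδ β V H F hN hH hF hFF hFc hcl
end

section
/- For every integer k ≥ 1 there exists a constant c_k > 0 such that for every real ε > 0 there exists n₀ with the following property for all integers n ≥ n₀: if P is a finite set of n points in ℝ² and C is a k-intersecting family of n simple curves with I(P,C) ≥ ε · n^((3k+1)/(2k+1)), then the sum, over all unordered pairs {γ,γ'} of distinct curves of C, of the number of points of (γ ∩ γ') \ P is at least c_k · ε^((2k+1)/k) · n². -/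
open scoped Classical

/-- A simple curve: the image of an injective continuous map from [0,1] into ℝ². -/
def IsSimpleCurve (γ : Set (ℝ × ℝ)) : Prop :=
  ∃ f : Set.Icc (0:ℝ) 1 → ℝ × ℝ, Continuous f ∧ Function.Injective f ∧ γ = Set.range f

/-- A k-intersecting family of simple curves: every member is a simple curve and
any two distinct members intersect in at most k points. -/
def KIntersecting (C : Finset (Set (ℝ × ℝ))) (k : ℕ) : Prop :=
  (∀ γ ∈ C, IsSimpleCurve γ) ∧
  ∀ γ ∈ C, ∀ γ' ∈ C, γ ≠ γ' → (γ ∩ γ').Finite ∧ (γ ∩ γ').ncard ≤ k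

/-- The number of incidences between a finite point set P and a finite family of curves C. -/
noncomputable def incidences (P : Finset (ℝ × ℝ)) (C : Finset (Set (ℝ × ℝ))) : ℕ :=
  ∑ γ ∈ C, (P.filter (fun p => p ∈ γ)).card


lemma exists_clog {A : Type} [TopologicalSpace A] [SimplyConnectedSpace A]
    [LocallyPathConnectedSpace A] [Nonempty A] (F : A → ℂ) (hF : Continuous F) (h0 : ∀ a, F a ≠ 0) :
    ∃ L : A → ℂ, Continuous L ∧ ∀ a, Complex.exp (L a) = F a := by
  obtain ⟨a₀⟩ := ‹Nonempty A›
  obtain ⟨L, ⟨-, hL⟩, -⟩ := Complex.isCoveringMapOn_exp.existsUnique_continuousMap_lifts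
    ⟨F, hF⟩ (Complex.exp_log (h0 a₀)) (fun a => h0 a)
  exact ⟨L, L.continuous, fun a => congrFun hL a⟩

lemma clog_unique (L M : ℝ → ℂ) (hL : Continuous L) (hM : Continuous M)
    (h : ∀ t, Complex.exp (L t) = Complex.exp (M t)) : L 1 - L 0 = M 1 - M 0 := by
  obtain ⟨K, -, hK⟩ := Complex.isCoveringMapOn_exp.existsUnique_continuousMap_lifts
    (⟨fun t => Complex.exp (L t), by fun_prop⟩ : C(ℝ, ℂ)) (a₀ := 0) (e₀ := L 0) rfl
    (fun a => Complex.exp_ne_zero _)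
  have e0 : Complex.exp (L 0 - M 0) = 1 := by
    rw [Complex.exp_sub, h 0, div_self (Complex.exp_ne_zero _)]
  have h1 := hK ⟨L, hL⟩ ⟨rfl, rfl⟩
  have h2 := hK ⟨fun t => M t + (L 0 - M 0), by fun_prop⟩ ⟨by simp, by
    funext t
    simp [Complex.exp_add, e0, h t]⟩
  have h3 := congrArg (fun f : C(ℝ, ℂ) => f 1) (h1.trans h2.symm)
  simp at h3
  rw [h3]; ring

def sg (i j : Fin 5) : ℤ := if i < j then 1 else -1

theorem no_K5 (p : Fin 5 → ℂ) (g : Fin 5 → Fin 5 → ℝ → ℂ)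
    (hc : ∀ i j, i < j → Continuous (g i j))
    (h0 : ∀ i j, i < j → g i j 0 = p i) (h1 : ∀ i j, i < j → g i j 1 = p j)
    (hdis : ∀ i j k l, i < j → k < l → i ≠ k → i ≠ l → j ≠ k → j ≠ l →
      ∀ s t, g i j s ≠ g k l t) : False := by
  -- vertices avoid edges
  have hv : ∀ v k l : Fin 5, k < l → v ≠ k → v ≠ l → ∀ t, g k l t ≠ p v := by
    intro v k l hkl hvk hvl t
    obtain ⟨w, hw1, hw2, hw3⟩ : ∃ w : Fin 5, w ≠ v ∧ w ≠ k ∧ w ≠ l := by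
      clear hc h0 h1 hdis
      revert v k l; decide
    rcases lt_or_gt_of_ne hw1 with h | h
    · rw [← h1 w v h]
      exact hdis k l w v hkl h hw2.symm hvk.symm hw3.symm hvl.symm t 1
    · rw [← h0 v w h]
      exact hdis k l v w hkl h hvk.symm hw2.symm hvl.symm hw3.symm t 0
  have hp : ∀ i j : Fin 5, i ≠ j → p j - p i ≠ 0 := by
    intro i j hij
    obtain ⟨w, hw1, hw2⟩ : ∃ w : Fin 5, w ≠ i ∧ w ≠ j := by
      clear hc h0 h1 hdis hv
      revert i j; decide
    rcases lt_or_gt_of_ne hw2 with h | h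
    · rw [← h1 w j h, sub_ne_zero]
      exact hv i w j h hw1.symm hij 1
    · rw [← h0 j w h, sub_ne_zero]
      exact hv i j w h hij hw1.symm 0
  obtain ⟨T, hT, hTs⟩ : ∃ T : Fin 5 → Fin 5 → ℂ, (∀ i j, i ≠ j → Complex.exp (T i j) = p j - p i) ∧
      ∀ i j, i ≠ j → T j i = T i j + (sg i j : ℂ) * (Real.pi * Complex.I) := by
    refine ⟨fun i j => if i < j then Complex.log (p j - p i) else
      Complex.log (p i - p j) + Real.pi * Complex.I, ?_, ?_⟩
    · intro i j hij
      dsimp only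
      split_ifs with h
      · exact Complex.exp_log (hp i j hij)
      · rw [Complex.exp_add, Complex.exp_pi_mul_I, Complex.exp_log (hp j i hij.symm)]; ring
    · intro i j hij
      rcases lt_or_gt_of_ne hij with h | h
      · simp [sg, h, not_lt.mpr h.le]
      · simp [sg, h, not_lt.mpr h.le]
  have hN : ∀ v k l : Fin 5, ∃ N : ℤ, k < l → v ≠ k → v ≠ l → ∀ L : ℝ → ℂ, Continuous L →
      (∀ t, Complex.exp (L t) = g k l t - p v) →
      L 1 - L 0 = T v l - T v k + N * (2 * Real.pi * Complex.I) := by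
    intro v k l
    by_cases hh : k < l ∧ v ≠ k ∧ v ≠ l
    swap
    · exact ⟨0, fun a b c => absurd ⟨a, b, c⟩ hh⟩
    obtain ⟨hkl, hvk, hvl⟩ := hh
    obtain ⟨M, hM, hM'⟩ := exists_clog (fun t : ℝ => g k l t - p v)
      ((hc k l hkl).sub continuous_const) (fun t => sub_ne_zero.mpr (hv v k l hkl hvk hvl t))
    have : Complex.exp (M 1 - M 0) = Complex.exp (T v l - T v k) := by
      rw [Complex.exp_sub, Complex.exp_sub, hM', hM', hT _ _ hvl, hT _ _ hvk, h0 _ _ hkl,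
        h1 _ _ hkl]
    obtain ⟨N, hN⟩ := Complex.exp_eq_exp_iff_exists_int.mp this
    refine ⟨N, fun _ _ _ L hL hL' => ?_⟩
    rw [← hN]
    exact clog_unique L M hL hM (fun t => by rw [hL', hM'])
  choose N hN using hN
  have key : ∀ i j k l : Fin 5, i < j → k < l → i ≠ k → i ≠ l → j ≠ k → j ≠ l →
      2 * (N i k l + N l i j - N k i j - N j k l) = sg i l - sg i k - sg j l + sg j k := by
    intro i j k l hij hkl hik hil hjk hjl
    have c1 := hc i j hij
    have c2 := hc k l hkl
    obtain ⟨L, hL, hL'⟩ := exists_clog (fun x : ℝ × ℝ => g k l x.2 - g i j x.1)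
      (by fun_prop) (fun x => sub_ne_zero.mpr (hdis i j k l hij hkl hik hil hjk hjl x.1 x.2).symm)
    have e1 := hN i k l hkl hik hil (fun t => L (0, t)) (by fun_prop)
      (fun t => by rw [hL']; simp [h0 i j hij])
    have e2 := hN j k l hkl hjk hjl (fun t => L (1, t)) (by fun_prop)
      (fun t => by rw [hL']; simp [h1 i j hij])
    have e3 := hN k i j hij hik.symm hjk.symm (fun t => L (t, 0) + Real.pi * Complex.I) (by fun_prop)
      (fun t => by rw [Complex.exp_add, hL']; simp [h0 k l hkl])
    have e4 := hN l i j hij hil.symm hjl.symm (fun t => L (t, 1) + Real.pi * Complex.I) (by fun_prop)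
      (fun t => by rw [Complex.exp_add, hL']; simp [h1 k l hkl])
    have t1 := hTs i l hil
    have t2 := hTs i k hik
    have t3 := hTs j l hjl
    have t4 := hTs j k hjk
    have hpi : (Real.pi : ℂ) * Complex.I ≠ 0 := by simp [Real.pi_ne_zero]
    have : ((2 * (N i k l + N l i j - N k i j - N j k l) : ℤ) : ℂ) * (Real.pi * Complex.I) =
        ((sg i l - sg i k - sg j l + sg j k : ℤ) : ℂ) * (Real.pi * Complex.I) := by
      push_cast
      linear_combination e2 + e3 - e1 - e4 + t1 - t2 - t3 + t4
    exact_mod_cast mul_right_cancel₀ hpi this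
  have a1 := key 0 1 2 3 (by decide) (by decide) (by decide) (by decide) (by decide) (by decide)
  have a2 := key 0 1 2 4 (by decide) (by decide) (by decide) (by decide) (by decide) (by decide)
  have a3 := key 0 1 3 4 (by decide) (by decide) (by decide) (by decide) (by decide) (by decide)
  have a4 := key 0 2 1 3 (by decide) (by decide) (by decide) (by decide) (by decide) (by decide)
  have a5 := key 0 2 1 4 (by decide) (by decide) (by decide) (by decide) (by decide) (by decide)
  have a6 := key 0 2 3 4 (by decide) (by decide) (by decide) (by decide) (by decide) (by decide)
  have a7 := key 0 3 1 2 (by decide) (by decide) (by decide) (by decide) (by decide) (by decide)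
  have a8 := key 0 3 1 4 (by decide) (by decide) (by decide) (by decide) (by decide) (by decide)
  have a9 := key 0 3 2 4 (by decide) (by decide) (by decide) (by decide) (by decide) (by decide)
  have a10 := key 0 4 1 2 (by decide) (by decide) (by decide) (by decide) (by decide) (by decide)
  have a11 := key 0 4 1 3 (by decide) (by decide) (by decide) (by decide) (by decide) (by decide)
  have a12 := key 0 4 2 3 (by decide) (by decide) (by decide) (by decide) (by decide) (by decide)
  have a13 := key 1 2 3 4 (by decide) (by decide) (by decide) (by decide) (by decide) (by decide)
  have a14 := key 1 3 2 4 (by decide) (by decide) (by decide) (by decide) (by decide) (by decide)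
  have a15 := key 1 4 2 3 (by decide) (by decide) (by decide) (by decide) (by decide) (by decide)
  simp [sg] at a1 a2 a3 a4 a5 a6 a7 a8 a9 a10 a11 a12 a13 a14 a15
  clear key hN hT hTs hp hv hdis h0 h1 hc
  omega

abbrev PX := ℝ × ℝ

def Drawable (adj : PX → PX → Prop) : Prop :=
  ∃ A : PX → PX → Set PX, (∀ x y, adj x y → JoinedIn (A x y) x y) ∧
    ∀ x y z w, adj x y → adj z w → x ≠ z → x ≠ w → y ≠ z → y ≠ w → Disjoint (A x y) (A z w)

lemma Drawable.no_clique {adj : PX → PX → Prop} (h : Drawable adj) (B : Finset PX)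
    (hB : B.card = 5) (hadj : ∀ x ∈ B, ∀ y ∈ B, x ≠ y → adj x y) : False := by
  obtain ⟨A, hA, hd⟩ := h
  let e := (B.equivFinOfCardEq hB).symm
  have hne : ∀ i j, i ≠ j → (e i : PX) ≠ e j := fun i j hij h =>
    hij (e.injective (Subtype.ext h))
  have had : ∀ i j, i < j → adj (e i) (e j) := fun i j hij =>
    hadj _ (e i).2 _ (e j).2 (hne i j hij.ne)
  refine no_K5 (fun i => Complex.equivRealProdCLM.symm (e i))
    (fun i j t => if hij : i < j then
      Complex.equivRealProdCLM.symm ((hA _ _ (had i j hij)).somePath.extend t) else 0) ?_ ?_ ?_ ?_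
  · intro i j hij
    simp only [hij, dif_pos]
    exact Complex.equivRealProdCLM.symm.continuous.comp (Path.continuous_extend _)
  · intro i j hij
    simp only [hij, dif_pos, Path.extend_zero]
  · intro i j hij
    simp only [hij, dif_pos, Path.extend_one]
  · intro i j k l hij hkl h1 h2 h3 h4 s t
    simp only [hij, hkl, dif_pos]
    intro heq
    have heq' := Complex.equivRealProdCLM.symm.injective heq
    have m1 : (hA _ _ (had i j hij)).somePath.extend s ∈ A (e i) (e j) :=
      JoinedIn.somePath_mem _ _
    have m2 : (hA _ _ (had k l hkl)).somePath.extend t ∈ A (e k) (e l) :=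
      JoinedIn.somePath_mem _ _
    rw [heq'] at m1
    exact Set.disjoint_left.mp (hd _ _ _ _ (had i j hij) (had k l hkl) (hne _ _ h1) (hne _ _ h2)
      (hne _ _ h3) (hne _ _ h4)) m1 m2

def contractAdj (adj : PX → PX → Prop) (u v x y : PX) : Prop :=
  x ≠ y ∧ x ≠ v ∧ y ≠ v ∧ (adj x y ∨ (x = u ∧ adj v y) ∨ (y = u ∧ adj v x))

lemma Drawable.contract {adj : PX → PX → Prop} (h : Drawable adj) (hs : ∀ x y, adj x y → adj y x)
    (hi : ∀ x, ¬ adj x x) (u v : PX) (huv : adj u v) : Drawable (contractAdj adj u v) := by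
  obtain ⟨A, hA, hd⟩ := h
  have hne : u ≠ v := fun h => hi u (by rw [← h] at huv; exact huv)
  refine ⟨fun x y => if adj x y then A x y else if x = u then A u v ∪ A v y else A x v ∪ A v u,
    ?_, ?_⟩
  · intro x y hxy
    obtain ⟨h1, h2, h3, h4⟩ := hxy
    dsimp only
    split_ifs with ha hb
    · exact hA x y ha
    · subst hb
      have hvy : adj v y := by
        rcases h4 with h4 | h4 | h4
        · exact absurd h4 ha
        · exact h4.2
        · exact absurd h4.1.symm h1
      exact ((hA _ _ huv).mono Set.subset_union_left).trans
        ((hA _ _ hvy).mono Set.subset_union_right)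
    · have hvy : y = u ∧ adj v x := by tauto
      obtain ⟨rfl, hvx⟩ := hvy
      exact ((hA _ _ (hs _ _ hvx)).mono Set.subset_union_left).trans
        ((hA _ _ (hs _ _ huv)).mono Set.subset_union_right)
  · rintro x y z w ⟨a1, a2, a3, a4⟩ ⟨b1, b2, b3, b4⟩ h1 h2 h3 h4
    have hvu := hs _ _ huv
    have hvx := hs v x
    have hvz := hs v z
    dsimp only
    split_ifs with ha hb hc hd' he hf
    · exact hd _ _ _ _ ha hb h1 h2 h3 h4
    · subst hc
      refine Set.disjoint_union_right.mpr ⟨?_, ?_⟩ <;> apply hd <;> grind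
    · refine Set.disjoint_union_right.mpr ⟨?_, ?_⟩ <;> apply hd <;> grind
    · subst hd'
      refine Set.disjoint_union_left.mpr ⟨?_, ?_⟩ <;> apply hd <;> grind
    · grind
    · grind
    · refine Set.disjoint_union_left.mpr ⟨?_, ?_⟩ <;> apply hd <;> grind
    · grind
    · grind

noncomputable def dg (adj : PX → PX → Prop) (S : Finset PX) (x : PX) : ℕ := (S.filter (adj x)).card

lemma contract_count {adj : PX → PX → Prop} (hs : ∀ x y, adj x y → adj y x)
    (hi : ∀ x, ¬ adj x x) (u v : PX) (huv : adj u v) (S : Finset PX) (hu : u ∈ S) (hv : v ∈ S) :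
    ∑ x ∈ S, dg adj S x ≤ ∑ x ∈ S.erase v, dg (contractAdj adj u v) (S.erase v) x +
      2 * (S.filter (fun x => adj u x ∧ adj v x)).card + 2 := by
  have hne : u ≠ v := fun h => hi u (by rw [← h] at huv; exact huv)
  have huS : u ∈ S.erase v := Finset.mem_erase.mpr ⟨hne, hu⟩
  rw [← Finset.add_sum_erase S _ hv, ← Finset.add_sum_erase (S.erase v) _ huS,
    ← Finset.add_sum_erase (S.erase v) _ huS]
  set com := S.filter (fun x => adj u x ∧ adj v x) with hcom
  have h1 : dg adj S v + dg adj S u ≤ dg (contractAdj adj u v) (S.erase v) u + com.card + 2 := by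
    unfold dg
    rw [← Finset.card_union_add_card_inter]
    have e1 : S.filter (adj v) ∩ S.filter (adj u) ⊆ com := by
      intro x; simp [hcom]; tauto
    have e2 : S.filter (adj v) ∪ S.filter (adj u) ⊆
        (S.erase v).filter (contractAdj adj u v u) ∪ {u, v} := by
      intro x; simp [contractAdj]; grind
    have := Finset.card_le_card e1
    have := Finset.card_le_card e2
    have := Finset.card_union_le ((S.erase v).filter (contractAdj adj u v u)) {u, v}
    have : ({u, v} : Finset PX).card ≤ 2 := Finset.card_le_two
    omega
  have h2 : ∑ x ∈ (S.erase v).erase u, dg adj S x ≤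
      ∑ x ∈ (S.erase v).erase u, (dg (contractAdj adj u v) (S.erase v) x +
        if (adj u x ∧ adj v x) then 1 else 0) := by
    apply Finset.sum_le_sum
    intro x hx
    simp only [Finset.mem_erase] at hx
    obtain ⟨hxu, hxv, hxS⟩ := hx
    unfold dg
    by_cases hxv' : adj x v
    · by_cases hxu' : adj x u
      · rw [if_pos ⟨hs _ _ hxu', hs _ _ hxv'⟩]
        have : S.filter (adj x) ⊆ (S.erase v).filter (contractAdj adj u v x) ∪ {v} := by
          intro y; simp [contractAdj]; grind
        have := Finset.card_le_card this
        have := Finset.card_union_le ((S.erase v).filter (contractAdj adj u v x)) {v}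
        simp at *; omega
      · have : insert u ((S.filter (adj x)).erase v) ⊆
            (S.erase v).filter (contractAdj adj u v x) := by
          intro y; simp [contractAdj]; grind
        have := Finset.card_le_card this
        rw [Finset.card_insert_of_notMem (by simp [hxu']), Finset.card_erase_of_mem
          (by simp [hxv', hv])] at this
        omega
    · have : S.filter (adj x) ⊆ (S.erase v).filter (contractAdj adj u v x) := by
        intro y; simp [contractAdj]; grind
      have := Finset.card_le_card this
      omega
  rw [Finset.sum_add_distrib] at h2
  have h3 : ∑ x ∈ (S.erase v).erase u, (if (adj u x ∧ adj v x) then 1 else 0) ≤ com.card := by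
    rw [← Finset.sum_filter, Finset.sum_const, smul_eq_mul, mul_one]
    apply Finset.card_le_card
    intro x; simp [hcom]; tauto
  omega

def cc : ℕ → ℕ
  | 0 => 0
  | (s+1) => 2 * cc s + 1

theorem mader (s : ℕ) : ∀ (N : ℕ) (adj : PX → PX → Prop), Drawable adj →
    (∀ x y, adj x y → adj y x) → (∀ x, ¬ adj x x) → ∀ (A S : Finset PX), S.card ≤ N → A.card + s = 3 →
    (∀ x ∈ A, ∀ y ∈ A, x ≠ y → adj x y) → (∀ x ∈ A, ∀ y ∈ S, adj x y) →
    ∑ x ∈ S, dg adj S x ≤ 2 * cc s * S.card := by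
  induction s with
  | zero =>
    intro N adj hD hs hi A S hN hA hAA hAS
    simp only [cc, mul_zero, zero_mul, nonpos_iff_eq_zero, Finset.sum_eq_zero_iff]
    intro u hu
    unfold dg
    rw [Finset.card_eq_zero, Finset.filter_eq_empty_iff]
    intro v hv huv
    have hne : u ≠ v := fun h => hi u (by rw [← h] at huv; exact huv)
    have hvA : v ∉ A := fun h => hi v (hAS v h v hv)
    have huA : u ∉ insert v A := by
      simp only [Finset.mem_insert, not_or]
      exact ⟨hne, fun h => hi u (hAS u h u hu)⟩
    refine hD.no_clique (insert u (insert v A)) ?_ ?_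
    · rw [Finset.card_insert_of_notMem huA, Finset.card_insert_of_notMem hvA]; omega
    · intro x hx y hy hxy
      simp only [Finset.mem_insert] at hx hy
      rcases hx with rfl | rfl | hx <;> rcases hy with rfl | rfl | hy
      · exact absurd rfl hxy
      · exact huv
      · exact hs _ _ (hAS y hy _ hu)
      · exact hs _ _ huv
      · exact absurd rfl hxy
      · exact hs _ _ (hAS y hy _ hv)
      · exact hAS x hx _ hu
      · exact hAS x hx _ hv
      · exact hAA x hx y hy hxy
  | succ s ih =>
    intro N
    induction N with
    | zero =>
      intro adj hD hs hi A S hN hA hAA hAS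
      have : S = ∅ := Finset.card_eq_zero.mp (by omega)
      simp [this]
    | succ N ihN =>
      intro adj hD hs hi A S hN hA hAA hAS
      by_contra hcon
      push Not at hcon
      by_cases hall : ∀ u ∈ S, ∀ v ∈ S, adj u v →
          cc (s+1) ≤ (S.filter (fun x => adj u x ∧ adj v x)).card
      · have hpos : ∑ x ∈ S, dg adj S x ≠ 0 := by omega
        obtain ⟨v, hv, hdv⟩ := Finset.exists_ne_zero_of_sum_ne_zero hpos
        have hvA : v ∉ A := fun h => hi v (hAS v h v hv)
        have := ih (S.filter (adj v)).card adj hD hs hi (insert v A) (S.filter (adj v)) le_rfl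
          (by rw [Finset.card_insert_of_notMem hvA]; omega) ?_ ?_
        · have h2 : (S.filter (adj v)).card * cc (s+1) ≤
              ∑ x ∈ S.filter (adj v), dg adj (S.filter (adj v)) x := by
            rw [← smul_eq_mul]
            apply Finset.card_nsmul_le_sum
            intro x hx
            rw [Finset.mem_filter] at hx
            refine (hall v hv x hx.1 hx.2).trans (le_of_eq ?_)
            unfold dg
            rw [Finset.filter_filter]
          have h3 : 0 < (S.filter (adj v)).card := Nat.pos_of_ne_zero hdv
          simp only [cc] at h2
          nlinarith
        · intro x hx y hy hxy
          simp only [Finset.mem_insert] at hx hy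
          rcases hx with rfl | hx <;> rcases hy with rfl | hy
          · exact absurd rfl hxy
          · exact hs _ _ (hAS y hy _ hv)
          · exact hAS x hx _ hv
          · exact hAA x hx y hy hxy
        · intro x hx y hy
          simp only [Finset.mem_insert, Finset.mem_filter] at hx hy
          rcases hx with rfl | hx
          · exact hy.2
          · exact hAS x hx y hy.1
      · push Not at hall
        obtain ⟨u, hu, v, hv, huv, hlt⟩ := hall
        have h1 := contract_count hs hi u v huv S hu hv
        have hcard := Finset.card_erase_add_one hv
        have hne : u ≠ v := fun h => hi u (by rw [← h] at huv; exact huv)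
        have h2 := ihN (contractAdj adj u v) (hD.contract hs hi u v huv)
          (by unfold contractAdj; intro x y; tauto) (by unfold contractAdj; tauto) A (S.erase v)
          (by omega) hA ?_ ?_
        · nlinarith
        · intro x hx y hy hxy
          have := hAA x hx y hy hxy
          have hx' : x ≠ v := fun h => hi v (hAS v (h ▸ hx) v hv)
          have hy' : y ≠ v := fun h => hi v (hAS v (h ▸ hy) v hv)
          exact ⟨hxy, hx', hy', Or.inl this⟩
        · intro x hx y hy
          rw [Finset.mem_erase] at hy
          have hx' : x ≠ v := fun h => hi v (hAS v (h ▸ hx) v hv)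
          have hxy : x ≠ y := fun h => hi y (hAS y (h ▸ hx) y hy.2)
          exact ⟨hxy, hx', hy.1, Or.inl (hAS x hx y hy.2)⟩

theorem planar_bound (adj : PX → PX → Prop) (hD : Drawable adj)
    (hs : ∀ x y, adj x y → adj y x) (hi : ∀ x, ¬ adj x x) (S : Finset PX) :
    ∑ x ∈ S, dg adj S x ≤ 14 * S.card := by
  have := mader 3 S.card adj hD hs hi ∅ S le_rfl (by simp) (by simp) (by simp)
  simpa [cc] using this

def indep {E W : Type} (a b : E → W) (e f : E) : Prop :=
  a e ≠ a f ∧ a e ≠ b f ∧ b e ≠ a f ∧ b e ≠ b f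

def crs {E W : Type} (a b : E → W) (Z : E → Set PX) (e f : E) : Prop :=
  indep a b e f ∧ ¬ Disjoint (Z e) (Z f)

def par {E W : Type} (a b : E → W) (e f : E) : Prop :=
  (a e = a f ∧ b e = b f) ∨ (a e = b f ∧ b e = a f)

lemma arcs_base {E : Type} (a b : E → PX) (Z : E → Set PX) (F : Finset E) (S : Finset PX)
    (hab : ∀ e ∈ F, a e ≠ b e) (hS : ∀ e ∈ F, a e ∈ S ∧ b e ∈ S)
    (hZ : ∀ e ∈ F, JoinedIn (Z e) (a e) (b e))
    (hcrs : ∀ e ∈ F, ∀ f ∈ F, ¬ crs a b Z e f)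
    (hpar : ∀ e ∈ F, ∀ f ∈ F, e ≠ f → ¬ par a b e f) : F.card ≤ 14 * S.card := by
  set adj : PX → PX → Prop := fun x y => ∃ e ∈ F, (a e = x ∧ b e = y) ∨ (a e = y ∧ b e = x) with hadj
  have hD : Drawable adj := by
    refine ⟨fun x y => if h : adj x y then Z h.choose else ∅, ?_, ?_⟩
    · intro x y h
      simp only [h, dif_pos]
      have hh := h.choose_spec
      have h2 := hZ _ hh.1
      rcases hh.2 with h3 | h3
      · rw [h3.1, h3.2] at h2; exact h2
      · rw [h3.1, h3.2] at h2; exact h2.symm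
    · intro x y z w h h' h1 h2 h3 h4
      simp only [h, h', dif_pos]
      by_contra hcon
      have hh := h.choose_spec
      have hh' := h'.choose_spec
      refine hcrs _ hh.1 _ hh'.1 ⟨?_, hcon⟩
      unfold indep
      rcases hh.2 with h5 | h5 <;> rcases hh'.2 with h6 | h6 <;> rw [h5.1, h5.2, h6.1, h6.2] <;>
        tauto
  have hb := planar_bound adj hD (by
    rintro x y ⟨e, he, h⟩; exact ⟨e, he, h.symm⟩) (by
    rintro x ⟨e, he, h⟩
    refine hab e he ?_
    rcases h with h | h <;> rw [h.1, h.2]) S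
  refine le_trans ?_ hb
  unfold dg
  rw [← Finset.card_sigma]
  refine Finset.card_le_card_of_injOn (fun e => ⟨a e, b e⟩) ?_ ?_
  · intro e he
    simp only [Finset.coe_sigma, Set.mem_sigma_iff, Finset.mem_coe, Finset.mem_filter]
    exact ⟨(hS e he).1, (hS e he).2, e, he, Or.inl ⟨rfl, rfl⟩⟩
  · intro e he f hf hef
    by_contra hne
    simp only [Sigma.mk.injEq, heq_eq_eq] at hef
    exact hpar e he f hf hne (Or.inl hef)

lemma arcs_linear {E : Type} (a b : E → PX) (Z : E → Set PX) (S : Finset PX) (N : ℕ) :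
    ∀ F : Finset E, F.card ≤ N →
    (∀ e ∈ F, a e ≠ b e) → (∀ e ∈ F, a e ∈ S ∧ b e ∈ S) →
    (∀ e ∈ F, JoinedIn (Z e) (a e) (b e)) →
    F.card ≤ 14 * S.card + ((F ×ˢ F).filter (fun x => crs a b Z x.1 x.2)).card
      + ((F ×ˢ F).filter (fun x => x.1 ≠ x.2 ∧ par a b x.1 x.2)).card := by
  induction N with
  | zero => intro F hF _ _ _; omega
  | succ N ih =>
    intro F hF hab hS hZ
    by_cases hc : ∃ e ∈ F, ∃ f ∈ F, crs a b Z e f ∨ (e ≠ f ∧ par a b e f)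
    · obtain ⟨e, he, f, hf, h⟩ := hc
      have hcard := Finset.card_erase_add_one he
      have h1 := ih (F.erase e) (by omega) (fun x hx => hab x (Finset.mem_of_mem_erase hx))
        (fun x hx => hS x (Finset.mem_of_mem_erase hx))
        (fun x hx => hZ x (Finset.mem_of_mem_erase hx))
      have s1 : ((F.erase e ×ˢ F.erase e).filter (fun x => crs a b Z x.1 x.2)) ⊆
          ((F ×ˢ F).filter (fun x => crs a b Z x.1 x.2)).erase (e, f) := by
        rintro ⟨x, y⟩; simp; grind
      have s2 : ((F.erase e ×ˢ F.erase e).filter (fun x => x.1 ≠ x.2 ∧ par a b x.1 x.2)) ⊆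
          ((F ×ˢ F).filter (fun x => x.1 ≠ x.2 ∧ par a b x.1 x.2)).erase (e, f) := by
        rintro ⟨x, y⟩; simp; grind
      have s1 := Finset.card_le_card s1
      have s2 := Finset.card_le_card s2
      rcases h with h | h
      · have hm : (e, f) ∈ ((F ×ˢ F).filter (fun x => crs a b Z x.1 x.2)) := by
          simp [he, hf, h]
        have := Finset.card_erase_add_one hm
        have := Finset.card_erase_le (s := ((F ×ˢ F).filter (fun x => x.1 ≠ x.2 ∧ par a b x.1 x.2))) (a := (e,f))
        omega
      · have hm : (e, f) ∈ ((F ×ˢ F).filter (fun x => x.1 ≠ x.2 ∧ par a b x.1 x.2)) := by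
          rw [Finset.mem_filter, Finset.mem_product]
          exact ⟨⟨he, hf⟩, h⟩
        have := Finset.card_erase_add_one hm
        have := Finset.card_erase_le (s := ((F ×ˢ F).filter (fun x => crs a b Z x.1 x.2))) (a := (e,f))
        omega
    · push Not at hc
      have := arcs_base a b Z F S hab hS hZ (fun e he f hf => (hc e he f hf).1)
        (fun e he f hf => (hc e he f hf).2)
      omega

lemma count_col (V : Type) [Fintype V] (q : ℕ) [NeZero q] (T : Finset V) :
    ((Finset.univ.filter fun f : V → Fin q => ∀ x ∈ T, f x = 0).card) * q ^ T.card =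
      q ^ (Fintype.card V) := by
  have : (Finset.univ.filter fun f : V → Fin q => ∀ x ∈ T, f x = 0) =
      Fintype.piFinset (fun x => if x ∈ T then {0} else Finset.univ) := by
    ext f
    simp only [Finset.mem_filter, Finset.mem_univ, true_and, Fintype.mem_piFinset]
    refine forall_congr' fun x => ?_
    by_cases h : x ∈ T <;> simp [h]
  rw [this, Fintype.card_piFinset]
  have h2 : ∀ x : V, (if x ∈ T then ({0} : Finset (Fin q)) else Finset.univ).card =
      if x ∈ T then 1 else q := by
    intro x; split_ifs <;> simp
  simp_rw [h2]
  rw [Finset.prod_ite]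
  simp only [Finset.prod_const_one, one_mul, Finset.prod_const]
  rw [← pow_add]
  congr 1
  have h3 : Finset.univ.filter (fun x => x ∈ T) = T := by ext; simp
  have h4 := Finset.card_filter_add_card_filter_not (s := (Finset.univ : Finset V)) (fun x => x ∈ T)
  rw [h3] at h4
  rw [Finset.card_univ] at h4
  omega

/-- number of colourings pairs with prescribed zero sets. -/
lemma count_col2 (V E : Type) [Fintype V] [Fintype E] (q r : ℕ) [NeZero q] [NeZero r]
    (T : Finset V) (U : Finset E) :
    ((Finset.univ.filter fun w : (V → Fin q) × (E → Fin r) =>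
      (∀ x ∈ T, w.1 x = 0) ∧ ∀ x ∈ U, w.2 x = 0).card : ℝ) =
      ((q : ℝ) ^ (Fintype.card V) * (r : ℝ) ^ (Fintype.card E)) / ((q:ℝ) ^ T.card * (r:ℝ) ^ U.card) := by
  have h1 := count_col V q T
  have h2 := count_col E r U
  have : (Finset.univ.filter fun w : (V → Fin q) × (E → Fin r) =>
      (∀ x ∈ T, w.1 x = 0) ∧ ∀ x ∈ U, w.2 x = 0) =
      (Finset.univ.filter fun f : V → Fin q => ∀ x ∈ T, f x = 0) ×ˢ
      (Finset.univ.filter fun f : E → Fin r => ∀ x ∈ U, f x = 0) := by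
    ext w; simp
  rw [this, Finset.card_product]
  have hq : (q : ℝ) ≠ 0 := by exact_mod_cast NeZero.ne q
  have hr : (r : ℝ) ≠ 0 := by exact_mod_cast NeZero.ne r
  rw [eq_div_iff (by positivity)]
  have h1' : ((Finset.univ.filter fun f : V → Fin q => ∀ x ∈ T, f x = 0).card : ℝ) * (q:ℝ) ^ T.card =
    (q:ℝ) ^ (Fintype.card V) := by exact_mod_cast h1
  have h2' : ((Finset.univ.filter fun f : E → Fin r => ∀ x ∈ U, f x = 0).card : ℝ) * (r:ℝ) ^ U.card =
    (r:ℝ) ^ (Fintype.card E) := by exact_mod_cast h2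
  rw [← h1', ← h2']
  push_cast
  ring

lemma crossing_sample {V E : Type} [Fintype V] [Fintype E] (p : V → PX) (hp : Function.Injective p)
    (a b : E → V) (Z : E → Set PX) (hab : ∀ e, a e ≠ b e)
    (hZ : ∀ e, JoinedIn (Z e) (p (a e)) (p (b e)))
    (μ q : ℕ) (hμ : 1 ≤ μ) (hq : 1 ≤ q)
    (hpar : ∀ e, (Finset.univ.filter (fun f => par a b e f)).card ≤ μ) :
    (q:ℝ) ^ 2 * μ * Fintype.card E ≤
      ((Finset.univ.filter (fun x : E × E => crs a b Z x.1 x.2)).card : ℝ)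
        + 56 * Fintype.card V * (q:ℝ) ^ 3 * (μ:ℝ) ^ 2 := by
  set r := 2 * μ with hr
  have : NeZero q := ⟨by omega⟩
  have : NeZero r := ⟨by omega⟩
  let Ω := (V → Fin q) × (E → Fin r)
  let Fw : Ω → Finset E := fun w => Finset.univ.filter (fun e =>
    (∀ x ∈ ({a e, b e} : Finset V), w.1 x = 0) ∧ ∀ x ∈ ({e} : Finset E), w.2 x = 0)
  let Sw : Ω → Finset V := fun w => Finset.univ.filter (fun v =>
    (∀ x ∈ ({v} : Finset V), w.1 x = 0) ∧ ∀ x ∈ (∅ : Finset E), w.2 x = 0)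
  set CR := Finset.univ.filter (fun x : E × E => crs a b Z x.1 x.2) with hCR
  set PR := Finset.univ.filter (fun x : E × E => x.1 ≠ x.2 ∧ par a b x.1 x.2) with hPR
  have hCRm : ∀ x y, (x, y) ∈ CR ↔ crs a b Z x y := by intro x y; simp [hCR]
  have hPRm : ∀ x y, (x, y) ∈ PR ↔ x ≠ y ∧ par a b x y := by intro x y; simp [hPR]
  let Cw : Ω → Finset (E × E) := fun w => CR.filter (fun y =>
    (∀ x ∈ ({a y.1, b y.1, a y.2, b y.2} : Finset V), w.1 x = 0) ∧
      ∀ x ∈ ({y.1, y.2} : Finset E), w.2 x = 0)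
  let Pw : Ω → Finset (E × E) := fun w => PR.filter (fun y =>
    (∀ x ∈ ({a y.1, b y.1} : Finset V), w.1 x = 0) ∧ ∀ x ∈ ({y.1, y.2} : Finset E), w.2 x = 0)
  have main : ∀ w, ((Fw w).card : ℝ) ≤ 14 * (Sw w).card + (Cw w).card + (Pw w).card := by
    intro w
    have h := arcs_linear (fun e => p (a e)) (fun e => p (b e)) Z ((Sw w).image p) (Fw w).card (Fw w)
      le_rfl (fun e _ h => hab e (hp h)) (by
        intro e he
        simp only [Fw, Finset.mem_filter, Finset.mem_univ, true_and, Finset.mem_insert,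
          Finset.mem_singleton, forall_eq_or_imp, forall_eq] at he
        simp only [Finset.mem_image]
        exact ⟨⟨a e, by simp [Sw, he], rfl⟩, ⟨b e, by simp [Sw, he], rfl⟩⟩) (fun e _ => hZ e)
    have h1 : ((Sw w).image p).card ≤ (Sw w).card := Finset.card_image_le
    have h2 : ((Fw w ×ˢ Fw w).filter
        (fun x => crs (fun e => p (a e)) (fun e => p (b e)) Z x.1 x.2)).card ≤ (Cw w).card := by
      apply Finset.card_le_card
      rintro ⟨x, y⟩
      simp only [Fw, Cw, hCRm, Finset.mem_filter, Finset.mem_univ, true_and, Finset.mem_insert,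
          Finset.mem_singleton, forall_eq_or_imp, forall_eq, Finset.mem_product, crs, indep,
          hp.ne_iff]
      tauto
    have h3 : ((Fw w ×ˢ Fw w).filter (fun x => x.1 ≠ x.2 ∧
        par (fun e => p (a e)) (fun e => p (b e)) x.1 x.2)).card ≤ (Pw w).card := by
      apply Finset.card_le_card
      rintro ⟨x, y⟩
      simp only [Fw, Pw, hPRm, Finset.mem_filter, Finset.mem_univ, true_and, Finset.mem_insert,
          Finset.mem_singleton, forall_eq_or_imp, forall_eq, Finset.mem_product, par,
          hp.eq_iff]
      tauto
    have : (Fw w).card ≤ 14 * (Sw w).card + (Cw w).card + (Pw w).card := by omega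
    exact_mod_cast this
  have hsum := Finset.sum_le_sum (s := (Finset.univ : Finset Ω)) (fun w _ => main w)
  rw [Finset.sum_add_distrib, Finset.sum_add_distrib, ← Finset.mul_sum] at hsum
  have swap : ∀ {α : Type} (s : Finset α) (T : α → Finset V) (U : α → Finset E),
      ∑ w : Ω, ((s.filter (fun y => (∀ x ∈ T y, w.1 x = 0) ∧ ∀ x ∈ U y, w.2 x = 0)).card : ℝ) =
      ∑ y ∈ s, ((q : ℝ) ^ (Fintype.card V) * (r : ℝ) ^ (Fintype.card E)) /
        ((q:ℝ) ^ (T y).card * (r:ℝ) ^ (U y).card) := by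
    intro α s T U
    simp_rw [← count_col2, Finset.card_filter]
    push_cast
    rw [Finset.sum_comm]
  have q0 : (0:ℝ) < q := by exact_mod_cast hq
  have r0 : (0:ℝ) < r := by exact_mod_cast (by omega : 0 < r)
  set N := (q : ℝ) ^ (Fintype.card V) * (r : ℝ) ^ (Fintype.card E) with hN
  have N0 : 0 < N := by positivity
  have e1 : ∑ w : Ω, ((Fw w).card : ℝ) = Fintype.card E * (N / ((q:ℝ)^2 * r)) := by
    rw [swap]
    rw [Finset.sum_congr rfl (g := fun _ => N / ((q:ℝ)^2 * r))]
    · simp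
    · intro e _
      rw [Finset.card_pair (hab e)]; simp
  have e2 : ∑ w : Ω, ((Sw w).card : ℝ) = Fintype.card V * (N / q) := by
    rw [swap]; simp
  have e3 : ∑ w : Ω, ((Cw w).card : ℝ) = CR.card * (N / ((q:ℝ)^4 * (r:ℝ)^2)) := by
    rw [swap]
    rw [Finset.sum_congr rfl (g := fun _ => N / ((q:ℝ)^4 * (r:ℝ)^2))]
    · simp
    · rintro ⟨e, f⟩ hef
      simp only [hCRm, crs, indep] at hef
      obtain ⟨⟨h1, h2, h3, h4⟩, -⟩ := hef
      have c4 : ({a e, b e, a f, b f} : Finset V).card = 4 := by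
        rw [Finset.card_insert_of_notMem, Finset.card_insert_of_notMem, Finset.card_pair (hab f)]
        · simp [h3, h4]
        · simp [h1, h2, hab e]
      have c2 : ({e, f} : Finset E).card = 2 := Finset.card_pair (fun h => h1 (by rw [h]))
      simp only [c4, c2]
  have e4 : ∑ w : Ω, ((Pw w).card : ℝ) = PR.card * (N / ((q:ℝ)^2 * (r:ℝ)^2)) := by
    rw [swap]
    rw [Finset.sum_congr rfl (g := fun _ => N / ((q:ℝ)^2 * (r:ℝ)^2))]
    · simp
    · rintro ⟨e, f⟩ hef
      rw [hPRm] at hef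
      have c2 : ({e, f} : Finset E).card = 2 := Finset.card_pair hef.1
      simp only [Finset.card_pair (hab e), c2]
  rw [e1, e2, e3, e4] at hsum
  have hPRc : PR.card ≤ Fintype.card E * μ := by
    have : PR ⊆ ((Finset.univ : Finset E).sigma
        (fun e => Finset.univ.filter (fun f => par a b e f))).image (fun x => (x.1, x.2)) := by
      rintro ⟨x, y⟩ hxy
      rw [hPRm] at hxy
      simp only [Finset.mem_image, Finset.mem_sigma, Finset.mem_filter, Finset.mem_univ, true_and]
      exact ⟨⟨x, y⟩, hxy.2, rfl⟩
    refine (Finset.card_le_card this).trans (Finset.card_image_le.trans ?_)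
    rw [Finset.card_sigma]
    refine (Finset.sum_le_card_nsmul _ _ μ (fun e _ => hpar e)).trans ?_
    simp
  have hPRc' : (PR.card : ℝ) ≤ Fintype.card E * μ := by exact_mod_cast hPRc
  have hrμ : (r:ℝ) = 2 * μ := by rw [hr]; push_cast; ring
  have μ0 : (0:ℝ) < μ := by exact_mod_cast hμ
  have hmul := mul_le_mul_of_nonneg_right hsum (by positivity : 0 ≤ (q:ℝ)^4 * (r:ℝ)^2 / N)
  have lhs : Fintype.card E * (N / ((q:ℝ)^2 * r)) * ((q:ℝ)^4 * (r:ℝ)^2 / N) =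
      Fintype.card E * (q:ℝ)^2 * r := by field_simp
  have rhs : (14 * (Fintype.card V * (N / q)) + CR.card * (N / ((q:ℝ)^4 * (r:ℝ)^2)) +
      PR.card * (N / ((q:ℝ)^2 * (r:ℝ)^2))) * ((q:ℝ)^4 * (r:ℝ)^2 / N) =
      14 * Fintype.card V * (q:ℝ)^3 * (r:ℝ)^2 + CR.card + PR.card * (q:ℝ)^2 := by field_simp
  rw [lhs, rhs, hrμ] at hmul
  have : (PR.card : ℝ) * (q:ℝ)^2 ≤ Fintype.card E * μ * (q:ℝ)^2 := by gcongr
  nlinarith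

theorem crossing_lemma {V E : Type} [Fintype V] [Fintype E] (p : V → PX) (hp : Function.Injective p)
    (a b : E → V) (Z : E → Set PX) (hab : ∀ e, a e ≠ b e)
    (hZ : ∀ e, JoinedIn (Z e) (p (a e)) (p (b e)))
    (μ : ℕ) (hμ : 1 ≤ μ)
    (hpar : ∀ e, (Finset.univ.filter (fun f => par a b e f)).card ≤ μ)
    (hbig : 112 * Fintype.card V * μ ≤ Fintype.card E) :
    (Fintype.card E : ℝ) ^ 3 ≤ 100352 * (Fintype.card V : ℝ) ^ 2 * μ *
      ((Finset.univ.filter (fun x : E × E => crs a b Z x.1 x.2)).card : ℝ) := by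
  rcases Nat.eq_zero_or_pos (Fintype.card E) with hE | hE
  · rw [hE]; norm_num; positivity
  obtain ⟨e0⟩ := Fintype.card_pos_iff.mp hE
  have hV : 0 < Fintype.card V := Fintype.card_pos_iff.mpr ⟨a e0⟩
  set n := Fintype.card V
  set E' := Fintype.card E
  set X := ((Finset.univ.filter (fun x : E × E => crs a b Z x.1 x.2)).card : ℝ)
  have hd : 0 < 112 * n * μ := by positivity
  set q := E' / (112 * n * μ) with hqdef
  have hq : 1 ≤ q := (Nat.one_le_div_iff hd).mpr hbig
  have hs := crossing_sample p hp a b Z hab hZ μ q hμ hq hpar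
  have h1 : q * (112 * n * μ) ≤ E' := Nat.div_mul_le_self _ _
  have h2 : E' < (q + 1) * (112 * n * μ) := by
    rw [hqdef, ← Nat.div_lt_iff_lt_mul hd]; omega
  have h3 : E' ≤ q * (224 * n * μ) := by nlinarith
  have h1' : (q:ℝ) * (112 * n * μ) ≤ E' := by exact_mod_cast h1
  have h3' : (E':ℝ) ≤ q * (224 * n * μ) := by exact_mod_cast h3
  have q0 : (0:ℝ) < q := by exact_mod_cast hq
  have μ0 : (0:ℝ) < μ := by exact_mod_cast hμ
  have n0 : (0:ℝ) < n := by exact_mod_cast hV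
  have E0 : (0:ℝ) < E' := by exact_mod_cast hE
  have hX : (q:ℝ)^2 * μ * E' ≤ 2 * X := by
    have : (q:ℝ)^2 * μ * ((q:ℝ) * (112 * n * μ)) ≤ (q:ℝ)^2 * μ * E' := by gcongr
    nlinarith
  have hsq : (E':ℝ)^2 ≤ (q * (224 * n * μ))^2 := by gcongr
  calc (E':ℝ)^3 = (E':ℝ)^2 * E' := by ring
    _ ≤ ((q:ℝ) * (224 * n * μ))^2 * E' := by gcongr
    _ = 50176 * (n:ℝ)^2 * μ * ((q:ℝ)^2 * μ * E') := by ring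
    _ ≤ 50176 * (n:ℝ)^2 * μ * (2 * X) := by gcongr
    _ = _ := by ring

lemma curve_enum (γ : Set PX) (hγ : IsSimpleCurve γ) (R : Finset PX) :
    ∃ (pt : ℕ → PX) (arc : ℕ → Set PX),
      (∀ i j, i < (R.filter (· ∈ γ)).card → j < (R.filter (· ∈ γ)).card → pt i = pt j → i = j) ∧
      (∀ i, i < (R.filter (· ∈ γ)).card → pt i ∈ R ∧ pt i ∈ γ) ∧
      (∀ i, i + 1 < (R.filter (· ∈ γ)).card → JoinedIn (arc i) (pt i) (pt (i+1)) ∧ arc i ⊆ γ ∧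
        ∀ x ∈ arc i, x ∈ R → x = pt i ∨ x = pt (i+1)) ∧
      (∀ i j, i + 1 < (R.filter (· ∈ γ)).card → j + 1 < (R.filter (· ∈ γ)).card → i ≠ j →
        ∀ x, x ∈ arc i → x ∈ arc j → x ∈ R) := by
  obtain ⟨f, hf, hinj, rfl⟩ := hγ
  let T : Finset (Set.Icc (0:ℝ) 1) := R.preimage f hinj.injOn
  have hT : T.card = (R.filter (· ∈ Set.range f)).card := by
    rw [← Finset.card_image_of_injective T hinj, Finset.image_preimage]
  set s := (R.filter (· ∈ Set.range f)).card with hs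
  let o := T.orderEmbOfFin hT
  let τ : ℕ → Set.Icc (0:ℝ) 1 := fun i => if h : i < s then o ⟨i, h⟩ else 0
  have hτ : ∀ i (h : i < s), τ i = o ⟨i, h⟩ := fun i h => by simp [τ, h]
  have hmono : ∀ i j, i < s → j < s → (τ i ≤ τ j ↔ i ≤ j) := by
    intro i j hi hj
    rw [hτ i hi, hτ j hj, OrderEmbedding.le_iff_le]; simp
  have hmem : ∀ i, i < s → f (τ i) ∈ R := by
    intro i hi
    rw [hτ i hi]
    have := Finset.orderEmbOfFin_mem T hT ⟨i, hi⟩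
    exact Finset.mem_preimage.mp this
  have hsurj : ∀ t, f t ∈ R → ∃ j, j < s ∧ τ j = t := by
    intro t ht
    have h1 : t ∈ T := by simpa [T] using ht
    have h2 : t ∈ Set.range (T.orderEmbOfFin hT) := by
      rw [Finset.range_orderEmbOfFin]; exact h1
    obtain ⟨j, hj⟩ := h2
    exact ⟨j, j.2, by rw [hτ j j.2]; exact hj⟩
  refine ⟨fun i => f (τ i), fun i => Set.image f (Set.Icc (τ i) (τ (i+1))), ?_, ?_, ?_, ?_⟩
  · intro i j hi hj h
    have := hinj h
    have h1 := (hmono i j hi hj).mp this.le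
    have h2 := (hmono j i hj hi).mp this.ge
    omega
  · intro i hi
    exact ⟨hmem i hi, Set.mem_range_self _⟩
  · intro i hi
    refine ⟨?_, Set.image_subset_range _ _, ?_⟩
    · have hle : τ i ≤ τ (i+1) := (hmono _ _ (by omega) hi).mpr (by omega)
      have hconv : Convex ℝ (Set.Icc (τ i : ℝ) (τ (i+1))) := convex_Icc _ _
      have hj := (hconv.isPathConnected ⟨_, Set.left_mem_Icc.mpr hle⟩).joinedIn _
        (Set.left_mem_Icc.mpr hle) _ (Set.right_mem_Icc.mpr hle)
      obtain ⟨g, hg⟩ := hj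
      have h01 : ∀ t, g t ∈ Set.Icc (0:ℝ) 1 := fun t =>
        ⟨(τ i).2.1.trans (hg t).1, (hg t).2.trans (τ (i+1)).2.2⟩
      refine ⟨⟨⟨fun t => f ⟨g t, h01 t⟩, ?_⟩, ?_, ?_⟩, ?_⟩
      · exact hf.comp (Continuous.subtype_mk g.continuous _)
      · simp
      · simp
      · intro t
        exact ⟨⟨g t, h01 t⟩, ⟨(hg t).1, (hg t).2⟩, rfl⟩
    · rintro x ⟨t, ht, rfl⟩ hx
      obtain ⟨j, hj, rfl⟩ := hsurj t hx
      have h1 := (hmono i j (by omega) hj).mp ht.1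
      have h2 := (hmono j (i+1) hj hi).mp ht.2
      have : j = i ∨ j = i + 1 := by omega
      rcases this with rfl | rfl <;> simp
  · have key : ∀ i j, i + 1 < s → j + 1 < s → i < j → ∀ x, x ∈ Set.image f (Set.Icc (τ i) (τ (i+1))) →
        x ∈ Set.image f (Set.Icc (τ j) (τ (j+1))) → x ∈ R := by
      rintro i j hi hj hij x ⟨t, ht, rfl⟩ ⟨u, hu, hut⟩
      have := hinj hut
      subst this
      have h1 : τ (i+1) ≤ τ j := (hmono _ _ hi (by omega)).mpr hij
      have : u = τ j := le_antisymm (ht.2.trans h1) hu.1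
      rw [this]
      exact hmem j (by omega)
    intro i j hi hj hij x hx hx'
    rcases lt_or_gt_of_ne hij with h | h
    · exact key i j hi hj h x hx hx'
    · exact key j i hj hi h x hx' hx

lemma walk_count (Q : Finset PX) (hv : PX → PX → Prop) (D : ℕ)
    (hD : ∀ x ∈ Q, (Q.filter (hv x)).card ≤ D) (k : ℕ) :
    ((Fintype.piFinset (fun _ : Fin (k+1) => Q)).filter
      (fun w => ∀ i : Fin k, hv (w i.castSucc) (w i.succ))).card ≤ Q.card * D ^ k := by
  induction k with
  | zero =>
    refine (Finset.card_filter_le _ _).trans ?_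
    simp
  | succ k ih =>
    refine (Finset.card_le_mul_card_image_of_maps_to (f := fun w => Fin.init w)
      (t := ((Fintype.piFinset (fun _ : Fin (k+1) => Q)).filter
      (fun w => ∀ i : Fin k, hv (w i.castSucc) (w i.succ)))) ?_ D ?_).trans ?_
    · intro w hw
      simp only [Finset.mem_filter, Fintype.mem_piFinset] at hw ⊢
      refine ⟨fun i => hw.1 _, fun i => ?_⟩
      have := hw.2 i.castSucc
      simpa [Fin.init] using this
    · intro b hb
      simp only [Finset.mem_filter, Fintype.mem_piFinset] at hb
      refine le_trans ?_ (hD (b (Fin.last k)) (hb.1 _))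
      refine Finset.card_le_card_of_injOn (fun w => w (Fin.last (k+1))) ?_ ?_
      · intro w hw
        simp only [Finset.coe_filter, Finset.mem_filter, Fintype.mem_piFinset,
          Set.mem_ofPred_eq] at hw ⊢
        obtain ⟨⟨h1, h2⟩, h3⟩ := hw
        refine ⟨h1 _, ?_⟩
        have := h2 (Fin.last k)
        rw [← h3]
        simpa [Fin.init] using this
      · intro w hw w' hw' h
        simp only [Finset.coe_filter, Set.mem_ofPred_eq] at hw hw'
        rw [← Fin.snoc_init_self w, ← Fin.snoc_init_self w', hw.2, hw'.2]
        simp only at h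
        rw [h]
    · calc D * _ ≤ D * (Q.card * D ^ k) := Nat.mul_le_mul_left _ ih
        _ = _ := by ring

lemma index_count (γ : Set PX) (R Q : Finset PX) (hQR : Q ⊆ R) (k : ℕ) (pt : ℕ → PX)
    (hinj : ∀ i j, i < (R.filter (· ∈ γ)).card → j < (R.filter (· ∈ γ)).card → pt i = pt j → i = j)
    (hmem : ∀ i, i < (R.filter (· ∈ γ)).card → pt i ∈ R ∧ pt i ∈ γ) :
    (Q.filter (fun p => p ∈ γ)).card ≤ ((Finset.range R.card).filter (fun i =>
      i + k < (R.filter (· ∈ γ)).card ∧ ∀ l ≤ k, pt (i + l) ∈ Q)).card + k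
      + (k+1) * ((R \ Q).filter (fun p => p ∈ γ)).card := by
  set s := (R.filter (· ∈ γ)).card with hs
  have hsR : s ≤ R.card := Finset.card_filter_le _ _
  have himg : (Finset.range s).image pt = R.filter (· ∈ γ) := by
    apply Finset.eq_of_subset_of_card_le
    · intro x hx
      simp only [Finset.mem_image, Finset.mem_range] at hx
      obtain ⟨i, hi, rfl⟩ := hx
      exact Finset.mem_filter.mpr (hmem i hi)
    · rw [Finset.card_image_of_injOn, Finset.card_range]
      intro i hi j hj h
      exact hinj i j (by simpa using hi) (by simpa using hj) h
  set J := (Finset.range s).filter (fun i => pt i ∈ Q) with hJ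
  have h1 : (Q.filter (fun p => p ∈ γ)).card ≤ J.card := by
    refine le_trans (Finset.card_le_card ?_) (Finset.card_image_le (s := J) (f := pt))
    intro x hx
    rw [Finset.mem_filter] at hx
    have : x ∈ (Finset.range s).image pt := by
      rw [himg]; exact Finset.mem_filter.mpr ⟨hQR hx.1, hx.2⟩
    obtain ⟨i, hi, rfl⟩ := Finset.mem_image.mp this
    exact Finset.mem_image.mpr ⟨i, Finset.mem_filter.mpr ⟨hi, hx.1⟩, rfl⟩
  set B := (Finset.range s).filter (fun i => ∃ l, l ≤ k ∧ i + l < s ∧ pt (i+l) ∉ Q) with hB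
  have h2 : B.card ≤ (k+1) * ((R \ Q).filter (fun p => p ∈ γ)).card := by
    have hch : ∀ i, ∃ l, i ∈ B → l ≤ k ∧ i + l < s ∧ pt (i+l) ∉ Q := by
      intro i
      by_cases h : i ∈ B
      · obtain ⟨l, hl⟩ := (Finset.mem_filter.mp h).2
        exact ⟨l, fun _ => hl⟩
      · exact ⟨0, fun h' => absurd h' h⟩
    choose l hl using hch
    have : B.card ≤ (Finset.range (k+1) ×ˢ ((R \ Q).filter (fun p => p ∈ γ))).card := by
      refine Finset.card_le_card_of_injOn (fun i => (l i, pt (i + l i))) ?_ ?_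
      · intro i hi
        obtain ⟨a1, a2, a3⟩ := hl i hi
        have := hmem _ a2
        simp only [Finset.coe_product, Set.mem_prod, Finset.mem_coe, Finset.mem_range,
          Finset.mem_filter, Finset.mem_sdiff]
        exact ⟨by omega, ⟨this.1, a3⟩, this.2⟩
      · intro i hi j hj h
        obtain ⟨a1, a2, a3⟩ := hl i hi
        obtain ⟨b1, b2, b3⟩ := hl j hj
        simp only [Prod.mk.injEq] at h
        have := hinj _ _ a2 b2 h.2
        omega
    simpa [Finset.card_product] using this
  have h3 : J ⊆ ((Finset.range R.card).filter (fun i =>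
      i + k < s ∧ ∀ l ≤ k, pt (i + l) ∈ Q)) ∪ Finset.Ico (s - k) s ∪ B := by
    intro i hi
    rw [hJ, Finset.mem_filter, Finset.mem_range] at hi
    simp only [Finset.mem_union, Finset.mem_filter, Finset.mem_range, Finset.mem_Ico, hB]
    by_cases h : i + k < s
    · by_cases h' : ∀ l ≤ k, pt (i + l) ∈ Q
      · left; left; exact ⟨by omega, h, h'⟩
      · push Not at h'
        obtain ⟨l, hl, hl'⟩ := h'
        right; exact ⟨hi.1, l, hl, by omega, hl'⟩
    · left; right; omega
  have h4 := (Finset.card_le_card h3).trans (Finset.card_union_le _ _)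
  have h5 := Finset.card_union_le ((Finset.range R.card).filter (fun i =>
      i + k < s ∧ ∀ l ≤ k, pt (i + l) ∈ Q)) (Finset.Ico (s - k) s)
  rw [Nat.card_Ico] at h5
  omega

lemma window (k : ℕ) (hk : 1 ≤ k) (C : Finset (Set PX)) (hC : KIntersecting C k)
    (Q R : Finset PX) (hQR : Q ⊆ R) (M D : ℕ) (hM : 1 ≤ M)
    (hdeg : ∀ x ∈ Q, 2 * (C.filter (fun γ => x ∈ γ)).card < (D+1) * (M+1)) :
    ∃ F : ℕ, incidences Q C ≤ Q.card * D ^ k + k * F + k * C.card + (k+1) * incidences (R \ Q) C ∧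
      (112 * Q.card * M ≤ F → (F:ℝ)^3 ≤ 100352 * (Q.card : ℝ)^2 * M *
        ((∑ e ∈ C.offDiag, ((e.1 ∩ e.2) \ (↑R : Set PX)).ncard : ℕ) : ℝ)) := by
  set s : Set PX → ℕ := fun γ => (R.filter (· ∈ γ)).card with hs
  have hch : ∀ γ : Set PX, ∃ (pt : ℕ → PX) (arc : ℕ → Set PX), γ ∈ C →
      (∀ i j, i < s γ → j < s γ → pt i = pt j → i = j) ∧
      (∀ i, i < s γ → pt i ∈ R ∧ pt i ∈ γ) ∧
      (∀ i, i + 1 < s γ → JoinedIn (arc i) (pt i) (pt (i+1)) ∧ arc i ⊆ γ ∧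
        ∀ x ∈ arc i, x ∈ R → x = pt i ∨ x = pt (i+1)) ∧
      (∀ i j, i + 1 < s γ → j + 1 < s γ → i ≠ j → ∀ x, x ∈ arc i → x ∈ arc j → x ∈ R) := by
    intro γ
    by_cases h : γ ∈ C
    · obtain ⟨pt, arc, h'⟩ := curve_enum γ (hC.1 γ h) R
      exact ⟨pt, arc, fun _ => h'⟩
    · exact ⟨fun _ => 0, fun _ => ∅, fun h' => absurd h' h⟩
  choose pt arc hpa using hch
  have hinj := fun γ h => (hpa γ h).1
  have hmem := fun γ h => (hpa γ h).2.1
  have harc := fun γ h => (hpa γ h).2.2.1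
  have hdis := fun γ h => (hpa γ h).2.2.2
  clear hpa
  have hsR : ∀ γ, s γ ≤ R.card := fun γ => Finset.card_filter_le _ _
  let A : Set PX × ℕ → PX := fun e => pt e.1 e.2
  let B : Set PX × ℕ → PX := fun e => pt e.1 (e.2+1)
  set E0 : Finset (Set PX × ℕ) := (C ×ˢ Finset.range R.card).filter
    (fun e => e.2 + 1 < s e.1 ∧ pt e.1 e.2 ∈ Q ∧ pt e.1 (e.2+1) ∈ Q) with hE0
  have mE0 : ∀ e, e ∈ E0 ↔ e.1 ∈ C ∧ e.2 + 1 < s e.1 ∧ A e ∈ Q ∧ B e ∈ Q := by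
    intro e
    simp only [hE0, Finset.mem_filter, Finset.mem_product, Finset.mem_range, A, B]
    have := hsR e.1
    constructor
    · rintro ⟨h1, h2⟩; exact ⟨h1.1, h2⟩
    · rintro ⟨h1, h2⟩; exact ⟨⟨h1, by omega⟩, h2⟩
  let mu : PX → PX → ℕ := fun x y =>
    (E0.filter (fun e => (A e = x ∧ B e = y) ∨ (A e = y ∧ B e = x))).card
  let hv : PX → PX → Prop := fun x y => M < mu x y
  set F := E0.filter (fun e => mu (A e) (B e) ≤ M) with hF
  -- heavy degree
  have hheavy : ∀ x ∈ Q, (Q.filter (hv x)).card ≤ D := by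
    intro x hx
    have h1 : (Q.filter (hv x)).card * (M+1) ≤ ∑ y ∈ Q.filter (hv x), mu x y := by
      rw [← smul_eq_mul]
      exact Finset.card_nsmul_le_sum _ _ _ (fun y hy => (Finset.mem_filter.mp hy).2)
    have h2 : ∑ y ∈ Q.filter (hv x), mu x y ≤ (E0.filter (fun e => A e = x ∨ B e = x)).card := by
      rw [← Finset.card_biUnion]
      · apply Finset.card_le_card
        intro e he
        simp only [Finset.mem_biUnion, Finset.mem_filter] at he ⊢
        obtain ⟨y, -, h, h'⟩ := he
        exact ⟨h, by tauto⟩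
      · intro y _ z _ hyz
        rw [Function.onFun, Finset.disjoint_left]
        intro e he he'
        simp only [Finset.mem_filter] at he he'
        apply hyz
        rcases he.2 with h | h <;> rcases he'.2 with h' | h'
        · rw [← h.2, h'.2]
        · rw [← h.2, h'.2, ← h'.1, h.1]
        · rw [← h.1, h'.1, ← h'.2, h.2]
        · rw [← h.1, h'.1]
    have h3 : (E0.filter (fun e => A e = x ∨ B e = x)).card ≤
        2 * (C.filter (fun γ => x ∈ γ)).card := by
      rw [Finset.filter_or]
      refine (Finset.card_union_le _ _).trans ?_
      rw [two_mul]
      apply Nat.add_le_add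
      · refine Finset.card_le_card_of_injOn Prod.fst ?_ ?_
        · intro e he
          simp only [Finset.coe_filter, Set.mem_ofPred_eq, mE0] at he ⊢
          exact ⟨he.1.1, he.2 ▸ (hmem e.1 he.1.1 _ (by omega)).2⟩
        · rintro ⟨γ, i⟩ he ⟨γ', j⟩ he' h
          simp only [Finset.coe_filter, Set.mem_ofPred_eq, mE0] at he he' h
          subst h
          have := hinj γ he.1.1 i j (by omega) (by omega) (he.2.trans he'.2.symm)
          rw [this]
      · refine Finset.card_le_card_of_injOn Prod.fst ?_ ?_
        · intro e he
          simp only [Finset.coe_filter, Set.mem_ofPred_eq, mE0] at he ⊢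
          exact ⟨he.1.1, he.2 ▸ (hmem e.1 he.1.1 _ (by omega)).2⟩
        · rintro ⟨γ, i⟩ he ⟨γ', j⟩ he' h
          simp only [Finset.coe_filter, Set.mem_ofPred_eq, mE0] at he he' h
          subst h
          have := hinj γ he.1.1 (i+1) (j+1) (by omega) (by omega) (he.2.trans he'.2.symm)
          have : i = j := by omega
          rw [this]
    have h4 := hdeg x hx
    have h5 : (Q.filter (hv x)).card * (M+1) < (D+1) * (M+1) := by omega
    have := lt_of_mul_lt_mul_right h5 (Nat.zero_le _)
    omega
  -- windows
  set W : Finset (Set PX × ℕ) := (C ×ˢ Finset.range R.card).filter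
    (fun e => e.2 + k < s e.1 ∧ ∀ l ≤ k, pt e.1 (e.2+l) ∈ Q) with hW
  have hcount : incidences Q C ≤ W.card + k * C.card + (k+1) * incidences (R \ Q) C := by
    unfold incidences
    have hWc : W.card = ∑ γ ∈ C, ((Finset.range R.card).filter (fun i =>
        i + k < s γ ∧ ∀ l ≤ k, pt γ (i + l) ∈ Q)).card := by
      rw [hW, Finset.card_filter, Finset.sum_product]
      refine Finset.sum_congr rfl (fun γ _ => ?_)
      rw [Finset.card_filter]
    rw [hWc, Finset.mul_sum, mul_comm k, ← smul_eq_mul C.card k, ← Finset.sum_const,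
      ← Finset.sum_add_distrib, ← Finset.sum_add_distrib]
    refine Finset.sum_le_sum (fun γ hγ => ?_)
    exact index_count γ R Q hQR k (pt γ) (hinj γ hγ) (hmem γ hγ)
  set W1 := W.filter (fun e => ∀ l : Fin k, hv (pt e.1 (e.2+l)) (pt e.1 (e.2+l+1))) with hW1
  have hw1 : W1.card ≤ Q.card * D ^ k := by
    refine le_trans ?_ (walk_count Q hv D (fun x hx => by convert hheavy x hx) k)
    refine Finset.card_le_card_of_injOn (fun e => fun l : Fin (k+1) => pt e.1 (e.2 + l)) ?_ ?_
    · intro e he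
      simp only [hW1, hW, Finset.coe_filter, Finset.mem_filter, Set.mem_ofPred_eq,
        Fintype.mem_piFinset] at he ⊢
      refine ⟨fun l => he.1.2.2 l (by omega), fun l => ?_⟩
      simpa [add_assoc] using he.2 l
    · rintro ⟨γ, i⟩ he ⟨γ', j⟩ he' h
      simp only [hW1, hW, Finset.coe_filter, Finset.mem_filter, Set.mem_ofPred_eq,
        Finset.mem_product] at he he'
      have hl : ∀ l : Fin (k+1), pt γ (i + l) = pt γ' (j + l) := fun l => congrFun h l
      have hγ := he.1.1.1
      have hγ' := he'.1.1.1
      have hgg : γ = γ' := by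
        by_contra hne
        obtain ⟨h1, h2⟩ := hC.2 γ hγ γ' hγ' hne
        have : k + 1 ≤ (γ ∩ γ').ncard := by
          have h3 : (Finset.univ.image (fun l : Fin (k+1) => pt γ (i + l))).card = k + 1 := by
            rw [Finset.card_image_of_injective]
            · simp
            · intro l l' hll
              have := hinj γ hγ (i+l) (i+l') (by omega) (by omega) hll
              ext; omega
          rw [← h3, ← Set.ncard_coe_finset]
          apply Set.ncard_le_ncard _ h1
          intro x hx
          simp only [Finset.coe_image, Set.mem_image, Finset.coe_univ, Set.mem_univ, true_and] at hx
          obtain ⟨l, rfl⟩ := hx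
          refine ⟨(hmem γ hγ _ (by omega)).2, ?_⟩
          rw [hl l]
          exact (hmem γ' hγ' _ (by omega)).2
        omega
      subst hgg
      have := hinj γ hγ (i+0) (j+0) (by omega) (by omega) (hl 0)
      have : i = j := by omega
      rw [this]
  have hw2 : (W \ W1).card ≤ k * F.card := by
    have hch : ∀ e, ∃ l : ℕ, e ∈ W \ W1 → l < k ∧ (e.1, e.2 + l) ∈ F := by
      intro e
      by_cases he : e ∈ W \ W1
      · have he' := he
        simp only [hW1, Finset.mem_sdiff, Finset.mem_filter, not_and, not_forall] at he'
        obtain ⟨h1, h2⟩ := he'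
        obtain ⟨l, hl⟩ := h2 h1
        refine ⟨l, fun _ => ⟨l.2, ?_⟩⟩
        simp only [hW, Finset.mem_filter, Finset.mem_product] at h1
        rw [hF, Finset.mem_filter, mE0]
        refine ⟨⟨h1.1.1, ?_, h1.2.2 l l.2.le, h1.2.2 (l+1) l.2⟩, not_lt.mp hl⟩
        have := l.2
        have := h1.2.1
        simp only
        omega
      · exact ⟨0, fun h => absurd h he⟩
    choose l hl using hch
    have : (W \ W1).card ≤ (Finset.range k ×ˢ F).card := by
      refine Finset.card_le_card_of_injOn (fun e => (l e, (e.1, e.2 + l e))) ?_ ?_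
      · intro e he
        obtain ⟨h1, h2⟩ := hl e he
        simp only [Finset.coe_product, Set.mem_prod, Finset.mem_coe, Finset.mem_range]
        exact ⟨h1, h2⟩
      · rintro ⟨γ, i⟩ he ⟨γ', j⟩ he' h
        simp only [Prod.mk.injEq] at h ⊢
        exact ⟨h.2.1, by omega⟩
    simpa [Finset.card_product] using this
  have hWs : W.card = (W \ W1).card + W1.card :=
    (Finset.card_sdiff_add_card_eq_card (Finset.filter_subset _ _)).symm
  refine ⟨F.card, by omega, ?_⟩
  intro hbig
  have mF : ∀ e ∈ F, e.1 ∈ C ∧ e.2 + 1 < s e.1 ∧ A e ∈ Q ∧ B e ∈ Q := fun e he =>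
    (mE0 e).mp (Finset.mem_filter.mp he).1
  let a : F → Q := fun e => ⟨A e, (mF e e.2).2.2.1⟩
  let b : F → Q := fun e => ⟨B e, (mF e e.2).2.2.2⟩
  let Z : F → Set PX := fun e => arc e.1.1 e.1.2
  have hcl := crossing_lemma (fun q : Q => (q : PX)) Subtype.val_injective a b Z ?_ ?_ M hM ?_ ?_
  · rw [Fintype.card_coe, Fintype.card_coe] at hcl
    refine hcl.trans ?_
    gcongr
    -- crossings count
    have hmaps : ∀ x ∈ Finset.univ.filter (fun x : F × F => crs a b Z x.1 x.2),
        ∃ y, y ∈ Z x.1 ∧ y ∈ Z x.2 ∧ y ∉ R ∧ x.1.1.1 ≠ x.2.1.1 := by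
      rintro ⟨e, f⟩ hx
      obtain ⟨hi, hd⟩ := (Finset.mem_filter.mp hx).2
      rw [Set.not_disjoint_iff] at hd
      obtain ⟨y, hy, hy'⟩ := hd
      obtain ⟨i1, i2, i3, i4⟩ := hi
      have i1 : A e ≠ A f := fun h => i1 (Subtype.ext h)
      have i2 : A e ≠ B f := fun h => i2 (Subtype.ext h)
      have i3 : B e ≠ A f := fun h => i3 (Subtype.ext h)
      have i4 : B e ≠ B f := fun h => i4 (Subtype.ext h)
      have he := mF e e.2
      have hf := mF f f.2
      have hyR : y ∉ R := by
        intro hR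
        have h1 := (harc _ he.1 _ he.2.1).2.2 y hy hR
        have h2 := (harc _ hf.1 _ hf.2.1).2.2 y hy' hR
        rcases h1 with h1 | h1 <;> rcases h2 with h2 | h2
        · exact i1 (h1.symm.trans h2)
        · exact i2 (h1.symm.trans h2)
        · exact i3 (h1.symm.trans h2)
        · exact i4 (h1.symm.trans h2)
      refine ⟨y, hy, hy', hyR, ?_⟩
      intro hee
      simp only at hee
      have hne : (e : Set PX × ℕ).2 ≠ (f : Set PX × ℕ).2 := by
        intro h
        apply i1
        show pt _ _ = pt _ _
        rw [hee, h]
      apply hyR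
      refine hdis _ he.1 _ _ he.2.1 (by rw [hee]; exact hf.2.1) hne y hy ?_
      rw [hee]; exact hy'
    choose! cy hcy using hmaps
    rw [Finset.card_eq_sum_card_fiberwise (f := fun x : F × F => (x.1.1.1, x.2.1.1))
      (t := C.offDiag)]
    · refine Finset.sum_le_sum ?_
      rintro ⟨γ, γ'⟩ hg
      rw [Finset.mem_offDiag] at hg
      have hfin : ((γ ∩ γ') \ (↑R : Set PX)).Finite :=
        (hC.2 γ hg.1 γ' hg.2.1 hg.2.2).1.subset Set.sdiff_subset
      rw [Set.ncard_eq_toFinset_card _ hfin]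
      refine Finset.card_le_card_of_injOn cy ?_ ?_
      · rintro ⟨e, f⟩ hx
        have hx := Finset.mem_filter.mp (Finset.mem_coe.mp hx)
        obtain ⟨h1, h2, h3, h4⟩ := hcy _ hx.1
        simp only [Prod.mk.injEq] at hx
        have he := mF e e.2
        have hf := mF f f.2
        simp only [Set.Finite.coe_toFinset]
        refine ⟨⟨?_, ?_⟩, h3⟩
        · rw [← hx.2.1]; exact (harc _ he.1 _ he.2.1).2.1 h1
        · rw [← hx.2.2]; exact (harc _ hf.1 _ hf.2.1).2.1 h2
      · rintro ⟨e, f⟩ hx ⟨e', f'⟩ hx' hyy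
        have hx := Finset.mem_filter.mp (Finset.mem_coe.mp hx)
        have hx' := Finset.mem_filter.mp (Finset.mem_coe.mp hx')
        obtain ⟨h1, h2, h3, h4⟩ := hcy _ hx.1
        obtain ⟨h1', h2', h3', h4'⟩ := hcy _ hx'.1
        simp only [Prod.mk.injEq] at hx hx'
        rw [← hyy] at h1' h2'
        have key : ∀ e e' : F, e.1.1 = e'.1.1 → ∀ y, y ∉ R → y ∈ Z e → y ∈ Z e' → e = e' := by
          intro e e' hee y hyR hy hy'
          by_contra hne
          apply hyR
          have he := mF e e.2
          have hf := mF e' e'.2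
          refine hdis _ he.1 e.1.2 e'.1.2 he.2.1 (by rw [hee]; exact hf.2.1) ?_ y hy ?_
          · intro h
            exact hne (Subtype.ext (Prod.ext hee h))
          · rw [hee]; exact hy'
        rw [key e e' (hx.2.1.trans hx'.2.1.symm) _ h3 h1 h1',
          key f f' (hx.2.2.trans hx'.2.2.symm) _ h3 h2 h2']
    · rintro ⟨e, f⟩ hx
      obtain ⟨h1, h2, h3, h4⟩ := hcy _ hx
      exact Finset.mem_coe.mpr (Finset.mem_offDiag.mpr ⟨(mF e e.2).1, (mF f f.2).1, h4⟩)
  · intro e h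
    have he := mF e e.2
    have := hinj _ he.1 _ _ (by omega) he.2.1 (congrArg Subtype.val h)
    omega
  · intro e
    have he := mF e e.2
    exact (harc _ he.1 _ he.2.1).1
  · intro e
    have hμ := (Finset.mem_filter.mp e.2).2
    refine le_trans ?_ hμ
    refine Finset.card_le_card_of_injOn Subtype.val ?_ Subtype.val_injective.injOn
    intro f hf
    have hf := (Finset.mem_filter.mp (Finset.mem_coe.mp hf)).2
    refine Finset.mem_coe.mpr (Finset.mem_filter.mpr ⟨(Finset.mem_filter.mp f.2).1, ?_⟩)
    rcases hf with h | h
    · left; exact ⟨(congrArg Subtype.val h.1).symm, (congrArg Subtype.val h.2).symm⟩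
    · right; exact ⟨(congrArg Subtype.val h.2).symm, (congrArg Subtype.val h.1).symm⟩
  · rw [Fintype.card_coe, Fintype.card_coe]; exact hbig

lemma incidences_eq (Q : Finset PX) (C : Finset (Set PX)) :
    incidences Q C = ∑ x ∈ Q, (C.filter (fun γ => x ∈ γ)).card := by
  unfold incidences
  simp only [Finset.card_filter]
  exact Finset.sum_comm

lemma lemmaA (k : ℕ) (hk : 1 ≤ k) (C : Finset (Set PX)) (hC : KIntersecting C k)
    (Q R : Finset PX) (hQR : Q ⊆ R) (T B : ℝ) (hB : 1 ≤ B) (hT : 2016 * B^2 * k ≤ T)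
    (hdeg : ∀ x ∈ Q, T^k / B ≤ ((C.filter (fun γ => x ∈ γ)).card : ℝ) ∧
      ((C.filter (fun γ => x ∈ γ)).card : ℝ) ≤ T^k)
    (hL : 4 * B * (k+1) * ((incidences (R \ Q) C : ℝ) + C.card) ≤ Q.card * T^k) :
    Q.card * (T^k)^2 * T ≤ 72 * 100352 * B^4 * k^3 *
      ((∑ e ∈ C.offDiag, ((e.1 ∩ e.2) \ (↑R : Set PX)).ncard : ℕ) : ℝ) := by
  have hk' : (1:ℝ) ≤ k := by exact_mod_cast hk
  have hBk : 1 ≤ B^2 * k := one_le_mul_of_one_le_of_one_le (one_le_pow₀ hB) hk'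
  have hT1 : 1 ≤ T := by nlinarith
  have hT0 : 0 < T := by linarith
  have hB0 : 0 < B := by linarith
  rcases Finset.eq_empty_or_nonempty Q with rfl | hQ
  · simp; positivity
  have hq : (1:ℝ) ≤ Q.card := by exact_mod_cast hQ.card_pos
  set q : ℝ := (Q.card : ℝ) with hqdef
  set Y : ℝ := ((∑ e ∈ C.offDiag, ((e.1 ∩ e.2) \ (↑R : Set PX)).ncard : ℕ) : ℝ) with hY
  set Δ := T^k with hΔ
  have hTΔ : T ≤ Δ := le_self_pow₀ hT1 (by omega)
  have hΔ0 : 0 < Δ := by linarith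
  set D := ⌊T / (4*B)⌋₊ with hD
  set M := ⌈8 * B * Δ / T⌉₊ with hM
  have hMl : 8 * B * Δ / T ≤ M := Nat.le_ceil _
  have hM1 : 1 ≤ M := Nat.ceil_pos.mpr (by positivity)
  have hMu : (M:ℝ) ≤ 9 * B * Δ / T := by
    have h1 : (M:ℝ) < 8 * B * Δ / T + 1 := Nat.ceil_lt_add_one (by positivity)
    have h2 : 1 ≤ B * Δ / T := by rw [le_div_iff₀ hT0]; nlinarith
    have : 9 * B * Δ / T = 8 * B * Δ / T + B * Δ / T := by ring
    linarith
  have hDk : (D:ℝ)^k ≤ Δ / (4*B) := by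
    have h1 : (D:ℝ) ≤ T / (4*B) := Nat.floor_le (by positivity)
    calc (D:ℝ)^k ≤ (T / (4*B))^k := by gcongr
      _ = Δ / (4*B)^k := by rw [div_pow]
      _ ≤ Δ / (4*B) := by
        gcongr
        exact le_self_pow₀ (by linarith) (by omega)
  have hDl : T / (4*B) < D + 1 := Nat.lt_floor_add_one _
  obtain ⟨F, hF1, hF2⟩ := window k hk C hC Q R hQR M D hM1 (by
    intro x hx
    have h1 := (hdeg x hx).2
    have h2 : 2 * Δ < ((D:ℝ)+1) * (M+1) := by
      calc 2 * Δ = T / (4*B) * (8 * B * Δ / T) := by field_simp; ring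
        _ < ((D:ℝ)+1) * (M+1) := by
          apply mul_lt_mul'' hDl (by linarith) (by positivity) (by positivity)
    have : (2 * ((C.filter (fun γ => x ∈ γ)).card : ℝ)) < ((D:ℝ)+1) * (M+1) := by linarith
    exact_mod_cast this)
  have hIQ : q * (Δ / B) ≤ (incidences Q C : ℝ) := by
    rw [incidences_eq, hqdef, ← nsmul_eq_mul]
    push_cast
    exact Finset.card_nsmul_le_sum _ _ _ (fun x hx => (hdeg x hx).1)
  have hF1' : (incidences Q C : ℝ) ≤ q * (D:ℝ)^k + k * F + k * C.card
      + (k+1) * incidences (R \ Q) C := by rw [hqdef]; exact_mod_cast hF1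
  have hloss : (k:ℝ) * C.card + (k+1) * incidences (R \ Q) C ≤ q * Δ / (4 * B) := by
    rw [le_div_iff₀ (by positivity)]
    have : (k:ℝ) * C.card ≤ (k+1) * C.card := by gcongr; linarith
    calc ((k:ℝ) * C.card + (k+1) * incidences (R \ Q) C) * (4*B)
        ≤ ((k+1) * C.card + (k+1) * incidences (R \ Q) C) * (4*B) := by gcongr
      _ = 4 * B * (k+1) * ((incidences (R \ Q) C : ℝ) + C.card) := by ring
      _ ≤ _ := hL
  have hD2 : q * (D:ℝ)^k ≤ q * Δ / (4*B) := by
    rw [mul_div_assoc]; gcongr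
  have e1 : q * (Δ / B) = 4 * (q * Δ / (4*B)) := by field_simp
  have e2 : q * Δ / (2*B) = 2 * (q * Δ / (4*B)) := by field_simp; ring
  have hkF : q * Δ / (2*B) ≤ k * F := by linarith
  have hF : q * Δ / (2*B*k) ≤ F := by
    rw [div_le_iff₀ (by positivity)] at hkF ⊢
    linarith
  have hbig : (112 * q * M : ℝ) ≤ F := by
    refine le_trans ?_ hF
    calc 112 * q * (M:ℝ) ≤ 112 * q * (9 * B * Δ / T) := by gcongr
      _ ≤ q * Δ / (2*B*k) := by
        rw [mul_div_assoc', div_le_div_iff₀ hT0 (by positivity)]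
        calc 112 * q * (9 * B * Δ) * (2*B*k) = q * Δ * (2016 * B^2 * k) := by ring
          _ ≤ q * Δ * T := by gcongr
  have h3 := hF2 (by rw [hqdef] at hbig; exact_mod_cast hbig)
  have hY0 : 0 ≤ Y := by rw [hY]; positivity
  have h4 : (q * Δ / (2*B*k))^3 ≤ 100352 * q^2 * (9 * B * Δ / T) * Y := by
    calc (q * Δ / (2*B*k))^3 ≤ (F:ℝ)^3 := by gcongr
      _ ≤ 100352 * q^2 * M * Y := h3
      _ ≤ _ := by gcongr
  have h5 : (q * Δ / (2*B*k))^3 = (q^2 * Δ / (8 * B^3 * k^3 * T)) * (q * Δ^2 * T) := by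
    field_simp; ring
  have h6 : 100352 * q^2 * (9 * B * Δ / T) * Y =
      (q^2 * Δ / (8 * B^3 * k^3 * T)) * (72 * 100352 * B^4 * k^3 * Y) := by
    field_simp; ring
  rw [h5, h6] at h4
  exact le_of_mul_le_mul_left h4 (by positivity)

lemma find_class (f : ℕ → ℝ) (hf : Monotone f) (x : ℝ) (J N : ℕ) (h1 : f J ≤ x) (h2 : x < f N) :
    ∃ j ∈ Finset.Ico J N, f j ≤ x ∧ x < f (j+1) := by
  have hex : ∃ m, x < f m := ⟨N, h2⟩
  set m := Nat.find hex with hm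
  have hm1 : x < f m := Nat.find_spec hex
  have hm2 : m ≤ N := Nat.find_min' hex h2
  have hJ : J < m := by
    by_contra h
    have := hf (not_lt.mp h)
    linarith
  refine ⟨m - 1, by rw [Finset.mem_Ico]; omega, ?_, ?_⟩
  · exact not_lt.mp (Nat.find_min hex (by omega))
  · rw [show m - 1 + 1 = m by omega]; exact hm1

lemma cover_sum (S : Finset PX) (Js : Finset ℕ) (Q : ℕ → Finset PX) (d : PX → ℝ)
    (hd : ∀ x, 0 ≤ d x) (h : ∀ p ∈ S, ∃ j ∈ Js, p ∈ Q j) :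
    ∑ p ∈ S, d p ≤ ∑ j ∈ Js, ∑ p ∈ Q j, d p := by
  calc ∑ p ∈ S, d p ≤ ∑ p ∈ S, ∑ j ∈ Js, if p ∈ Q j then d p else 0 := by
        refine Finset.sum_le_sum (fun p hp => ?_)
        obtain ⟨j, hj, hpj⟩ := h p hp
        have := Finset.single_le_sum (f := fun j => if p ∈ Q j then d p else 0)
          (fun i _ => by split_ifs <;> simp [hd]) hj
        simpa [hpj] using this
    _ = ∑ j ∈ Js, ∑ p ∈ S, if p ∈ Q j then d p else 0 := Finset.sum_comm
    _ ≤ _ := by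
        refine Finset.sum_le_sum (fun j _ => ?_)
        rw [← Finset.sum_filter]
        refine Finset.sum_le_sum_of_subset_of_nonneg ?_ (fun x _ _ => hd x)
        intro x hx; exact (Finset.mem_filter.mp hx).2

lemma offDiag_bound (k : ℕ) (C : Finset (Set PX)) (hC : KIntersecting C k) (R : Finset PX) :
    ∑ e ∈ C.offDiag, ((e.1 ∩ e.2) \ (↑R : Set PX)).ncard ≤ k * C.card ^ 2 := by
  have : ∑ e ∈ C.offDiag, ((e.1 ∩ e.2) \ (↑R : Set PX)).ncard ≤ C.offDiag.card • k := by
    refine Finset.sum_le_card_nsmul _ _ _ ?_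
    intro e he
    rw [Finset.mem_offDiag] at he
    obtain ⟨h1, h2⟩ := hC.2 _ he.1 _ he.2.1 he.2.2
    exact (Set.ncard_le_ncard Set.sdiff_subset h1).trans h2
  refine this.trans ?_
  rw [Finset.offDiag_card, smul_eq_mul, mul_comm]
  gcongr
  rw [sq]; omega

lemma offDiag_split (k : ℕ) (C : Finset (Set PX)) (hC : KIntersecting C k) (P R : Finset PX) :
    ∑ e ∈ C.offDiag, ((e.1 ∩ e.2) \ (↑R : Set PX)).ncard ≤
      ∑ e ∈ C.offDiag, ((e.1 ∩ e.2) \ (↑P : Set PX)).ncard +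
      ∑ x ∈ P \ R, (C.filter (fun γ => x ∈ γ)).card ^ 2 := by
  have h1 : ∀ e ∈ C.offDiag, ((e.1 ∩ e.2) \ (↑R : Set PX)).ncard ≤
      ((e.1 ∩ e.2) \ (↑P : Set PX)).ncard +
      ∑ x ∈ P \ R, if x ∈ e.1 ∧ x ∈ e.2 then 1 else 0 := by
    intro e he
    rw [Finset.mem_offDiag] at he
    obtain ⟨h1, h2⟩ := hC.2 _ he.1 _ he.2.1 he.2.2
    rw [← Finset.card_filter, ← Set.ncard_coe_finset]
    refine (Set.ncard_le_ncard ?_ ((h1.subset Set.sdiff_subset).union (Finset.finite_toSet _))).trans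
      (Set.ncard_union_le _ _)
    rintro x ⟨hx, hxR⟩
    by_cases hP : x ∈ P
    · right
      rw [Finset.mem_coe, Finset.mem_filter, Finset.mem_sdiff]
      exact ⟨⟨hP, hxR⟩, hx⟩
    · left; exact ⟨hx, hP⟩
  refine (Finset.sum_le_sum h1).trans ?_
  rw [Finset.sum_add_distrib]
  gcongr
  rw [Finset.sum_comm]
  refine Finset.sum_le_sum (fun x _ => ?_)
  rw [← Finset.card_filter, sq, ← Finset.card_product]
  apply Finset.card_le_card
  intro e he
  simp only [Finset.mem_filter, Finset.mem_offDiag, Finset.mem_product] at he ⊢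
  tauto

set_option maxHeartbeats 1000000 in
lemma assembly (k : ℕ) (hk : 1 ≤ k) (C : Finset (Set PX)) (hC : KIntersecting C k)
    (P : Finset PX) (u α ε K L : ℝ) (J N m : ℕ) (hu : 1 ≤ u) (hα : 0 < α) (hε : 0 < ε)
    (hαk : α^k = ε / 2)
    (hP : (P.card : ℝ) = u^(2*k+1)) (hCc : (C.card : ℝ) = u^(2*k+1))
    (hm : 2 * m = ∑ e ∈ C.offDiag, ((e.1 ∩ e.2) \ (↑P : Set PX)).ncard)
    (hK : K = 72 * 100352 * (2^k)^4 * k^3) (hL : L = 4 * 2^k * (k+1))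
    (h0 : 2016 * (2^k)^2 * k ≤ α * u)
    (hJ : 128 * K * k * L ≤ ε * α^(k+1) * 2^J)
    (hN1 : 1 ≤ N) (hN : u^(2*k+1) < (2^N * (α * u))^k)
    (hδ : N * L * u^(2*k+1) * (64 * L * 2^J) ≤ ε * u^(3*k+1))
    (hI : ε * u^(3*k+1) ≤ (incidences P C : ℝ))
    (hlast : 32 * K * (u^(2*k+1) * ((2^J * (α * u))^k)^2) ≤ ε * α^(k+1) * u^(4*k+2)) :
    ε * α^(k+1) * u^(4*k+2) ≤ 32 * K * (2 * m) := by
  have hu0 : 0 < u := by linarith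
  have hk' : (1:ℝ) ≤ k := by exact_mod_cast hk
  have hK0 : 0 < K := by rw [hK]; positivity
  have hL1 : 1 ≤ L := by
    rw [hL]
    have : (1:ℝ) ≤ 2^k := one_le_pow₀ (by norm_num)
    nlinarith
  have hL0 : 0 < L := by linarith
  have hB1 : (1:ℝ) ≤ 2^k := one_le_pow₀ (by norm_num)
  set A := ε * u^(3*k+1) with hA
  have hA0 : 0 < A := by positivity
  set d : PX → ℝ := fun x => ((C.filter (fun γ => x ∈ γ)).card : ℝ) with hd
  have hd0 : ∀ x, 0 ≤ d x := fun x => Nat.cast_nonneg _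
  have hinc : ∀ S : Finset PX, (incidences S C : ℝ) = ∑ p ∈ S, d p := by
    intro S; rw [incidences_eq]; push_cast; rfl
  let T : ℕ → ℝ := fun j => 2^j * (α * u)
  have hTpos : ∀ j, 0 < T j := fun j => by positivity
  have hTs : ∀ j, T (j+1) = 2 * T j := fun j => by simp only [T]; ring
  have hTmono : Monotone T := monotone_nat_of_le_succ (fun j => by
    rw [hTs]; linarith [hTpos j])
  have hfmono : Monotone (fun j => (T j)^k) := fun i j h => by
    have := hTmono h
    have := (hTpos i).le
    simp only; gcongr
  have hT0 : T 0 = α * u := by simp [T]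
  have hTbig : ∀ j, 2016 * (2^k)^2 * k ≤ T j := fun j => by
    have := hTmono (Nat.zero_le j); rw [hT0] at this; linarith
  let Q : ℕ → Finset PX := fun j => P.filter (fun p => (T j)^k ≤ d p ∧ d p < (T (j+1))^k)
  have hQdeg : ∀ j, ∀ x ∈ Q j, (T (j+1))^k / 2^k ≤ d x ∧ d x ≤ (T (j+1))^k := by
    intro j x hx
    obtain ⟨-, h1, h2⟩ := Finset.mem_filter.mp hx
    refine ⟨?_, h2.le⟩
    rw [← div_pow, hTs]
    simpa using h1
  have hIQ : ∀ j, ∑ p ∈ Q j, d p ≤ (Q j).card * (T (j+1))^k := by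
    intro j
    rw [← nsmul_eq_mul]
    exact Finset.sum_le_card_nsmul _ _ _ (fun x hx => (hQdeg j x hx).2)
  have hdn : ∀ x, d x < (T N)^k := by
    intro x
    refine lt_of_le_of_lt ?_ hN
    rw [← hCc]
    simp only [d]
    exact_mod_cast Finset.card_filter_le _ _
  set n := u^(2*k+1) with hn
  have hn0 : 0 < n := by positivity
  have hA' : n * (ε * u^k) = A := by rw [hn, hA]; ring
  -- high classes
  have hhigh : ∀ j, ∑ p ∈ Q j, d p ≤ L * n + K * k * n^2 / (T (j+1))^(k+1) := by
    intro j
    refine (hIQ j).trans ?_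
    have hTp := hTpos (j+1)
    by_cases h : L * n ≤ (Q j).card * (T (j+1))^k
    · have := lemmaA k hk C hC (Q j) (Q j) subset_rfl (T (j+1)) (2^k) hB1 (hTbig _)
        (hQdeg j) (by
          rw [Finset.sdiff_self, hinc, Finset.sum_empty, zero_add, hCc, ← hL]; exact h)
      have h2 : ((∑ e ∈ C.offDiag, ((e.1 ∩ e.2) \ (↑(Q j) : Set PX)).ncard : ℕ) : ℝ) ≤ k * n^2 := by
        rw [← hCc]
        exact_mod_cast offDiag_bound k C hC (Q j)
      rw [← hK] at this
      have h3 : (Q j).card * (T (j+1))^k ≤ K * k * n^2 / (T (j+1))^(k+1) := by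
        rw [le_div_iff₀ (by positivity)]
        calc (Q j).card * (T (j+1))^k * (T (j+1))^(k+1)
            = (Q j).card * ((T (j+1))^k)^2 * T (j+1) := by ring
          _ ≤ _ := this
          _ ≤ K * (k * n^2) := by gcongr
          _ = _ := by ring
      have : 0 ≤ L * n := by positivity
      linarith
    · have : 0 ≤ K * k * n^2 / (T (j+1))^(k+1) := by positivity
      linarith
  set H := P.filter (fun p => (T J)^k ≤ d p) with hH
  have hn2 : n^2 = u^(3*k+1) * u^(k+1) := by rw [hn]; ring
  have hhighsum : ∑ j ∈ Finset.Ico J N, ∑ p ∈ Q j, d p ≤ 2 * (A / (64 * L * 2^J)) := by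
    have hg : ∀ j ∈ Finset.Ico J N, ∑ p ∈ Q j, d p ≤ L * n +
        K * k * (n^2 / (T J)^(k+1)) * ((1/2)^(j-J)) := by
      intro j hj
      rw [Finset.mem_Ico] at hj
      refine (hhigh j).trans ?_
      have : K * k * n^2 / (T (j+1))^(k+1) ≤ K * k * (n^2 / (T J)^(k+1)) * ((1/2)^(j-J)) := by
        rw [mul_assoc (K*k), mul_div_assoc]
        gcongr
        have h1 : T (j+1) = 2^(j+1-J) * T J := by
          simp only [T]
          rw [← mul_assoc (2^(j+1-J)), ← pow_add]; congr 2; omega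
        have hTJ := hTpos J
        rw [h1, mul_pow, one_div, inv_pow, ← div_eq_mul_inv, div_div]
        apply div_le_div_of_nonneg_left (by positivity) (by positivity)
        rw [mul_comm]
        gcongr
        rw [← pow_mul]
        apply pow_le_pow_right₀ (by norm_num)
        calc j - J ≤ (j + 1 - J) * 1 := by omega
          _ ≤ (j+1-J) * (k+1) := by gcongr; omega
      linarith
    refine (Finset.sum_le_sum hg).trans ?_
    rw [Finset.sum_add_distrib, Finset.sum_const, ← Finset.mul_sum, Nat.card_Ico, nsmul_eq_mul]
    have e1 : ((N - J : ℕ) : ℝ) * (L * n) ≤ A / (64 * L * 2^J) := by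
      rw [le_div_iff₀ (by positivity)]
      refine le_trans ?_ hδ
      have : ((N - J : ℕ) : ℝ) ≤ N := by exact_mod_cast Nat.sub_le _ _
      calc ((N - J : ℕ) : ℝ) * (L * n) * (64 * L * 2^J) ≤ N * (L * n) * (64 * L * 2^J) := by gcongr
        _ = _ := by ring
    have e2 : ∑ j ∈ Finset.Ico J N, ((1:ℝ)/2)^(j-J) ≤ 2 := by
      rw [Finset.sum_Ico_eq_sum_range]
      simp only [Nat.add_sub_cancel_left]
      exact sum_geometric_two_le _
    have e3 : K * k * (n^2 / (T J)^(k+1)) * 2 ≤ A / (64 * L * 2^J) := by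
      have hTJ := hTpos J
      have : (T J)^(k+1) = 2^(J*(k+1)) * (α^(k+1) * u^(k+1)) := by
        simp only [T]; rw [mul_pow, mul_pow, ← pow_mul]
      rw [this, hn2, le_div_iff₀ (by positivity)]
      have e4 : K * k * (u^(3*k+1) * u^(k+1) / (2^(J*(k+1)) * (α^(k+1) * u^(k+1)))) * 2 *
          (64 * L * 2^J) = u^(3*k+1) * (128 * K * k * L) * 2^J / (2^(J*(k+1)) * α^(k+1)) := by
        field_simp; ring
      rw [e4, div_le_iff₀ (by positivity)]
      calc u^(3*k+1) * (128 * K * k * L) * 2^J ≤ u^(3*k+1) * (ε * α^(k+1) * 2^J) * 2^J := by gcongr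
        _ = A * α^(k+1) * 2^(J + J) := by rw [hA, pow_add]; ring
        _ ≤ A * α^(k+1) * 2^(J*(k+1)) := by
          gcongr
          · norm_num
          · nlinarith
        _ = _ := by ring
    have e5 : K * k * (n^2 / (T J)^(k+1)) * ∑ j ∈ Finset.Ico J N, ((1:ℝ)/2)^(j-J) ≤
        K * k * (n^2 / (T J)^(k+1)) * 2 := by
      have hTJ := hTpos J
      gcongr
    linarith
  have hIH : (incidences H C : ℝ) ≤ 2 * (A / (64 * L * 2^J)) := by
    rw [hinc]
    refine (cover_sum H (Finset.Ico J N) Q d hd0 ?_).trans hhighsum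
    intro p hp
    obtain ⟨hpP, hpd⟩ := Finset.mem_filter.mp hp
    obtain ⟨j, hj, hj'⟩ := find_class (fun j => (T j)^k) hfmono (d p) J N hpd (hdn p)
    exact ⟨j, hj, Finset.mem_filter.mpr ⟨hpP, hj'⟩⟩
  have hnA : n ≤ A / (64 * L * 2^J) := by
    rw [le_div_iff₀ (by positivity)]
    refine le_trans ?_ hδ
    have : 1 ≤ N * L := one_le_mul_of_one_le_of_one_le (by exact_mod_cast hN1) hL1
    have h2 : n ≤ N * L * n := le_mul_of_one_le_left hn0.le this
    gcongr
  -- choose class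
  have hex : ∃ j, j < J ∧ A / 16 * (1/2)^j ≤ ∑ p ∈ Q j, d p := by
    by_contra hcon
    push Not at hcon
    have hlow : ∑ p ∈ P.filter (fun p => ¬ (T 0)^k ≤ d p), d p ≤ A / 2 := by
      have h1 : ∑ p ∈ P.filter (fun p => ¬ (T 0)^k ≤ d p), d p ≤
          (P.filter (fun p => ¬ (T 0)^k ≤ d p)).card • (T 0)^k :=
        Finset.sum_le_card_nsmul _ _ _ (fun x hx => (not_le.mp (Finset.mem_filter.mp hx).2).le)
      refine h1.trans ?_
      have h3 : (T 0)^k = ε / 2 * u^k := by rw [hT0, mul_pow, hαk]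
      rw [nsmul_eq_mul]
      have h2 : ((P.filter (fun p => ¬ (T 0)^k ≤ d p)).card : ℝ) ≤ n := by
        rw [← hP]; exact_mod_cast Finset.card_filter_le _ _
      calc _ ≤ n * (T 0)^k := by
            have := hTpos 0
            gcongr
        _ = n * (ε / 2 * u^k) := by rw [h3]
        _ = A / 2 := by rw [← hA']; ring
    have hup : ∑ p ∈ P.filter (fun p => (T 0)^k ≤ d p), d p ≤
        ∑ j ∈ Finset.range J, ∑ p ∈ Q j, d p + ∑ j ∈ Finset.Ico J N, ∑ p ∈ Q j, d p := by
      have h1 := cover_sum (P.filter (fun p => (T 0)^k ≤ d p)) (Finset.range J ∪ Finset.Ico J N)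
        Q d hd0 (by
          intro p hp
          obtain ⟨hpP, hpd⟩ := Finset.mem_filter.mp hp
          obtain ⟨j, hj, hj'⟩ := find_class (fun j => (T j)^k) hfmono (d p) 0 N hpd (hdn p)
          refine ⟨j, ?_, Finset.mem_filter.mpr ⟨hpP, hj'⟩⟩
          simp only [Finset.mem_union, Finset.mem_range, Finset.mem_Ico] at hj ⊢
          omega)
      rw [Finset.sum_union] at h1
      · exact h1
      · rw [Finset.disjoint_left]; intro j hj hj'
        simp only [Finset.mem_range, Finset.mem_Ico] at hj hj'
        omega
    have hlowcl : ∑ j ∈ Finset.range J, ∑ p ∈ Q j, d p ≤ A / 8 := by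
      calc ∑ j ∈ Finset.range J, ∑ p ∈ Q j, d p ≤ ∑ j ∈ Finset.range J, A / 16 * (1/2)^j :=
            Finset.sum_le_sum (fun j hj => (hcon j (Finset.mem_range.mp hj)).le)
        _ = A / 16 * ∑ j ∈ Finset.range J, (1/2)^j := by rw [Finset.mul_sum]
        _ ≤ A / 16 * 2 := by gcongr; exact sum_geometric_two_le _
        _ = A / 8 := by ring
    have htot := Finset.sum_filter_add_sum_filter_not P (fun p => (T 0)^k ≤ d p) d
    rw [← hinc P] at htot
    have hsm : A / (64 * L * 2^J) ≤ A / 64 := by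
      apply div_le_div_of_nonneg_left hA0.le (by norm_num)
      have : (1:ℝ) ≤ 2^J := one_le_pow₀ (by norm_num)
      have : 1 ≤ L * 2^J := one_le_mul_of_one_le_of_one_le hL1 this
      linarith
    linarith
  obtain ⟨j, hjJ, hj⟩ := hex
  have hdisj : (Q j ∪ H) \ Q j = H := by
    rw [Finset.union_sdiff_left]
    apply Finset.sdiff_eq_self_of_disjoint
    rw [Finset.disjoint_left]
    intro x hx hx'
    have h1 := (Finset.mem_filter.mp hx).2
    have h2 := (Finset.mem_filter.mp hx').2
    have := hfmono (show j + 1 ≤ J by omega)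
    simp only at this
    linarith [h2.2]
  have hjJ2 : A / 16 * (1/2)^J ≤ ∑ p ∈ Q j, d p := by
    refine le_trans ?_ hj
    gcongr ?_ * ?_
    exact pow_le_pow_of_le_one (by norm_num) (by norm_num) hjJ.le
  have hTp := hTpos (j+1)
  have hmain := lemmaA k hk C hC (Q j) (Q j ∪ H) Finset.subset_union_left (T (j+1)) (2^k) hB1
    (hTbig _) (hQdeg j) (by
      rw [hdisj, hCc, ← hL]
      refine le_trans ?_ (hjJ2.trans (hIQ j))
      have h1 : (incidences H C : ℝ) + n ≤ 3 * (A / (64 * L * 2^J)) := by linarith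
      calc L * ((incidences H C : ℝ) + n) ≤ L * (3 * (A / (64 * L * 2^J))) := by gcongr
        _ = 3 / 64 * (A * (1/2)^J) := by
          rw [one_div, inv_pow]; field_simp
        _ ≤ 4 / 64 * (A * (1/2)^J) := by gcongr; norm_num
        _ = _ := by ring)
  rw [← hK] at hmain
  set Y := ((∑ e ∈ C.offDiag, ((e.1 ∩ e.2) \ (↑(Q j ∪ H) : Set PX)).ncard : ℕ) : ℝ) with hY
  have hYl : ε * α^(k+1) * u^(4*k+2) ≤ 16 * (K * Y) := by
    have h1 : A / 16 * (α*u)^(k+1) ≤ (Q j).card * ((T (j+1))^k)^2 * T (j+1) := by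
      calc A / 16 * (α*u)^(k+1) = (A / 16 * (1/2)^j) * (2^j * (α*u)^(k+1)) := by
            rw [one_div, inv_pow]; field_simp
        _ ≤ ((Q j).card * (T (j+1))^k) * (T (j+1))^(k+1) := by
            have h2 : 2^j * (α*u)^(k+1) ≤ (T (j+1))^(k+1) := by
              simp only [T]
              rw [mul_pow (2^(j+1))]
              gcongr
              rw [← pow_mul]
              apply pow_le_pow_right₀ (by norm_num)
              nlinarith
            have h3 := hj.trans (hIQ j)
            gcongr
        _ = _ := by ring
    have h2 : A / 16 * (α*u)^(k+1) = ε * α^(k+1) * u^(4*k+2) / 16 := by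
      rw [hA]; ring
    linarith
  have hYu : Y ≤ 2 * m + n * ((2^J * (α * u))^k)^2 := by
    have h1 := offDiag_split k C hC P (Q j ∪ H)
    rw [← hm] at h1
    have h2 : Y ≤ 2 * m + ∑ x ∈ P \ (Q j ∪ H), (d x)^2 := by
      rw [hY]; simp only [d]; exact_mod_cast h1
    refine h2.trans ?_
    gcongr
    have h3 : ∑ x ∈ P \ (Q j ∪ H), (d x)^2 ≤
        (P \ (Q j ∪ H)).card • ((2^J * (α * u))^k)^2 := by
      refine Finset.sum_le_card_nsmul _ _ _ (fun x hx => ?_)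
      have hx' := Finset.mem_sdiff.mp hx
      have : d x ≤ (T J)^k := by
        by_contra hc
        exact hx'.2 (Finset.mem_union_right _ (Finset.mem_filter.mpr ⟨hx'.1, (not_le.mp hc).le⟩))
      have h0 := hd0 x
      exact pow_le_pow_left₀ h0 this 2
    refine h3.trans ?_
    rw [nsmul_eq_mul]
    gcongr
    rw [← hP]
    exact_mod_cast Finset.card_le_card Finset.sdiff_subset
  have h1 : K * Y ≤ K * (2 * m + n * ((2^J * (α * u))^k)^2) := by gcongr
  rw [mul_add] at h1
  rw [mul_assoc] at hlast ⊢
  linarith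

theorem many_crossings_from_many_incidences :
    ∀ k : ℕ, 1 ≤ k → ∃ c : ℝ, 0 < c ∧
      ∀ ε : ℝ, 0 < ε → ∃ n₀ : ℕ, ∀ n : ℕ, n₀ ≤ n →
        ∀ P : Finset (ℝ × ℝ), ∀ C : Finset (Set (ℝ × ℝ)), ∀ m : ℕ,
          P.card = n → C.card = n → KIntersecting C k →
          2 * m = ∑ e ∈ C.offDiag, ((e.1 ∩ e.2) \ (↑P : Set (ℝ × ℝ))).ncard →
          ε * (n : ℝ) ^ ((3 * (k:ℝ) + 1) / (2 * (k:ℝ) + 1)) ≤ (incidences P C : ℝ) →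
          c * ε ^ ((2 * (k:ℝ) + 1) / (k:ℝ)) * (n : ℝ) ^ 2 ≤ (m : ℝ) := by
  intro k hk
  have hk' : (1:ℝ) ≤ k := by exact_mod_cast hk
  have hk0 : (0:ℝ) < k := by linarith
  obtain ⟨K, hK⟩ : ∃ K : ℝ, K = 72 * 100352 * (2^k)^4 * k^3 := ⟨_, rfl⟩
  obtain ⟨L, hL⟩ : ∃ L : ℝ, L = 4 * 2^k * (k+1) := ⟨_, rfl⟩
  have hK0 : 0 < K := by rw [hK]; positivity
  have hL0 : 0 < L := by rw [hL]; positivity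
  refine ⟨1 / (256 * K), by positivity, ?_⟩
  intro ε hε
  obtain ⟨α, hαd⟩ : ∃ α : ℝ, α = (ε/2)^(1/(k:ℝ)) := ⟨_, rfl⟩
  have hα : 0 < α := by rw [hαd]; positivity
  have hαk : α^k = ε / 2 := by
    rw [hαd, ← Real.rpow_natCast, ← Real.rpow_mul (by positivity), one_div,
      inv_mul_cancel₀ hk0.ne', Real.rpow_one]
  obtain ⟨J, hJ'⟩ := pow_unbounded_of_one_lt (128 * K * k * L / (ε * α^(k+1))) (one_lt_two (α := ℝ))
  have hJ : 128 * K * k * L ≤ ε * α^(k+1) * 2^J := by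
    rw [div_lt_iff₀ (by positivity)] at hJ'
    linarith
  obtain ⟨δ, hδd⟩ : ∃ δ : ℝ, δ = ε / (128 * L^2 * 2^J) := ⟨_, rfl⟩
  have hδ0 : 0 < δ := by rw [hδd]; positivity
  have hlog : 0 < δ * Real.log 2 := mul_pos hδ0 (Real.log_pos (by norm_num))
  have ev1 := (tendsto_exp_mul_div_rpow_atTop ((k:ℝ)+1) _ hlog).eventually_gt_atTop (2/ε)
  obtain ⟨U, hU⟩ := Filter.eventually_atTop.mp (ev1.and ((Filter.eventually_ge_atTop (1:ℝ)).and
    ((Filter.eventually_ge_atTop (2016 * (2^k)^2 * k / α)).and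
    ((Filter.eventually_ge_atTop (1/δ)).and
    (Filter.eventually_ge_atTop (32 * K * ((2^J * α)^k)^2 / (ε * α^(k+1))))))))
  refine ⟨⌈(max U 1)^(2*k+1)⌉₊, ?_⟩
  intro n hn P C m hP hC hKI hm hI
  have hn' : (max U 1)^(2*k+1) ≤ (n:ℝ) := Nat.ceil_le.mp hn
  obtain ⟨u, hud⟩ : ∃ u : ℝ, u = (n:ℝ)^(1/(2*(k:ℝ)+1)) := ⟨_, rfl⟩
  have hnn : (0:ℝ) ≤ n := Nat.cast_nonneg n
  have hu00 : 0 ≤ u := by rw [hud]; positivity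
  have hk2 : (2*(k:ℝ)+1) ≠ 0 := by positivity
  have hun : u^(2*k+1) = n := by
    rw [hud, ← Real.rpow_natCast, ← Real.rpow_mul hnn]
    push_cast
    rw [one_div, inv_mul_cancel₀ hk2, Real.rpow_one]
  have hup : (n:ℝ) ^ ((3 * (k:ℝ) + 1) / (2 * (k:ℝ) + 1)) = u^(3*k+1) := by
    rw [hud, ← Real.rpow_natCast, ← Real.rpow_mul hnn]
    push_cast
    congr 1
    field_simp
  have huU : U ≤ u := by
    refine (le_max_left U 1).trans ?_
    refine le_of_pow_le_pow_left₀ (n := 2*k+1) (by omega) hu00 ?_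
    rw [hun]; exact hn'
  obtain ⟨a1, a2, a3, a4, a5⟩ := hU u huU
  have hu0 : 0 < u := by linarith
  rw [hup] at hI
  have b3 : 2016 * (2^k)^2 * k ≤ α * u := by
    rw [div_le_iff₀ hα] at a3; linarith
  have b4 : 1 ≤ δ * u := by
    rw [div_le_iff₀ hδ0] at a4; linarith
  have b5 : 32 * K * ((2^J * α)^k)^2 ≤ u * (ε * α^(k+1)) := by
    rw [div_le_iff₀ (by positivity)] at a5; exact a5
  have hN1 : 1 ≤ ⌈δ * u⌉₊ := Nat.ceil_pos.mpr (by positivity)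
  have hN2 : (⌈δ * u⌉₊ : ℝ) ≤ 2 * (δ * u) := by
    have := Nat.ceil_lt_add_one (show 0 ≤ δ * u by positivity)
    linarith
  have key := assembly k hk C hKI P u α ε K L J ⌈δ * u⌉₊ m a2 hα hε hαk (by rw [hP, hun])
    (by rw [hC, hun]) hm hK hL b3 hJ hN1 ?_ ?_ hI ?_
  · have hn2 : (n:ℝ)^2 = u^(4*k+2) := by rw [← hun]; ring
    have h1 : ε ^ ((2 * (k:ℝ) + 1) / (k:ℝ)) = ε^2 * ε^(1/(k:ℝ)) := by
      rw [show (2 * (k:ℝ) + 1) / (k:ℝ) = 2 + 1/(k:ℝ) by field_simp, Real.rpow_add hε]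
      norm_num
    have h2 : ε^(1/(k:ℝ)) ≤ 2 * α := by
      have h3 : (2:ℝ)^(1/(k:ℝ)) ≤ 2 := by
        calc (2:ℝ)^(1/(k:ℝ)) ≤ (2:ℝ)^(1:ℝ) := by
              apply Real.rpow_le_rpow_of_exponent_le (by norm_num)
              rw [div_le_one hk0]; exact hk'
          _ = 2 := Real.rpow_one 2
      calc ε^(1/(k:ℝ)) = (2:ℝ)^(1/(k:ℝ)) * α := by
            rw [hαd, ← Real.mul_rpow (by norm_num) (by positivity)]; congr 1; ring
        _ ≤ 2 * α := by gcongr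
    have h4 : ε ^ ((2 * (k:ℝ) + 1) / (k:ℝ)) ≤ 4 * (ε * α^(k+1)) := by
      rw [h1, pow_succ α k, hαk]
      calc ε^2 * ε^(1/(k:ℝ)) ≤ ε^2 * (2 * α) := by gcongr
        _ = _ := by ring
    rw [hn2]
    calc 1 / (256 * K) * ε ^ ((2 * (k:ℝ) + 1) / (k:ℝ)) * u^(4*k+2)
        ≤ 1 / (256 * K) * (4 * (ε * α^(k+1))) * u^(4*k+2) := by gcongr
      _ = 1 / (64 * K) * (ε * α^(k+1) * u^(4*k+2)) := by field_simp; norm_num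
      _ ≤ 1 / (64 * K) * (32 * K * (2 * m)) := by gcongr
      _ = m := by field_simp; norm_num
  · have e1 : Real.exp (δ * Real.log 2 * u) ≤ (2:ℝ)^⌈δ * u⌉₊ := by
      rw [← Real.rpow_natCast, Real.rpow_def_of_pos (by norm_num)]
      apply Real.exp_le_exp.mpr
      have := Nat.le_ceil (δ * u)
      have hl : 0 < Real.log 2 := Real.log_pos (by norm_num)
      nlinarith
    have e2 : (2:ℝ)^⌈δ * u⌉₊ ≤ ((2:ℝ)^⌈δ * u⌉₊)^k :=
      le_self_pow₀ (one_le_pow₀ (by norm_num)) (by omega)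
    have e3 : 2 / ε * u^(k+1) < Real.exp (δ * Real.log 2 * u) := by
      rw [lt_div_iff₀ (by positivity)] at a1
      have : u ^ ((k:ℝ)+1) = u^(k+1) := by rw [← Real.rpow_natCast]; push_cast; rfl
      rwa [this] at a1
    calc u^(2*k+1) = (2 / ε * u^(k+1)) * (ε/2 * u^k) := by field_simp; ring
      _ < ((2:ℝ)^⌈δ * u⌉₊)^k * (ε/2 * u^k) := by
        apply mul_lt_mul_of_pos_right _ (by positivity)
        linarith
      _ = _ := by rw [mul_pow, mul_pow, hαk]
  · calc (⌈δ * u⌉₊ : ℝ) * L * u^(2*k+1) * (64 * L * 2^J)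
        ≤ (2 * (δ * u)) * L * u^(2*k+1) * (64 * L * 2^J) := by gcongr
      _ = ε * u^(2*k+2) := by rw [hδd]; field_simp; ring
      _ ≤ ε * u^(3*k+1) := by
        have := pow_le_pow_right₀ a2 (show 2*k+2 ≤ 3*k+1 by omega)
        gcongr ε * ?_
  · calc 32 * K * (u^(2*k+1) * ((2^J * (α * u))^k)^2)
        = 32 * K * ((2^J * α)^k)^2 * u^(4*k+1) := by
          rw [← mul_assoc (2^J), mul_pow (2^J * α) u]; ring
      _ ≤ u * (ε * α^(k+1)) * u^(4*k+1) := by gcongr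
      _ = _ := by ring
end
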